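/- arXiv:1707.01315 — 2 statements merged into one kernel-verified Lean document; each statement's English description precedes it below -/
import Mathlib

section
/- Stationary phase estimate with Dirichlet characters (minor arc case): There exist absolute constants c ∈ (0,1) and C > 0 such that the following holds. Let 1 ≤ H ≤ X, let f : ℕ → ℂ be supported on the integers in (X, 2X], let q ≥ 1 be an integer, let a be an integer coprime to q, and let β, η be real numbers with β ≠ 0, 0 < η ≤ c and |β| ≤ c·η. Set I := { t ∈ ℝ : η|β|X ≤ |t| ≤ |β|X/η }. Then ∫_{β−1/H}^{β+1/H} |S_f(a/q + θ)|² dθ ≤ C [ (d₂(q)⁴/(|β|²H²q)) · max_{q = q₀q₁} ∫_I ( ∑_{χ mod q₁} ∫_{t−|β|H}^{t+|β|H} |D[f](1/2 + it', χ, q₀)| dt' )² dt + ((η + 1/(|β|H))²/H²) ∫_ℝ ( ∑_{x ≤ n ≤ x+H} |f(n)| )² dx ], where the maximum is over factorizations of q into positive integers q₀, q₁. -/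
open scoped BigOperators
open Real MeasureTheory

/-- `e(x) = e^{2πix}`. -/
noncomputable def eR (x : ℝ) : ℂ := Complex.exp (2 * Real.pi * Complex.I * x)

/-- The exponential sum `S_f(θ) = ∑_n f(n) e(θn)` of a (finitely supported)
function `f : ℕ → ℂ`. -/
noncomputable def expSumR (f : ℕ → ℂ) (θ : ℝ) : ℂ := ∑ᶠ n : ℕ, f n * eR (θ * n)

/-- The twisted Dirichlet polynomial `D[f](s, χ, q₀) = ∑_n f(q₀n) χ(n) n^{-s}`. -/
noncomputable def dirPolyChar (f : ℕ → ℂ) (s : ℂ) {q₁ : ℕ}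
    (χ : DirichletCharacter ℂ q₁) (q₀ : ℕ) : ℂ :=
  ∑ᶠ n : ℕ, f (q₀ * n) * χ (n : ZMod q₁) / (n : ℂ) ^ s

/-- The triangle function. -/
noncomputable def triangleFun (s : ℝ) : ℝ := max 0 (1 - |s|)

lemma continuous_triangleFun : Continuous triangleFun := by
  unfold triangleFun; fun_prop

lemma triangleFun_eq_zero_of_notMem {s : ℝ} (hs : s ∉ Set.Icc (-1 : ℝ) 1) : triangleFun s = 0 := by
  unfold triangleFun
  apply max_eq_left
  by_contra! h
  exact hs (abs_le.mp (by linarith))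

lemma integrable_triangleFun : Integrable (fun s => (triangleFun s : ℂ)) := by
  have hc : Continuous (fun s => (triangleFun s : ℂ)) :=
    Complex.continuous_ofReal.comp continuous_triangleFun
  refine hc.integrable_of_hasCompactSupport ?_
  refine HasCompactSupport.intro (isCompact_Icc (a := (-1 : ℝ)) (b := 1)) fun s hs => ?_
  simp [triangleFun_eq_zero_of_notMem hs]

lemma integral_triangleFun_mul_exp {c : ℂ} (hc : c ≠ 0) :
    ∫ v : ℝ, (triangleFun v : ℂ) * Complex.exp (c * v)
      = (Complex.exp c + Complex.exp (-c) - 2) / c ^ 2 := by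
  have h0 : ∫ v : ℝ, (triangleFun v : ℂ) * Complex.exp (c * v)
      = ∫ v in (-1 : ℝ)..1, (triangleFun v : ℂ) * Complex.exp (c * v) := by
    rw [intervalIntegral.integral_of_le (by norm_num), ← integral_Icc_eq_integral_Ioc,
      setIntegral_eq_integral_of_forall_compl_eq_zero]
    intro s hs
    simp [triangleFun_eq_zero_of_notMem hs]
  have hcont : Continuous (fun v : ℝ => (triangleFun v : ℂ) * Complex.exp (c * v)) := by
    have := continuous_triangleFun
    fun_prop
  rw [h0, ← intervalIntegral.integral_add_adjacent_intervals (b := 0)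
    (hcont.intervalIntegrable _ _) (hcont.intervalIntegrable _ _)]
  have e (v : ℝ) : HasDerivAt (fun v : ℝ => Complex.exp (c * v)) (Complex.exp (c * v) * c) v := by
    have h1 : HasDerivAt (fun v : ℝ => c * (v : ℂ)) (c * 1) v :=
      (HasDerivAt.ofReal_comp (hasDerivAt_id v)).const_mul c
    simpa using h1.cexp
  have id' (v : ℝ) : HasDerivAt (fun v : ℝ => (v : ℂ)) 1 v := by
    simpa using (hasDerivAt_id v).ofReal_comp
  have h1 : ∫ v in (-1 : ℝ)..0, (triangleFun v : ℂ) * Complex.exp (c * v)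
      = 1 / c - 1 / c ^ 2 + Complex.exp (-c) / c ^ 2 := by
    have : ∫ v in (-1 : ℝ)..0, (triangleFun v : ℂ) * Complex.exp (c * v)
        = ∫ v in (-1 : ℝ)..0, (1 + (v : ℂ)) * Complex.exp (c * v) := by
      apply intervalIntegral.integral_congr
      intro v hv
      rw [Set.uIcc_of_le (by norm_num)] at hv
      have : triangleFun v = 1 + v := by
        unfold triangleFun
        rw [abs_of_nonpos hv.2, max_eq_right (by linarith [hv.1])]; ring
      simp [this]
    rw [this, intervalIntegral.integral_eq_sub_of_hasDerivAt
      (f := fun v : ℝ => (1 + (v : ℂ)) * Complex.exp (c * v) / c - Complex.exp (c * v) / c ^ 2)]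
    · simp
    · intro v _
      have := ((((id' v).const_add 1).mul (e v)).div_const c).sub ((e v).div_const (c ^ 2))
      refine this.congr_deriv ?_
      field_simp; ring
    · apply Continuous.intervalIntegrable; fun_prop
  have h2 : ∫ v in (0 : ℝ)..1, (triangleFun v : ℂ) * Complex.exp (c * v)
      = Complex.exp c / c ^ 2 - 1 / c - 1 / c ^ 2 := by
    have : ∫ v in (0 : ℝ)..1, (triangleFun v : ℂ) * Complex.exp (c * v)
        = ∫ v in (0 : ℝ)..1, (1 - (v : ℂ)) * Complex.exp (c * v) := by
      apply intervalIntegral.integral_congr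
      intro v hv
      rw [Set.uIcc_of_le (by norm_num)] at hv
      have : triangleFun v = 1 - v := by
        unfold triangleFun
        rw [abs_of_nonneg hv.1, max_eq_right (by linarith [hv.2])]
      simp [this]
    rw [this, intervalIntegral.integral_eq_sub_of_hasDerivAt
      (f := fun v : ℝ => (1 - (v : ℂ)) * Complex.exp (c * v) / c + Complex.exp (c * v) / c ^ 2)]
    · simp; ring
    · intro v _
      have := ((((id' v).const_sub 1).mul (e v)).div_const c).add ((e v).div_const (c ^ 2))
      refine this.congr_deriv ?_
      field_simp; ring
    · apply Continuous.intervalIntegrable; fun_prop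
  rw [h1, h2]; ring

lemma fourier_triangleFun (u : ℝ) :
    FourierTransform.fourier (fun s => (triangleFun s : ℂ)) u = ((sinc (π * u) ^ 2 : ℝ) : ℂ) := by
  rw [Real.fourier_eq']
  have h : ∀ v : ℝ, Complex.exp (↑(-2 * π * inner ℝ v u) * Complex.I) • (triangleFun v : ℂ)
      = (triangleFun v : ℂ) * Complex.exp ((-2 * π * u * Complex.I) * v) := by
    intro v
    rw [smul_eq_mul, mul_comm]
    congr 2
    simp; ring
  simp_rw [h]
  rcases eq_or_ne u 0 with rfl | hu
  · simp only [Complex.ofReal_zero, mul_zero, zero_mul, Complex.exp_zero, mul_one, sinc_zero,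
      one_pow, Complex.ofReal_one]
    rw [integral_complex_ofReal]
    norm_cast
    have h0 : ∫ v : ℝ, triangleFun v = ∫ v in (-1 : ℝ)..1, triangleFun v := by
      rw [intervalIntegral.integral_of_le (by norm_num), ← integral_Icc_eq_integral_Ioc,
        setIntegral_eq_integral_of_forall_compl_eq_zero]
      intro s hs
      exact triangleFun_eq_zero_of_notMem hs
    rw [h0, ← intervalIntegral.integral_add_adjacent_intervals (b := 0)
      (continuous_triangleFun.intervalIntegrable _ _)
      (continuous_triangleFun.intervalIntegrable _ _)]
    have h1 : ∫ v in (-1 : ℝ)..0, triangleFun v = ∫ v in (-1 : ℝ)..0, (1 + v) := by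
      apply intervalIntegral.integral_congr
      intro v hv
      rw [Set.uIcc_of_le (by norm_num)] at hv
      unfold triangleFun
      rw [abs_of_nonpos hv.2, max_eq_right (by linarith [hv.1])]; ring
    have h2 : ∫ v in (0 : ℝ)..1, triangleFun v = ∫ v in (0 : ℝ)..1, (1 - v) := by
      apply intervalIntegral.integral_congr
      intro v hv
      rw [Set.uIcc_of_le (by norm_num)] at hv
      unfold triangleFun
      rw [abs_of_nonneg hv.1, max_eq_right (by linarith [hv.2])]
    rw [h1, h2, intervalIntegral.integral_add (by simp) (by simp),
      intervalIntegral.integral_sub (by simp) (by simp)]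
    simp; norm_num
  · have hpu : (π : ℂ) * u ≠ 0 := by
      simp [hu, pi_ne_zero]
    rw [integral_triangleFun_mul_exp (by simp [hu, pi_ne_zero]),
      sinc_of_ne_zero (by simp [hu, pi_ne_zero])]
    push_cast
    have h3 : Complex.exp (-2 * π * u * Complex.I) + Complex.exp (-(-2 * π * u * Complex.I))
        = 2 * Complex.cos (2 * (π * u)) := by
      rw [Complex.two_cos]
      rw [add_comm]
      congr 2 <;> ring
    rw [h3, Complex.cos_two_mul]
    have h4 := Complex.sin_sq_add_cos_sq ((π : ℂ) * u)
    have : (-2 * (π : ℂ) * u * Complex.I) ^ 2 = - 4 * (π * u) ^ 2 := by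
      linear_combination 4 * (π * u : ℂ) ^ 2 * Complex.I_sq
    rw [this, div_pow, div_eq_div_iff (by simp [hu, pi_ne_zero]) (pow_ne_zero 2 hpu)]
    linear_combination (4 * (π * u : ℂ) ^ 2) * h4

lemma integrable_sinc_sq : Integrable (fun u : ℝ => sinc (π * u) ^ 2) := by
  have : Integrable (fun u : ℝ => sinc u ^ 2) := by
    refine (integrable_inv_one_add_sq.const_mul 2).mono'
      (continuous_sinc.pow 2).aestronglyMeasurable (Filter.Eventually.of_forall fun u => ?_)
    rw [Real.norm_eq_abs, abs_of_nonneg (sq_nonneg _), ← div_eq_mul_inv,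
      le_div_iff₀ (by positivity)]
    have h1 : sinc u ^ 2 ≤ 1 := by
      rw [sq_le_one_iff_abs_le_one, abs_le]
      exact ⟨neg_one_le_sinc u, sinc_le_one u⟩
    have h2 : (sinc u * u) ^ 2 ≤ 1 := by
      rcases eq_or_ne u 0 with rfl | hu
      · simp
      · rw [sinc_of_ne_zero hu, div_mul_cancel₀ _ hu]
        exact sin_sq_le_one u
    nlinarith
  exact this.comp_mul_left' pi_ne_zero

lemma integral_sinc_sq_mul_exp (s : ℝ) :
    ∫ u : ℝ, ((sinc (π * u) ^ 2 : ℝ) : ℂ) * Complex.exp (2 * π * Complex.I * (s * u))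
      = (triangleFun s : ℂ) := by
  have hF : FourierTransform.fourier (fun s => (triangleFun s : ℂ))
      = fun u : ℝ => ((sinc (π * u) ^ 2 : ℝ) : ℂ) := funext fourier_triangleFun
  have h := integrable_triangleFun.fourierInv_fourier_eq (v := s)
    (by rw [hF]; exact integrable_sinc_sq.ofReal)
    (Complex.continuous_ofReal.comp continuous_triangleFun).continuousAt
  rw [hF, Real.fourierInv_eq'] at h
  rw [← h]
  congr 1
  ext u
  rw [smul_eq_mul, mul_comm]
  congr 2
  simp; ring

lemma four_div_pi_sq_le_sinc_sq {u : ℝ} (hu : |u| ≤ 1 / 2) : 4 / π ^ 2 ≤ sinc (π * u) ^ 2 := by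
  have key : ∀ u : ℝ, 0 ≤ u → u ≤ 1 / 2 → 2 / π ≤ sinc (π * u) := by
    intro u h0 h1
    rcases h0.eq_or_lt with rfl | h0
    · simp only [mul_zero, sinc_zero]
      rw [div_le_one pi_pos]; exact two_le_pi
    · have hp : 0 < π * u := by positivity
      rw [sinc_of_ne_zero hp.ne', le_div_iff₀ hp]
      exact mul_le_sin hp.le (by nlinarith [pi_pos])
  have h2 : sinc (π * u) = sinc (π * |u|) := by
    rcases abs_cases u with ⟨h, _⟩ | ⟨h, _⟩ <;> rw [h]
    rw [mul_neg, sinc_neg]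
  rw [h2]
  calc 4 / π ^ 2 = (2 / π) ^ 2 := by ring
    _ ≤ _ := by gcongr; exact key _ (abs_nonneg u) hu

section Gallagher

variable {Ω : Type*} [MeasurableSpace Ω] {μ : Measure Ω} [SFinite μ] {ψ : Ω → ℂ} {ξ : Ω → ℝ}

/-- Indicator function of `[0, l]`. -/
noncomputable def windowInd (l y : ℝ) : ℝ := (Set.Icc (0 : ℝ) l).indicator 1 y

lemma measurable_windowInd (l : ℝ) : Measurable (windowInd l) :=
  measurable_one.indicator measurableSet_Icc

lemma windowInd_nonneg (l y : ℝ) : 0 ≤ windowInd l y := Set.indicator_nonneg (by simp) y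

lemma windowInd_le_one (l y : ℝ) : windowInd l y ≤ 1 := by
  unfold windowInd; rw [Set.indicator_apply]; split_ifs <;> simp

lemma windowInd_of_mem {l y : ℝ} (h : y ∈ Set.Icc 0 l) : windowInd l y = 1 :=
  Set.indicator_of_mem h _

lemma windowInd_of_notMem {l y : ℝ} (h : y ∉ Set.Icc 0 l) : windowInd l y = 0 :=
  Set.indicator_of_notMem h _

lemma integrable_windowInd (l : ℝ) : Integrable (windowInd l) := by
  refine (integrable_indicator_iff measurableSet_Icc).2 ?_
  simp [Pi.one_def]

/-- Mass of `ψ` on the window `[x, x + l]`. -/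
noncomputable def windowMass (μ : Measure Ω) (ψ : Ω → ℂ) (ξ : Ω → ℝ) (l x : ℝ) : ℝ :=
  ∫ ω, windowInd l (ξ ω - x) * ‖ψ ω‖ ∂μ

lemma integral_windowInd_mul_windowInd {l : ℝ} (a b : ℝ) :
    ∫ x : ℝ, windowInd l (a - x) * windowInd l (b - x) = max 0 (l - |a - b|) := by
  have h : (fun x : ℝ => windowInd l (a - x) * windowInd l (b - x))
      = (Set.Icc (max a b - l) (min a b)).indicator 1 := by
    ext x
    simp only [windowInd, Set.indicator_apply, Set.mem_Icc, Pi.one_apply, sub_le_iff_le_add,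
      le_min_iff, max_le_iff, sub_nonneg]
    split_ifs <;> grind
  rw [h, integral_indicator_one measurableSet_Icc, Real.volume_real_Icc, max_comm]
  congr 1
  rcases le_total a b with h | h
  · rw [min_eq_left h, max_eq_right h, abs_of_nonpos (by linarith)]; ring
  · rw [min_eq_right h, max_eq_left h, abs_of_nonneg (by linarith)]; ring

lemma integrable_window_prod {l : ℝ} (hψ : Integrable ψ μ) (hξ : Measurable ξ) :
    Integrable (Function.uncurry fun (x : ℝ) (p : Ω × Ω) =>
      (windowInd l (ξ p.1 - x) * windowInd l (ξ p.2 - x)) * (‖ψ p.1‖ * ‖ψ p.2‖))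
      (volume.prod (μ.prod μ)) := by
  have hi := measurable_windowInd l
  have hpp : Integrable (fun p : Ω × Ω => ‖ψ p.1‖ * ‖ψ p.2‖) (μ.prod μ) :=
    hψ.norm.mul_prod hψ.norm
  have hm : AEStronglyMeasurable (Function.uncurry fun (x : ℝ) (p : Ω × Ω) =>
      (windowInd l (ξ p.1 - x) * windowInd l (ξ p.2 - x)) * (‖ψ p.1‖ * ‖ψ p.2‖))
      (volume.prod (μ.prod μ)) := by
    have h1 : Measurable fun z : ℝ × (Ω × Ω) => windowInd l (ξ z.2.1 - z.1) := by
      fun_prop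
    have h2 : Measurable fun z : ℝ × (Ω × Ω) => windowInd l (ξ z.2.2 - z.1) := by
      fun_prop
    exact (h1.mul h2).aestronglyMeasurable.mul hpp.aestronglyMeasurable.comp_snd
  rw [integrable_prod_iff' hm]
  have hind : ∀ a b : ℝ, Integrable (fun x : ℝ => windowInd l (a - x) * windowInd l (b - x)) := by
    intro a b
    refine ((integrable_windowInd l).comp_sub_left a).mono ?_
      (Filter.Eventually.of_forall fun x => ?_)
    · apply Measurable.aestronglyMeasurable
      fun_prop
    · rw [norm_mul]
      refine mul_le_of_le_one_right (norm_nonneg _) ?_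
      rw [Real.norm_eq_abs, abs_of_nonneg (windowInd_nonneg _ _)]
      exact windowInd_le_one _ _
  refine ⟨Filter.Eventually.of_forall fun p =>
    (hind (ξ p.1) (ξ p.2)).mul_const (‖ψ p.1‖ * ‖ψ p.2‖), ?_⟩
  have : ∀ p : Ω × Ω, ∫ x : ℝ, ‖(windowInd l (ξ p.1 - x) * windowInd l (ξ p.2 - x))
        * (‖ψ p.1‖ * ‖ψ p.2‖)‖ = max 0 (l - |ξ p.1 - ξ p.2|) * (‖ψ p.1‖ * ‖ψ p.2‖) := by
    intro p
    rw [← integral_windowInd_mul_windowInd, ← integral_mul_const]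
    congr 1
    ext x
    rw [Real.norm_eq_abs, abs_of_nonneg]
    exact mul_nonneg (mul_nonneg (windowInd_nonneg _ _) (windowInd_nonneg _ _)) (by positivity)
  simp only [Function.uncurry_apply_pair, this]
  refine hpp.bdd_mul (c := |l|) ?_ (Filter.Eventually.of_forall fun p => ?_)
  · apply Measurable.aestronglyMeasurable
    fun_prop
  · rw [Real.norm_eq_abs, abs_of_nonneg (le_max_left _ _)]
    refine max_le (abs_nonneg _) ?_
    linarith [abs_nonneg (ξ p.1 - ξ p.2), le_abs_self l]

lemma integral_mul_windowInd_sq {l : ℝ} (x : ℝ) :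
    windowMass μ ψ ξ l x ^ 2 = ∫ p : Ω × Ω,
      (windowInd l (ξ p.1 - x) * windowInd l (ξ p.2 - x)) * (‖ψ p.1‖ * ‖ψ p.2‖) ∂(μ.prod μ) := by
  unfold windowMass
  rw [sq, ← integral_prod_mul]
  congr 1
  ext p
  ring

lemma integrable_windowMass_sq {l : ℝ} (hψ : Integrable ψ μ) (hξ : Measurable ξ) :
    Integrable (fun x => windowMass μ ψ ξ l x ^ 2) := by
  simp only [integral_mul_windowInd_sq]
  exact (integrable_window_prod (l := l) hψ hξ).integral_prod_left

lemma integral_windowMass_sq {l : ℝ} (hψ : Integrable ψ μ) (hξ : Measurable ξ) :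
    ∫ x, windowMass μ ψ ξ l x ^ 2
      = ∫ p : Ω × Ω, max 0 (l - |ξ p.1 - ξ p.2|) * (‖ψ p.1‖ * ‖ψ p.2‖) ∂(μ.prod μ) := by
  simp only [integral_mul_windowInd_sq]
  rw [integral_integral_swap (integrable_window_prod (l := l) hψ hξ)]
  congr 1
  ext p
  rw [← integral_windowInd_mul_windowInd, ← integral_mul_const]

/-- Gallagher's lemma for a general complex measure on the line. -/
lemma gallagher {l : ℝ} (hl : 0 < l) (hψ : Integrable ψ μ) (hξ : Measurable ξ) :
    ∫ u in (-(1 / l))..(1 / l),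
      ‖∫ ω, ψ ω * Complex.exp (2 * π * Complex.I * (ξ ω * u)) ∂μ‖ ^ 2
      ≤ π ^ 2 / l ^ 2 * ∫ x, windowMass μ ψ ξ l x ^ 2 := by
  set L := l / 2 with hL
  have hL0 : 0 < L := by positivity
  set P : ℝ → ℂ := fun u => ∫ ω, ψ ω * Complex.exp (2 * π * Complex.I * (ξ ω * u)) ∂μ with hP
  set E : ℝ → ℝ → ℂ := fun s u => Complex.exp (2 * π * Complex.I * (s * u)) with hE
  have hEn : ∀ s u, ‖E s u‖ = 1 := by
    intro s u
    have : (2 * π * Complex.I * (s * u) : ℂ) = ((2 * π * (s * u) : ℝ) : ℂ) * Complex.I := by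
      push_cast; ring
    simp only [hE, this, Complex.norm_exp_ofReal_mul_I]
  set w : ℝ → ℝ := fun u => sinc (π * (L * u)) ^ 2 with hw
  have hwi : Integrable w := integrable_sinc_sq.comp_mul_left' hL0.ne'
  set F : ℝ → Ω × Ω → ℂ := fun u p =>
    (w u : ℂ) * (ψ p.1 * (starRingEnd ℂ) (ψ p.2)) * E (ξ p.1 - ξ p.2) u with hF
  have hψψ : Integrable (fun p : Ω × Ω => ψ p.1 * (starRingEnd ℂ) (ψ p.2)) (μ.prod μ) :=
    hψ.mul_prod (by simpa using (Complex.conjCLE.toContinuousLinearMap.integrable_comp hψ))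
  have hFi : Integrable (Function.uncurry F) (volume.prod (μ.prod μ)) := by
    have h1 : Integrable (fun z : ℝ × (Ω × Ω) =>
        (w z.1 : ℂ) * (ψ z.2.1 * (starRingEnd ℂ) (ψ z.2.2))) (volume.prod (μ.prod μ)) :=
      hwi.ofReal.mul_prod hψψ
    refine h1.mul_bdd (c := 1) ?_ (Filter.Eventually.of_forall fun z => (hEn _ _).le)
    apply Measurable.aestronglyMeasurable
    fun_prop
  have hFP : ∀ u, ∫ p, F u p ∂(μ.prod μ) = ((w u * ‖P u‖ ^ 2 : ℝ) : ℂ) := by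
    intro u
    have h1 : ((‖P u‖ ^ 2 : ℝ) : ℂ) = P u * (starRingEnd ℂ) (P u) := by
      rw [Complex.mul_conj, Complex.normSq_eq_norm_sq]
    rw [Complex.ofReal_mul, h1]
    simp only [hP]
    rw [← integral_conj, ← integral_prod_mul, ← integral_const_mul]
    congr 1
    ext p
    simp only [hF, hE, map_mul, ← Complex.exp_conj, map_ofNat, Complex.conj_ofReal, Complex.conj_I]
    have : Complex.exp (2 * π * Complex.I * (((ξ p.1 - ξ p.2 : ℝ) : ℂ) * u))
        = Complex.exp (2 * π * Complex.I * (ξ p.1 * u))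
          * Complex.exp (2 * π * -Complex.I * (ξ p.2 * u)) := by
      rw [← Complex.exp_add]; congr 1; push_cast; ring
    rw [this]; ring
  have hwP : Integrable (fun u => w u * ‖P u‖ ^ 2) := by
    have := hFi.integral_prod_left
    simp only [Function.uncurry_apply_pair, hFP] at this
    exact_mod_cast this.re
  have hker : ∀ s : ℝ, ∫ u : ℝ, (w u : ℂ) * E s u = ((1 / L * triangleFun (s / L) : ℝ) : ℂ) := by
    intro s
    have := integral_sinc_sq_mul_exp (s / L)
    rw [Complex.ofReal_mul, ← this]
    have h2 := Measure.integral_comp_mul_left (fun u : ℝ => ((sinc (π * u) ^ 2 : ℝ) : ℂ)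
      * Complex.exp (2 * π * Complex.I * (((s / L : ℝ) : ℂ) * u))) L
    rw [abs_of_pos (inv_pos.2 hL0)] at h2
    rw [one_div, ← Complex.real_smul, ← h2]
    congr 1
    ext u
    simp only [hw, hE]
    congr 3
    push_cast
    have : (L : ℂ) ≠ 0 := by exact_mod_cast hL0.ne'
    field_simp
  have hswap := integral_integral_swap hFi
  simp only [hFP] at hswap
  rw [integral_complex_ofReal] at hswap
  have hinner : ∀ p : Ω × Ω, ∫ u, F u p
      = ψ p.1 * (starRingEnd ℂ) (ψ p.2) *
          ((1 / L * triangleFun ((ξ p.1 - ξ p.2) / L) : ℝ) : ℂ) := by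
    intro p
    rw [← hker, ← integral_const_mul]
    congr 1; ext u
    simp only [hF]; ring
  simp only [hinner] at hswap
  have hmass : Integrable (fun p : Ω × Ω =>
      max 0 (l - |ξ p.1 - ξ p.2|) * (‖ψ p.1‖ * ‖ψ p.2‖)) (μ.prod μ) := by
    refine ((hψ.norm.mul_prod hψ.norm).bdd_mul (c := l) ?_
      (Filter.Eventually.of_forall fun p => ?_))
    · apply Measurable.aestronglyMeasurable
      fun_prop
    · rw [Real.norm_eq_abs, abs_of_nonneg (le_max_left _ _)]
      exact max_le hl.le (by linarith [abs_nonneg (ξ p.1 - ξ p.2)])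
  have hbound : ∫ u, w u * ‖P u‖ ^ 2 ≤ 4 / l ^ 2 * ∫ x, windowMass μ ψ ξ l x ^ 2 := by
    rw [integral_windowMass_sq hψ hξ, ← integral_const_mul]
    calc ∫ u, w u * ‖P u‖ ^ 2 ≤ ‖((∫ u, w u * ‖P u‖ ^ 2 : ℝ) : ℂ)‖ := by
          rw [Complex.norm_real]; exact le_abs_self _
      _ ≤ _ := by
        rw [hswap]
        refine norm_integral_le_of_norm_le (hmass.const_mul _)
          (Filter.Eventually.of_forall fun p => ?_)
        rw [norm_mul, norm_mul, RCLike.norm_conj, Complex.norm_real, Real.norm_eq_abs]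
        have h4 : |1 / L * triangleFun ((ξ p.1 - ξ p.2) / L)|
            ≤ 4 / l ^ 2 * max 0 (l - |ξ p.1 - ξ p.2|) := by
          rw [abs_of_nonneg (mul_nonneg (by positivity) (le_max_left _ _))]
          have : 4 / l ^ 2 = 1 / L * (1 / L) := by rw [hL]; field_simp; norm_num
          rw [this, mul_assoc]
          gcongr
          unfold triangleFun
          refine max_le (mul_nonneg (by positivity) (le_max_left _ _)) ?_
          rw [abs_div, abs_of_pos hL0]
          calc 1 - |ξ p.1 - ξ p.2| / L = 1 / L * (L - |ξ p.1 - ξ p.2|) := by field_simp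
            _ ≤ _ := by
              gcongr
              exact le_max_of_le_right (by linarith)
        calc _ ≤ ‖ψ p.1‖ * ‖ψ p.2‖ * (4 / l ^ 2 * max 0 (l - |ξ p.1 - ξ p.2|)) := by gcongr
          _ = _ := by ring
  have hlow : ∀ u ∈ Set.Ioc (-(1 / l)) (1 / l), ‖P u‖ ^ 2 ≤ π ^ 2 / 4 * (w u * ‖P u‖ ^ 2) := by
    intro u hu
    have h1 : 4 / π ^ 2 ≤ w u := by
      apply four_div_pi_sq_le_sinc_sq
      rw [abs_mul, abs_of_pos hL0, hL]
      have : |u| ≤ 1 / l := abs_le.2 ⟨hu.1.le, hu.2⟩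
      calc l / 2 * |u| ≤ l / 2 * (1 / l) := by gcongr
        _ = 1 / 2 := by field_simp
    calc ‖P u‖ ^ 2 = π ^ 2 / 4 * (4 / π ^ 2 * ‖P u‖ ^ 2) := by
          have := pi_ne_zero; field_simp
      _ ≤ _ := by gcongr
  rw [intervalIntegral.integral_of_le (by have : 0 < 1 / l := by positivity
                                          linarith)]
  calc ∫ u in Set.Ioc (-(1 / l)) (1 / l), ‖P u‖ ^ 2
      ≤ ∫ u in Set.Ioc (-(1 / l)) (1 / l), π ^ 2 / 4 * (w u * ‖P u‖ ^ 2) := by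
        refine integral_mono_of_nonneg (Filter.Eventually.of_forall fun u => by positivity)
          (hwP.const_mul _).integrableOn ?_
        exact (ae_restrict_iff' measurableSet_Ioc).2 (Filter.Eventually.of_forall hlow)
    _ ≤ ∫ u, π ^ 2 / 4 * (w u * ‖P u‖ ^ 2) := by
        refine setIntegral_le_integral (hwP.const_mul _) (Filter.Eventually.of_forall fun u => ?_)
        simp only [hw, Pi.zero_apply]; positivity
    _ = π ^ 2 / 4 * ∫ u, w u * ‖P u‖ ^ 2 := integral_const_mul _ _
    _ ≤ π ^ 2 / 4 * (4 / l ^ 2 * ∫ x, windowMass μ ψ ξ l x ^ 2) := by gcongr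
    _ = _ := by ring

end Gallagher

section Oscillatory

/-- `e(Y e^v - ξ v)`. -/
noncomputable def oscExp (Y ξ v : ℝ) : ℂ :=
  Complex.exp (((2 * π * (Y * exp v - ξ * v) : ℝ) : ℂ) * Complex.I)

/-- Derivative of the phase of `oscExp`. -/
noncomputable def oscFreq (Y ξ v : ℝ) : ℝ := 2 * π * (Y * exp v - ξ)

/-- Second (and third) derivative of the phase of `oscExp`. -/
noncomputable def oscCurv (Y v : ℝ) : ℝ := 2 * π * (Y * exp v)

lemma abs_oscCurv (Y v : ℝ) : |oscCurv Y v| = 2 * π * (|Y| * exp v) := by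
  rw [oscCurv, abs_mul, abs_mul Y, abs_of_pos (exp_pos v), abs_of_pos two_pi_pos]

lemma norm_oscExp (Y ξ v : ℝ) : ‖oscExp Y ξ v‖ = 1 := Complex.norm_exp_ofReal_mul_I _

lemma hasDerivAt_oscFreq (Y ξ v : ℝ) : HasDerivAt (oscFreq Y ξ) (oscCurv Y v) v :=
  ((((Real.hasDerivAt_exp v).const_mul Y).sub_const ξ).const_mul (2 * π))

lemma hasDerivAt_oscCurv (Y v : ℝ) : HasDerivAt (oscCurv Y) (oscCurv Y v) v :=
  (((Real.hasDerivAt_exp v).const_mul Y).const_mul (2 * π))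

lemma hasDerivAt_oscExp (Y ξ v : ℝ) :
    HasDerivAt (oscExp Y ξ) (oscExp Y ξ v * ((oscFreq Y ξ v : ℂ) * Complex.I)) v := by
  have h : HasDerivAt (fun v : ℝ => 2 * π * (Y * exp v - ξ * v)) (oscFreq Y ξ v) v := by
    have := ((((Real.hasDerivAt_exp v).const_mul Y).sub
      ((hasDerivAt_id v).const_mul ξ)).const_mul (2 * π))
    refine this.congr_deriv ?_
    simp [oscFreq]
  exact (h.ofReal_comp.mul_const Complex.I).cexp

lemma continuous_oscExp (Y ξ : ℝ) : Continuous (oscExp Y ξ) := by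
  unfold oscExp; fun_prop

lemma continuous_oscFreq (Y ξ : ℝ) : Continuous (oscFreq Y ξ) := by
  unfold oscFreq; fun_prop

lemma continuous_oscCurv (Y : ℝ) : Continuous (oscCurv Y) := by
  unfold oscCurv; fun_prop

lemma integral_by_parts_oscExp {Y ξ : ℝ} {r r' : ℝ → ℝ}
    (hr : ∀ v ∈ Set.Icc (-3 : ℝ) 3, HasDerivAt r (r' v) v)
    (hr' : ContinuousOn r' (Set.Icc (-3) 3)) (h1 : r (-3) = 0) (h2 : r 3 = 0) :
    ∫ v in (-3 : ℝ)..3, ((r v * oscFreq Y ξ v : ℝ) : ℂ) * oscExp Y ξ v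
      = Complex.I * ∫ v in (-3 : ℝ)..3, (r' v : ℂ) * oscExp Y ξ v := by
  have hu : Set.uIcc (-3 : ℝ) 3 = Set.Icc (-3) 3 := Set.uIcc_of_le (by norm_num)
  have hrc : ContinuousOn r (Set.Icc (-3) 3) := fun v hv =>
    (hr v hv).continuousAt.continuousWithinAt
  have c1 : IntervalIntegrable (fun v => ((r v * oscFreq Y ξ v : ℝ) : ℂ) * oscExp Y ξ v)
      volume (-3) 3 := by
    apply ContinuousOn.intervalIntegrable
    rw [hu]
    exact (Complex.continuous_ofReal.comp_continuousOn
      (hrc.mul (continuous_oscFreq Y ξ).continuousOn)).mul (continuous_oscExp Y ξ).continuousOn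
  have c2 : IntervalIntegrable (fun v => (r' v : ℂ) * oscExp Y ξ v) volume (-3) 3 := by
    apply ContinuousOn.intervalIntegrable
    rw [hu]
    exact (Complex.continuous_ofReal.comp_continuousOn hr').mul
      (continuous_oscExp Y ξ).continuousOn
  have h := intervalIntegral.integral_eq_sub_of_hasDerivAt (a := -3) (b := 3)
    (f := fun v => -Complex.I * ((r v : ℂ) * oscExp Y ξ v))
    (f' := fun v => ((r v * oscFreq Y ξ v : ℝ) : ℂ) * oscExp Y ξ v
      - Complex.I * ((r' v : ℂ) * oscExp Y ξ v)) ?_ ?_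
  · rw [intervalIntegral.integral_sub c1 (c2.const_mul _),
      intervalIntegral.integral_const_mul] at h
    simp only [h1, h2, Complex.ofReal_zero, zero_mul, mul_zero, sub_zero] at h
    exact sub_eq_zero.mp h
  · intro v hv
    rw [hu] at hv
    have := (((hr v hv).ofReal_comp.mul (hasDerivAt_oscExp Y ξ v)).const_mul (-Complex.I))
    refine this.congr_deriv ?_
    push_cast
    linear_combination (-(r v : ℂ) * oscFreq Y ξ v * oscExp Y ξ v) * Complex.I_sq
  · exact c1.sub (c2.const_mul _)

variable {a a' a'' : ℝ → ℝ} {A : ℝ}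

lemma norm_oscIntegral_le_of_le_abs_oscFreq {Y ξ M K : ℝ} (hM : 0 < M)
    (ha : ∀ v, HasDerivAt a (a' v) v) (ha' : ∀ v, HasDerivAt a' (a'' v) v)
    (ca : Continuous a'') (b0 : ∀ v, |a v| ≤ A) (b1 : ∀ v, |a' v| ≤ A) (b2 : ∀ v, |a'' v| ≤ A)
    (z0 : ∀ v, 3 ≤ |v| → a v = 0) (z1 : ∀ v, 3 ≤ |v| → a' v = 0)
    (hp : ∀ v ∈ Set.Icc (-3 : ℝ) 3, M ≤ |oscFreq Y ξ v|)
    (hs : ∀ v ∈ Set.Icc (-3 : ℝ) 3, |oscCurv Y v| ≤ K * |oscFreq Y ξ v|) :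
    ‖∫ v in (-3 : ℝ)..3, (a v : ℂ) * oscExp Y ξ v‖ ≤ 6 * A * (1 + 4 * K + 3 * K ^ 2) / M ^ 2 := by
  set p := oscFreq Y ξ with hpdef
  set s := oscCurv Y with hsdef
  have hu : Set.uIcc (-3 : ℝ) 3 = Set.Icc (-3) 3 := Set.uIcc_of_le (by norm_num)
  have hp0 : ∀ v ∈ Set.Icc (-3 : ℝ) 3, p v ≠ 0 := fun v hv =>
    abs_pos.1 (hM.trans_le (hp v hv))
  have caa : Continuous a := continuous_iff_continuousAt.2 fun v => (ha v).continuousAt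
  have caa' : Continuous a' := continuous_iff_continuousAt.2 fun v => (ha' v).continuousAt
  have cp : Continuous p := continuous_oscFreq Y ξ
  have cs : Continuous s := continuous_oscCurv Y
  have e1 : ∫ v in (-3 : ℝ)..3, (a v : ℂ) * oscExp Y ξ v
      = Complex.I * ∫ v in (-3 : ℝ)..3, ((a' v / p v - a v * s v / p v ^ 2 : ℝ) : ℂ)
        * oscExp Y ξ v := by
    rw [← integral_by_parts_oscExp (r := fun v => a v / p v)]
    · apply intervalIntegral.integral_congr
      intro v hv
      rw [hu] at hv
      simp only
      rw [div_mul_cancel₀ _ (hp0 v hv)]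
    · intro v hv
      refine ((ha v).div (hasDerivAt_oscFreq Y ξ v) (hp0 v hv)).congr_deriv ?_
      have := hp0 v hv
      rw [← hpdef, ← hsdef]
      field_simp
    · apply ContinuousOn.sub
      · exact caa'.continuousOn.div cp.continuousOn hp0
      · exact (caa.mul cs).continuousOn.div (cp.pow 2).continuousOn fun v hv =>
          pow_ne_zero 2 (hp0 v hv)
    · simp [z0 (-3) (by norm_num)]
    · simp [z0 3 (by norm_num)]
  have e2 : ∫ v in (-3 : ℝ)..3, ((a' v / p v - a v * s v / p v ^ 2 : ℝ) : ℂ) * oscExp Y ξ v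
      = Complex.I * ∫ v in (-3 : ℝ)..3,
        ((a'' v / p v ^ 2 - 3 * a' v * s v / p v ^ 3 - a v * s v / p v ^ 3
          + 3 * a v * s v ^ 2 / p v ^ 4 : ℝ) : ℂ) * oscExp Y ξ v := by
    rw [← integral_by_parts_oscExp (r := fun v => a' v / p v ^ 2 - a v * s v / p v ^ 3)]
    · apply intervalIntegral.integral_congr
      intro v hv
      rw [hu] at hv
      have := hp0 v hv
      simp only
      congr 2
      rw [← hpdef]
      field_simp
    · intro v hv
      have h0 := hp0 v hv
      have d1 := (ha' v).div ((hasDerivAt_oscFreq Y ξ v).pow 2) (pow_ne_zero 2 h0)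
      have d2 := ((ha v).mul (hasDerivAt_oscCurv Y v)).div ((hasDerivAt_oscFreq Y ξ v).pow 3)
        (pow_ne_zero 3 h0)
      refine (d1.sub d2).congr_deriv ?_
      simp only [Pi.pow_apply, Pi.mul_apply, ← hpdef, ← hsdef]
      field_simp
      push_cast
      ring
    · have q := fun k : ℕ => fun v hv => pow_ne_zero k (hp0 v hv)
      refine ContinuousOn.add (ContinuousOn.sub (ContinuousOn.sub ?_ ?_) ?_) ?_
      · exact ContinuousOn.div (by fun_prop) (by fun_prop) (q 2)
      · exact ContinuousOn.div (by fun_prop) (by fun_prop) (q 3)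
      · exact ContinuousOn.div (by fun_prop) (by fun_prop) (q 3)
      · exact ContinuousOn.div (by fun_prop) (by fun_prop) (q 4)
    · simp [z0 (-3) (by norm_num), z1 (-3) (by norm_num)]
    · simp [z0 3 (by norm_num), z1 3 (by norm_num)]
  rw [e1, e2, norm_mul, norm_mul, Complex.norm_I, one_mul, one_mul]
  have hA : 0 ≤ A := (abs_nonneg _).trans (b0 0)
  have hbd : ∀ v ∈ Set.uIoc (-3 : ℝ) 3,
      ‖((a'' v / p v ^ 2 - 3 * a' v * s v / p v ^ 3 - a v * s v / p v ^ 3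
          + 3 * a v * s v ^ 2 / p v ^ 4 : ℝ) : ℂ) * oscExp Y ξ v‖
        ≤ A * (1 + 4 * K + 3 * K ^ 2) / M ^ 2 := by
    intro v hv
    rw [Set.uIoc_of_le (by norm_num)] at hv
    have hv := Set.Ioc_subset_Icc_self hv
    have h0 := hp0 v hv
    rw [norm_mul, norm_oscExp, mul_one, Complex.norm_real, Real.norm_eq_abs]
    set z := s v / p v with hz
    have hzK : |z| ≤ K := by
      rw [hz, abs_div, div_le_iff₀ (abs_pos.2 h0)]; exact hs v hv
    have hK : 0 ≤ K := (abs_nonneg _).trans hzK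
    have hid : a'' v / p v ^ 2 - 3 * a' v * s v / p v ^ 3 - a v * s v / p v ^ 3
          + 3 * a v * s v ^ 2 / p v ^ 4
        = (a'' v - 3 * a' v * z - a v * z + 3 * a v * z ^ 2) / p v ^ 2 := by
      rw [hz]; field_simp
    rw [hid, abs_div, abs_pow]
    have hnum : |a'' v - 3 * a' v * z - a v * z + 3 * a v * z ^ 2|
        ≤ A * (1 + 4 * K + 3 * K ^ 2) := by
      calc _ ≤ |a'' v| + |3 * a' v * z| + |a v * z| + |3 * a v * z ^ 2| :=
            (abs_add_le _ _).trans (add_le_add_left ((abs_sub _ _).trans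
              (add_le_add_left (abs_sub _ _) _)) _)
        _ = |a'' v| + 3 * (|a' v| * |z|) + |a v| * |z| + 3 * (|a v| * |z| ^ 2) := by
            simp only [abs_mul, abs_pow, abs_of_pos (by norm_num : (0 : ℝ) < 3)]; ring
        _ ≤ A + 3 * (A * K) + A * K + 3 * (A * K ^ 2) := by
            gcongr
            exacts [b2 v, b1 v, b0 v, b0 v]
        _ = _ := by ring
    have hpv := hp v hv
    gcongr
  calc _ ≤ A * (1 + 4 * K + 3 * K ^ 2) / M ^ 2 * |3 - -3| :=
        intervalIntegral.norm_integral_le_of_norm_le_const hbd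
    _ = _ := by norm_num; ring

lemma norm_oscIntegral_le_sqrt {Y ξ : ℝ} (hY : Y ≠ 0)
    (ha : ∀ v, HasDerivAt a (a' v) v) (ca' : Continuous a')
    (b0 : ∀ v, |a v| ≤ A) (b1 : ∀ v, |a' v| ≤ A)
    (z0 : ∀ v, 3 ≤ |v| → a v = 0) :
    ‖∫ v in (-3 : ℝ)..3, (a v : ℂ) * oscExp Y ξ v‖
      ≤ A * ((1 + exp 3) * π + 3) / √|Y| := by
  set p := oscFreq Y ξ with hpdef
  set s := oscCurv Y with hsdef
  set y := |Y| with hy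
  have hy0 : 0 < y := abs_pos.2 hY
  have hsy : 0 < √y := sqrt_pos.2 hy0
  have hA : 0 ≤ A := (abs_nonneg _).trans (b0 0)
  have caa : Continuous a := continuous_iff_continuousAt.2 fun v => (ha v).continuousAt
  have cp : Continuous p := continuous_oscFreq Y ξ
  have cs : Continuous s := continuous_oscCurv Y
  have hD : ∀ v, 0 < y + p v ^ 2 := fun v => by positivity
  have hDn : ∀ v, y + p v ^ 2 ≠ 0 := fun v => (hD v).ne'
  set r' : ℝ → ℝ := fun v => a' v * p v / (y + p v ^ 2)
    + a v * s v * (y - p v ^ 2) / (y + p v ^ 2) ^ 2 with hr'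
  have cr' : Continuous r' := by
    refine Continuous.add ?_ ?_
    · exact Continuous.div (by fun_prop) (by fun_prop) hDn
    · exact Continuous.div (by fun_prop) (by fun_prop) fun v => pow_ne_zero 2 (hDn v)
  have ibp := integral_by_parts_oscExp (Y := Y) (ξ := ξ) (r := fun v => a v * p v / (y + p v ^ 2))
    (r' := r') (fun v _ => by
      have d := ((ha v).mul (hasDerivAt_oscFreq Y ξ v)).div
        (((hasDerivAt_oscFreq Y ξ v).pow 2).const_add y) (hDn v)
      refine d.congr_deriv ?_
      have := hDn v
      simp only [Pi.pow_apply, Pi.mul_apply, ← hpdef, ← hsdef, hr']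
      field_simp
      push_cast
      ring) cr'.continuousOn (by simp [z0 (-3) (by norm_num)]) (by simp [z0 3 (by norm_num)])
  have c1 : Continuous fun v => ((a v * p v / (y + p v ^ 2) * oscFreq Y ξ v : ℝ) : ℂ)
      * oscExp Y ξ v := by
    refine (Complex.continuous_ofReal.comp ?_).mul (continuous_oscExp Y ξ)
    exact ((caa.mul cp).div (by fun_prop) hDn).mul cp
  have c2 : Continuous fun v => ((a v * y / (y + p v ^ 2) : ℝ) : ℂ) * oscExp Y ξ v := by
    refine (Complex.continuous_ofReal.comp ?_).mul (continuous_oscExp Y ξ)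
    exact (caa.mul continuous_const).div (by fun_prop) hDn
  have c3 : Continuous fun v => (r' v : ℂ) * oscExp Y ξ v :=
    (Complex.continuous_ofReal.comp cr').mul (continuous_oscExp Y ξ)
  have e1 : ∫ v in (-3 : ℝ)..3, (a v : ℂ) * oscExp Y ξ v
      = ∫ v in (-3 : ℝ)..3, (((a v * y / (y + p v ^ 2) : ℝ) : ℂ) * oscExp Y ξ v
          + Complex.I * ((r' v : ℂ) * oscExp Y ξ v)) := by
    rw [intervalIntegral.integral_add (c2.intervalIntegrable _ _)
      ((c3.intervalIntegrable _ _).const_mul _), intervalIntegral.integral_const_mul, ← ibp,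
      ← intervalIntegral.integral_add (c2.intervalIntegrable _ _) (c1.intervalIntegrable _ _)]
    congr 1
    ext v
    have : a v = a v * y / (y + p v ^ 2) + a v * p v / (y + p v ^ 2) * p v := by
      have := hDn v
      field_simp
    rw [← hpdef, ← add_mul, ← Complex.ofReal_add, ← this]
  set σ := Y / |Y| with hσ
  have hσ1 : |σ| = 1 := by rw [hσ, abs_div, abs_abs, div_self hy0.ne']
  have hσs : ∀ v, σ * s v = |s v| := by
    intro v
    simp only [hσ, hsdef]
    rw [abs_oscCurv, oscCurv]
    have : Y * Y = |Y| * |Y| := (abs_mul_abs_self Y).symm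
    have h' : |Y| ≠ 0 := hy0.ne'
    field_simp
    linear_combination this
  have dG : ∀ v, HasDerivAt (fun v => A * (1 + exp 3) * (σ / √y * arctan (p v / √y))
      + A / (2 * √y) * v) (A * (1 + exp 3) * (|s v| / (y + p v ^ 2)) + A / (2 * √y)) v := by
    intro v
    have d := ((((hasDerivAt_oscFreq Y ξ v).div_const (√y)).arctan.const_mul
      (σ / √y)).const_mul (A * (1 + exp 3))).add ((hasDerivAt_id v).const_mul (A / (2 * √y)))
    refine d.congr_deriv ?_
    rw [← hσs]
    have h1 : 1 + (oscFreq Y ξ v / √y) ^ 2 = (y + p v ^ 2) / (√y * √y) := by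
      rw [div_pow, sq_sqrt hy0.le, mul_self_sqrt hy0.le, hpdef]
      field_simp
    rw [h1, mul_one, ← hsdef]
    have := hDn v
    field_simp
  have cG : Continuous fun v => A * (1 + exp 3) * (|s v| / (y + p v ^ 2)) + A / (2 * √y) := by
    have : Continuous fun v => |s v| / (y + p v ^ 2) := cs.abs.div (by fun_prop) hDn
    fun_prop
  have hpt : ∀ v ∈ Set.Ioc (-3 : ℝ) 3,
      ‖((a v * y / (y + p v ^ 2) : ℝ) : ℂ) * oscExp Y ξ v
          + Complex.I * ((r' v : ℂ) * oscExp Y ξ v)‖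
        ≤ A * (1 + exp 3) * (|s v| / (y + p v ^ 2)) + A / (2 * √y) := by
    intro v hv
    have t1 : |a v * y / (y + p v ^ 2)| ≤ A * exp 3 * (|s v| / (y + p v ^ 2)) := by
      rw [abs_div, abs_mul, abs_of_pos hy0, abs_of_pos (hD v)]
      have : y ≤ exp 3 * |s v| := by
        rw [hsdef, abs_oscCurv, ← hy]
        have h3 : 1 ≤ exp 3 * exp v := by
          rw [← exp_add]; exact one_le_exp (by linarith [hv.1])
        have h4 : 1 ≤ 2 * π := by linarith [pi_gt_three]
        have h5 : 1 ≤ 2 * π * (exp 3 * exp v) := one_le_mul_of_one_le_of_one_le h4 h3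
        nlinarith
      calc |a v| * y / (y + p v ^ 2) ≤ A * (exp 3 * |s v|) / (y + p v ^ 2) := by
            have := hD v
            gcongr; exact b0 v
        _ = _ := by ring
    have t2 : |a' v * p v / (y + p v ^ 2)| ≤ A / (2 * √y) := by
      rw [abs_div, abs_mul, abs_of_pos (hD v), div_le_div_iff₀ (hD v) (by positivity)]
      have h1 : |p v| * (2 * √y) ≤ y + p v ^ 2 := by
        have := sq_nonneg (|p v| - √y)
        nlinarith [sq_sqrt hy0.le, sq_abs (p v)]
      calc |a' v| * |p v| * (2 * √y) = |a' v| * (|p v| * (2 * √y)) := by ring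
        _ ≤ A * (y + p v ^ 2) := by gcongr; exact b1 v
    have t3 : |a v * s v * (y - p v ^ 2) / (y + p v ^ 2) ^ 2|
        ≤ A * (|s v| / (y + p v ^ 2)) := by
      rw [abs_div, abs_mul, abs_mul, abs_of_pos (pow_pos (hD v) 2)]
      have h1 : |y - p v ^ 2| ≤ y + p v ^ 2 := by
        rw [abs_le]; constructor <;> nlinarith [sq_nonneg (p v)]
      have hDv := hD v
      calc |a v| * |s v| * |y - p v ^ 2| / (y + p v ^ 2) ^ 2
          ≤ A * |s v| * (y + p v ^ 2) / (y + p v ^ 2) ^ 2 := by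
            gcongr; exact b0 v
        _ = _ := by field_simp
    calc _ ≤ ‖((a v * y / (y + p v ^ 2) : ℝ) : ℂ) * oscExp Y ξ v‖
          + ‖Complex.I * ((r' v : ℂ) * oscExp Y ξ v)‖ := norm_add_le _ _
      _ = |a v * y / (y + p v ^ 2)| + |r' v| := by
        simp only [norm_mul, norm_oscExp, Complex.norm_I, mul_one, one_mul]
        rw [Complex.norm_real, Complex.norm_real, Real.norm_eq_abs, Real.norm_eq_abs]
      _ ≤ |a v * y / (y + p v ^ 2)| + (|a' v * p v / (y + p v ^ 2)|
          + |a v * s v * (y - p v ^ 2) / (y + p v ^ 2) ^ 2|) := by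
        gcongr; exact abs_add_le _ _
      _ ≤ _ := by linarith
  rw [e1]
  refine (intervalIntegral.norm_integral_le_of_norm_le (by norm_num)
    (Filter.Eventually.of_forall hpt) (cG.intervalIntegrable _ _)).trans ?_
  rw [intervalIntegral.integral_eq_sub_of_hasDerivAt (fun v _ => dG v)
    (cG.intervalIntegrable _ _)]
  have harc : σ * (arctan (p 3 / √y) - arctan (p (-3) / √y)) ≤ π := by
    calc _ ≤ |σ * (arctan (p 3 / √y) - arctan (p (-3) / √y))| := le_abs_self _
      _ = |arctan (p 3 / √y) - arctan (p (-3) / √y)| := by rw [abs_mul, hσ1, one_mul]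
      _ ≤ π := by
        rw [abs_le]
        have := arctan_lt_pi_div_two (p 3 / √y)
        have := arctan_lt_pi_div_two (p (-3) / √y)
        have := neg_pi_div_two_lt_arctan (p 3 / √y)
        have := neg_pi_div_two_lt_arctan (p (-3) / √y)
        constructor <;> linarith
  have hB : 0 ≤ A * (1 + exp 3) / √y := by positivity
  calc _ = A * (1 + exp 3) / √y * (σ * (arctan (p 3 / √y) - arctan (p (-3) / √y)))
        + A * 3 / √y := by field_simp; ring
    _ ≤ A * (1 + exp 3) / √y * π + A * 3 / √y := by gcongr
    _ = _ := by ring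

end Oscillatory

open scoped ContDiff FourierTransform in
lemma exists_smooth_amplitude : ∃ (a : ℝ → ℝ) (A : ℝ), 0 < A ∧ ContDiff ℝ ∞ a ∧
    (∀ v, |a v| ≤ A) ∧ (∀ v, |deriv a v| ≤ A) ∧ (∀ v, |deriv (deriv a) v| ≤ A) ∧
    (∀ v, 3 ≤ |v| → a v = 0) ∧ (∀ v, 3 ≤ |v| → deriv a v = 0) ∧
    (∀ v, |v| ≤ 2 → a v = exp (v / 2)) := by
  let ρ : ContDiffBump (0 : ℝ) := ⟨2, 5 / 2, by norm_num, by norm_num⟩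
  set a : ℝ → ℝ := fun v => ρ v * exp (v / 2) with ha
  have hsm : ContDiff ℝ ∞ a := ρ.contDiff.mul (by fun_prop)
  have hcs : HasCompactSupport a := ρ.hasCompactSupport.mul_right
  have hts : ∀ v, 3 ≤ |v| → v ∉ tsupport a := by
    intro v hv h
    have h1 : v ∈ tsupport ρ := (tsupport_mul_subset_left) h
    rw [ρ.tsupport_eq, Metric.mem_closedBall, Real.dist_eq, sub_zero] at h1
    have : ρ.rOut = 5 / 2 := rfl
    rw [this] at h1
    linarith
  have hsm1 : ContDiff ℝ ∞ (deriv a) := by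
    have : ContDiff ℝ (∞ + 1) a := hsm
    exact (contDiff_succ_iff_deriv.1 this).2.2
  have hsm2 : ContDiff ℝ ∞ (deriv (deriv a)) := by
    have : ContDiff ℝ (∞ + 1) (deriv a) := hsm1
    exact (contDiff_succ_iff_deriv.1 this).2.2
  obtain ⟨A0, h0⟩ := hcs.exists_bound_of_continuous hsm.continuous
  obtain ⟨A1, h1⟩ := hcs.deriv.exists_bound_of_continuous hsm1.continuous
  obtain ⟨A2, h2⟩ := hcs.deriv.deriv.exists_bound_of_continuous hsm2.continuous
  have p0 := (norm_nonneg _).trans (h0 0)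
  have p1 := (norm_nonneg _).trans (h1 0)
  have p2 := (norm_nonneg _).trans (h2 0)
  refine ⟨a, A0 + A1 + A2 + 1, by positivity, hsm, fun v => ?_, fun v => ?_, fun v => ?_,
    fun v hv => ?_, fun v hv => ?_, fun v hv => ?_⟩
  · have := h0 v; rw [Real.norm_eq_abs] at this; linarith
  · have := h1 v; rw [Real.norm_eq_abs] at this; linarith
  · have := h2 v; rw [Real.norm_eq_abs] at this; linarith
  · exact image_eq_zero_of_notMem_tsupport (hts v hv)
  · exact image_eq_zero_of_notMem_tsupport fun h => hts v hv (tsupport_deriv_subset h)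
  · have : ρ v = 1 := ρ.one_of_mem_closedBall (by simpa [ρ] using hv)
    simp [ha, this]

lemma exp_three_lt : exp 3 < 21 := by
  have h : exp 3 = exp 1 ^ 3 := by rw [← exp_nat_mul]; norm_num
  rw [h]
  have := exp_one_lt_d9
  have h0 := exp_pos 1
  calc exp 1 ^ 3 ≤ (2.7182818286 : ℝ) ^ 3 := by gcongr
    _ < 21 := by norm_num

lemma exp_bounds {v : ℝ} (hv : v ∈ Set.Icc (-3 : ℝ) 3) : 1 / 21 ≤ exp v ∧ exp v ≤ 21 := by
  have h1 : exp v ≤ exp 3 := exp_le_exp.2 hv.2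
  have h2 : exp (-3) ≤ exp v := exp_le_exp.2 hv.1
  have h3 := exp_three_lt
  refine ⟨le_trans ?_ h2, by linarith⟩
  rw [exp_neg, one_div]
  gcongr

/-- A Fourier representation of `e^{v/2} e(Y e^v)` for `|v| ≤ 2`, with stationary phase bounds. -/
lemma exists_phase_kernel : ∃ C : ℝ, 0 < C ∧ ∀ Y : ℝ, Y ≠ 0 → ∃ G : ℝ → ℂ,
    Integrable G ∧ Continuous G ∧
    (∀ v : ℝ, |v| ≤ 2 → ∫ ξ : ℝ, G ξ * Complex.exp (2 * π * Complex.I * (ξ * v))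
      = (exp (v / 2) : ℂ) * Complex.exp (2 * π * Complex.I * (Y * exp v : ℝ))) ∧
    (∀ ξ, ‖G ξ‖ ≤ C / √|Y|) ∧
    (∀ ξ, |ξ| ≤ |Y| / 100 → ‖G ξ‖ ≤ C / Y ^ 2) ∧
    (∀ ξ, 100 * |Y| ≤ |ξ| → ‖G ξ‖ ≤ C / ξ ^ 2) := by
  obtain ⟨a, A, hA, hsm, b0, b1, b2, z0, z1, haeq⟩ := exists_smooth_amplitude
  have hd : ∀ v, HasDerivAt a (deriv a v) v := fun v =>
    (hsm.differentiable (by simp) v).hasDerivAt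
  have hsm1 : ContDiff ℝ ((⊤ : ℕ∞) : WithTop ℕ∞) (deriv a) := by
    have : ContDiff ℝ (((⊤ : ℕ∞) : WithTop ℕ∞) + 1) a := hsm
    exact (contDiff_succ_iff_deriv.1 this).2.2
  have hd1 : ∀ v, HasDerivAt (deriv a) (deriv (deriv a) v) v := fun v =>
    (hsm1.differentiable (by simp) v).hasDerivAt
  have hc2 : Continuous (deriv (deriv a)) := hsm1.continuous_deriv (by simp)
  set K : ℝ := 2000 with hK
  set C := A * ((1 + exp 3) * π + 3) + 100 * (6 * A * (1 + 4 * K + 3 * K ^ 2)) with hC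
  have hC1 : 0 < A * ((1 + exp 3) * π + 3) := by positivity
  have hC2 : 0 < 6 * A * (1 + 4 * K + 3 * K ^ 2) := by positivity
  refine ⟨C, by positivity, fun Y hY => ?_⟩
  have hY0 : 0 < |Y| := abs_pos.2 hY
  set Φ : ℝ → ℂ := fun v => (a v : ℂ) * Complex.exp (2 * π * Complex.I * (Y * exp v : ℝ)) with hΦ
  have hΦsm : ContDiff ℝ ((⊤ : ℕ∞) : WithTop ℕ∞) Φ := by
    refine ContDiff.mul (Complex.ofRealCLM.contDiff.comp hsm) ?_
    refine ContDiff.cexp (contDiff_const.mul (Complex.ofRealCLM.contDiff.comp ?_))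
    exact contDiff_const.mul Real.contDiff_exp
  have hz : ∀ v, v ∉ Set.Icc (-3 : ℝ) 3 → Φ v = 0 := by
    intro v hv
    have : 3 ≤ |v| := by
      by_contra! h
      exact hv ⟨(abs_lt.1 h).1.le, (abs_lt.1 h).2.le⟩
    simp [hΦ, z0 v this]
  have hΦcs : HasCompactSupport Φ := HasCompactSupport.intro isCompact_Icc hz
  let Ψ : SchwartzMap ℝ ℂ := hΦcs.toSchwartzMap hΦsm
  have hΨ : (Ψ : ℝ → ℂ) = Φ := rfl
  let G : SchwartzMap ℝ ℂ := FourierTransform.fourier Ψ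
  have hG : (G : ℝ → ℂ) = FourierTransform.fourier Φ := by
    rw [← hΨ]; exact SchwartzMap.fourier_coe Ψ
  have hGosc : ∀ ξ, G ξ = ∫ v in (-3 : ℝ)..3, (a v : ℂ) * oscExp Y ξ v := by
    intro ξ
    rw [hG, Real.fourier_eq', intervalIntegral.integral_of_le (by norm_num),
      ← integral_Icc_eq_integral_Ioc]
    rw [← setIntegral_eq_integral_of_forall_compl_eq_zero (s := Set.Icc (-3 : ℝ) 3)
      (fun v hv => by rw [hz v hv, smul_zero])]
    congr 1
    ext v
    rw [smul_eq_mul, hΦ, mul_left_comm, ← Complex.exp_add, oscExp]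
    congr 2
    simp; ring
  refine ⟨G, G.integrable, G.continuous, fun v hv => ?_, fun ξ => ?_, fun ξ hξ => ?_,
    fun ξ hξ => ?_⟩
  · have hinv := MeasureTheory.Integrable.fourierInv_fourier_eq (f := Φ) (v := v)
      Ψ.integrable (by rw [← hG]; exact G.integrable) hΦsm.continuous.continuousAt
    rw [← hG, Real.fourierInv_eq'] at hinv
    have : Φ v = (exp (v / 2) : ℂ) * Complex.exp (2 * π * Complex.I * (Y * exp v : ℝ)) := by
      simp only [hΦ, haeq v hv]
    rw [← this, ← hinv]
    congr 1
    ext ξ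
    rw [smul_eq_mul, mul_comm]
    congr 2
    simp; ring
  · rw [hGosc]
    refine (norm_oscIntegral_le_sqrt hY hd hsm1.continuous b0 b1 z0).trans ?_
    gcongr
    linarith
  · have hlow : ∀ v ∈ Set.Icc (-3 : ℝ) 3, |Y| / 10 ≤ |oscFreq Y ξ v| := by
      intro v hv
      rw [oscFreq, abs_mul, abs_of_pos two_pi_pos]
      have h1 : |Y| / 21 - |Y| / 100 ≤ |Y * exp v - ξ| := by
        refine le_trans ?_ (abs_sub_abs_le_abs_sub _ _)
        rw [abs_mul, abs_of_pos (exp_pos v)]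
        have := (exp_bounds hv).1
        have : |Y| * (1 / 21) ≤ |Y| * exp v := by gcongr
        linarith
      have h3 := pi_gt_three
      nlinarith
    rw [hGosc]
    refine (norm_oscIntegral_le_of_le_abs_oscFreq (K := K) (by positivity : 0 < |Y| / 10) hd hd1 hc2
      b0 b1 b2 z0 z1 hlow fun v hv => ?_).trans ?_
    · rw [abs_oscCurv]
      have h1 := hlow v hv
      have h2 := (exp_bounds hv).2
      have h3 := pi_lt_four
      have : 2 * π * (|Y| * exp v) ≤ 2 * 4 * (|Y| * 21) := by gcongr
      rw [hK]
      nlinarith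
    · rw [div_pow, sq_abs, div_div_eq_mul_div]
      gcongr
      rw [hC]
      norm_num
      linarith
  · have hξ0 : 0 < |ξ| := by linarith
    have hlow : ∀ v ∈ Set.Icc (-3 : ℝ) 3, |ξ| ≤ |oscFreq Y ξ v| := by
      intro v hv
      rw [oscFreq, abs_mul, abs_of_pos two_pi_pos]
      have h1 : |ξ| - |Y| * 21 ≤ |Y * exp v - ξ| := by
        rw [abs_sub_comm]
        refine le_trans ?_ (abs_sub_abs_le_abs_sub _ _)
        rw [abs_mul, abs_of_pos (exp_pos v)]
        have := (exp_bounds hv).2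
        have : |Y| * exp v ≤ |Y| * 21 := by gcongr
        linarith
      have h3 := pi_gt_three
      nlinarith
    rw [hGosc]
    refine (norm_oscIntegral_le_of_le_abs_oscFreq (K := K) hξ0 hd hd1 hc2
      b0 b1 b2 z0 z1 hlow fun v hv => ?_).trans ?_
    · rw [abs_oscCurv]
      have h1 := hlow v hv
      have h2 := (exp_bounds hv).2
      have h3 := pi_lt_four
      have : 2 * π * (|Y| * exp v) ≤ 2 * 4 * (|Y| * 21) := by gcongr
      rw [hK]
      nlinarith
    · rw [sq_abs]
      gcongr
      linarith

/-- Sum of `‖g n‖` over the `n ∈ N` lying in the window `[x, x + H]`. -/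
noncomputable def shortMass (N : Finset ℕ) (g : ℕ → ℂ) (H x : ℝ) : ℝ :=
  ∑ n ∈ N, windowInd H (n - x) * ‖g n‖

lemma shortMass_nonneg (N : Finset ℕ) (g : ℕ → ℂ) (H x : ℝ) : 0 ≤ shortMass N g H x :=
  Finset.sum_nonneg fun _ _ => mul_nonneg (windowInd_nonneg _ _) (norm_nonneg _)

lemma measurable_shortMass (N : Finset ℕ) (g : ℕ → ℂ) (H : ℝ) :
    Measurable (shortMass N g H) := by
  have := measurable_windowInd H
  unfold shortMass
  fun_prop

lemma shortMass_le (N : Finset ℕ) (g : ℕ → ℂ) (H x : ℝ) :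
    shortMass N g H x ≤ ∑ n ∈ N, ‖g n‖ :=
  Finset.sum_le_sum fun _ _ => mul_le_of_le_one_left (norm_nonneg _) (windowInd_le_one _ _)

lemma integrable_shortMass (N : Finset ℕ) (g : ℕ → ℂ) (H : ℝ) :
    Integrable (shortMass N g H) :=
  integrable_finsetSum _ fun _ _ => ((integrable_windowInd H).comp_sub_left _).mul_const _

lemma integrable_shortMass_sq (N : Finset ℕ) (g : ℕ → ℂ) (H : ℝ) :
    Integrable (fun x => shortMass N g H x ^ 2) := by
  refine ((integrable_shortMass N g H).mul_const (∑ n ∈ N, ‖g n‖)).mono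
    ((measurable_shortMass N g H).pow_const 2).aestronglyMeasurable
    (Filter.Eventually.of_forall fun x => ?_)
  rw [norm_pow, norm_mul, sq, Real.norm_of_nonneg (shortMass_nonneg N g H x),
    Real.norm_of_nonneg (r := ∑ n ∈ N, ‖g n‖) (by positivity)]
  exact mul_le_mul_of_nonneg_left (shortMass_le N g H x) (shortMass_nonneg N g H x)

lemma integral_windowInd {H : ℝ} (hH : 0 ≤ H) : ∫ y, windowInd H y = H := by
  unfold windowInd
  rw [integral_indicator_one measurableSet_Icc, Real.volume_real_Icc]
  simpa using hH

lemma integral_shortMass (N : Finset ℕ) (g : ℕ → ℂ) {H : ℝ} (hH : 0 ≤ H) :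
    ∫ x, shortMass N g H x = H * ∑ n ∈ N, ‖g n‖ := by
  unfold shortMass
  rw [integral_finsetSum _ fun n _ => ((integrable_windowInd H).comp_sub_left _).mul_const _,
    Finset.mul_sum]
  refine Finset.sum_congr rfl fun n _ => ?_
  rw [integral_mul_const, integral_sub_left_eq_self (windowInd H) volume, integral_windowInd hH]

lemma sq_integral_Icc_le {f : ℝ → ℝ} {a b : ℝ} (hab : a < b) (hf : Integrable f)
    (hf2 : Integrable fun x => f x ^ 2) :
    (∫ x in Set.Icc a b, f x) ^ 2 ≤ (b - a) * ∫ x, f x ^ 2 := by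
  set m := (∫ x in Set.Icc a b, f x) / (b - a) with hm
  have h0 : 0 ≤ ∫ x in Set.Icc a b, (f x - m) ^ 2 :=
    integral_nonneg fun x => sq_nonneg _
  have h1 : ∫ x in Set.Icc a b, (f x - m) ^ 2 =
      (∫ x in Set.Icc a b, f x ^ 2) - 2 * m * (∫ x in Set.Icc a b, f x) + m ^ 2 * (b - a) := by
    have e : ∀ x, (f x - m) ^ 2 = f x ^ 2 - 2 * m * f x + m ^ 2 := fun x => by ring
    simp_rw [e]
    rw [integral_add, integral_sub, integral_const_mul, integral_const]
    · simp [measureReal_def, hab.le, mul_comm]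
    · exact hf2.integrableOn
    · exact hf.integrableOn.const_mul _
    · exact hf2.integrableOn.sub (hf.integrableOn.const_mul _)
    · exact integrableOn_const (by simp)
  have h2 : ∫ x in Set.Icc a b, f x ^ 2 ≤ ∫ x, f x ^ 2 :=
    setIntegral_le_integral hf2 (Filter.Eventually.of_forall fun x => sq_nonneg _)
  have hd : 0 < b - a := sub_pos.2 hab
  have h3 : ∫ x in Set.Icc a b, f x = m * (b - a) := by rw [hm]; field_simp
  rw [h3] at h1 ⊢
  nlinarith

/-- The `L¹` mass of `g` is controlled by the mean square of its short sums. -/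
lemma sq_sum_norm_le {X H : ℝ} (hH : 1 ≤ H) (hHX : H ≤ X) {N : Finset ℕ} (g : ℕ → ℂ)
    (hN : ∀ n ∈ N, X < (n : ℝ) ∧ (n : ℝ) ≤ 2 * X) :
    (∑ n ∈ N, ‖g n‖) ^ 2 / X ≤ 2 / H ^ 2 * ∫ x, shortMass N g H x ^ 2 := by
  have h := sq_integral_Icc_le (a := X - H) (b := 2 * X) (by linarith)
    (integrable_shortMass N g H) (integrable_shortMass_sq N g H)
  rw [setIntegral_eq_integral_of_forall_compl_eq_zero, integral_shortMass N g (by linarith)] at h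
  · have hI : 0 ≤ ∫ x, shortMass N g H x ^ 2 := integral_nonneg fun x => sq_nonneg _
    have hX : 0 < X := by linarith
    have hH0 : 0 < H := by linarith
    rw [div_le_iff₀ hX, ← mul_le_mul_iff_right₀ (pow_pos hH0 2), ← mul_pow]
    refine h.trans ?_
    have : H ^ 2 * (2 / H ^ 2 * (∫ x, shortMass N g H x ^ 2) * X)
      = (2 * X) * ∫ x, shortMass N g H x ^ 2 := by field_simp
    rw [this]
    gcongr
    linarith
  · intro x hx
    refine Finset.sum_eq_zero fun n hn => ?_
    rw [windowInd_of_notMem, zero_mul]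
    rintro ⟨h1, h2⟩
    exact hx ⟨by linarith [(hN n hn).1], by linarith [(hN n hn).2]⟩

/-- Gallagher's lemma for exponential sums. -/
lemma gallagher_sum {H : ℝ} (hH : 0 < H) (N : Finset ℕ) (g : ℕ → ℂ) (β : ℝ) :
    ∫ θ in (β - 1 / H)..(β + 1 / H), ‖∑ n ∈ N, g n * eR (θ * n)‖ ^ 2 ≤
      π ^ 2 / H ^ 2 * ∫ x, shortMass N g H x ^ 2 := by
  have key := gallagher (μ := (Measure.count : Measure N)) (l := H)
    (ψ := fun n => g n * eR (β * n)) (ξ := fun n => (n : ℝ)) hH Integrable.of_finite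
    (measurable_of_countable _)
  have hn : ∀ x : ℝ, ‖eR x‖ = 1 := fun x => by
    rw [eR, mul_right_comm, Complex.norm_exp]; simp
  have e1 : ∀ u : ℝ, ∫ n : N, (g n * eR (β * n)) *
      Complex.exp (2 * π * Complex.I * (((n : ℕ) : ℝ) * u)) ∂Measure.count
      = ∑ n ∈ N, g n * eR ((u + β) * n) := by
    intro u
    rw [integral_count, ← Finset.sum_coe_sort N]
    refine Finset.sum_congr rfl fun n _ => ?_
    rw [mul_assoc, eR, eR, ← Complex.exp_add]
    congr 2
    push_cast; ring
  have e2 : ∀ x : ℝ, windowMass Measure.count (fun n : N => g n * eR (β * n))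
      (fun n => ((n : ℕ) : ℝ)) H x = shortMass N g H x := by
    intro x
    rw [windowMass, shortMass, integral_count, ← Finset.sum_coe_sort N]
    refine Finset.sum_congr rfl fun n _ => ?_
    rw [norm_mul, hn, mul_one]
  simp_rw [e1, e2] at key
  rw [intervalIntegral.integral_comp_add_right
    (fun θ => ‖∑ n ∈ N, g n * eR (θ * n)‖ ^ 2) β] at key
  convert key using 2 <;> ring

/-- The Dirichlet polynomial `∑ g(n) n^{-1/2-it}`. -/
noncomputable def dirPoly (N : Finset ℕ) (g : ℕ → ℂ) (t : ℝ) : ℂ :=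
  ∑ n ∈ N, g n / (n : ℂ) ^ (1 / 2 + Complex.I * (t : ℂ))

lemma div_natCast_cpow {n : ℕ} (hn : n ≠ 0) (z : ℂ) (t : ℝ) :
    z / (n : ℂ) ^ (1 / 2 + Complex.I * (t : ℂ)) =
      z * Complex.exp (-(log n : ℂ) * (1 / 2 + Complex.I * t)) := by
  rw [Complex.cpow_def_of_ne_zero (Nat.cast_ne_zero.2 hn), div_eq_mul_inv, ← Complex.exp_neg,
    ← Complex.natCast_log, neg_mul]

lemma continuous_dirPoly {N : Finset ℕ} (hN : ∀ n ∈ N, n ≠ 0) (g : ℕ → ℂ) :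
    Continuous (dirPoly N g) := by
  refine continuous_finsetSum _ fun n hn => ?_
  simp_rw [div_natCast_cpow (hN n hn)]
  fun_prop

lemma norm_dirPoly_le {X : ℝ} (hX : 0 < X) {N : Finset ℕ} (hN : ∀ n ∈ N, X < (n : ℝ))
    (g : ℕ → ℂ) (t : ℝ) : exp (log X / 2) * ‖dirPoly N g t‖ ≤ ∑ n ∈ N, ‖g n‖ := by
  refine (mul_le_mul_of_nonneg_left (norm_sum_le _ _) (exp_pos _).le).trans ?_
  rw [Finset.mul_sum]
  refine Finset.sum_le_sum fun n hn => ?_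
  have hn0 : n ≠ 0 := fun h => by have := hN n hn; simp [h] at this; linarith
  have hlog : log X ≤ log n := log_le_log hX (hN n hn).le
  rw [div_natCast_cpow hn0, norm_mul, Complex.norm_exp, mul_left_comm, ← exp_add]
  refine mul_le_of_le_one_right (norm_nonneg _) (exp_le_one_iff.2 ?_)
  have : (-(log n : ℂ) * (1 / 2 + Complex.I * t)).re = -(log n) / 2 := by
    rw [← Complex.ofReal_neg, Complex.re_ofReal_mul]
    simp; ring
  rw [this]
  linarith

/-- The density of the exponential sum against the multiplicative characters `r ^ {2πiξ}`. -/
noncomputable def mellinDensity (G : ℝ → ℂ) (X : ℝ) (N : Finset ℕ) (g : ℕ → ℂ) (ξ : ℝ) : ℂ :=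
  (exp (log X / 2) : ℂ) * G ξ * eR (-(ξ * log X)) * dirPoly N g (-(2 * π) * ξ)

lemma norm_eR (x : ℝ) : ‖eR x‖ = 1 := by
  rw [eR, mul_right_comm, Complex.norm_exp]; simp

lemma continuous_eR : Continuous eR := by unfold eR; fun_prop

lemma norm_mellinDensity (G : ℝ → ℂ) (X : ℝ) (N : Finset ℕ) (g : ℕ → ℂ) (ξ : ℝ) :
    ‖mellinDensity G X N g ξ‖ = ‖G ξ‖ * (exp (log X / 2) * ‖dirPoly N g (-(2 * π) * ξ)‖) := by
  rw [mellinDensity, norm_mul, norm_mul, norm_mul, norm_eR, Complex.norm_real,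
    Real.norm_of_nonneg (exp_pos _).le]
  ring

lemma continuous_mellinDensity {G : ℝ → ℂ} (hG : Continuous G) (X : ℝ) {N : Finset ℕ}
    (hN : ∀ n ∈ N, n ≠ 0) (g : ℕ → ℂ) : Continuous (mellinDensity G X N g) := by
  have := continuous_dirPoly hN g
  have := continuous_eR
  unfold mellinDensity
  fun_prop

lemma integrable_mellinDensity {G : ℝ → ℂ} (hG : Continuous G) (hGi : Integrable G) {X : ℝ}
    (hX : 0 < X) {N : Finset ℕ} (hN : ∀ n ∈ N, X < (n : ℝ)) (g : ℕ → ℂ) :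
    Integrable (mellinDensity G X N g) := by
  have hN0 : ∀ n ∈ N, n ≠ 0 := fun n hn h => by have := hN n hn; simp [h] at this; linarith
  refine (hGi.norm.mul_const (∑ n ∈ N, ‖g n‖)).mono'
    (continuous_mellinDensity hG X hN0 g).aestronglyMeasurable
    (Filter.Eventually.of_forall fun ξ => ?_)
  rw [norm_mellinDensity]
  exact mul_le_mul_of_nonneg_left (norm_dirPoly_le hX hN g _) (norm_nonneg _)

/-- Mellin expansion of the exponential sum near the frequency `β`. -/
lemma expSum_eq_integral_mellinDensity {X β r : ℝ} (hX : 0 < X) (hr : r ∈ Set.Icc (1 / 2) (3 / 2))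
    {N : Finset ℕ} (hN : ∀ n ∈ N, X < (n : ℝ) ∧ (n : ℝ) ≤ 2 * X) (g : ℕ → ℂ) {G : ℝ → ℂ}
    (hGi : Integrable G)
    (hG : ∀ v : ℝ, |v| ≤ 2 → ∫ ξ, G ξ * Complex.exp (2 * π * Complex.I * (ξ * v)) =
      (exp (v / 2) : ℂ) * Complex.exp (2 * π * Complex.I * (β * X * exp v : ℝ))) :
    ∑ n ∈ N, g n * eR (β * r * n) = (exp (-(log r / 2)) : ℝ) *
      ∫ ξ, mellinDensity G X N g ξ * Complex.exp (2 * π * Complex.I * (ξ * (log r : ℝ))) := by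
  have hr0 : 0 < r := by linarith [hr.1]
  have hN0 : ∀ n ∈ N, n ≠ 0 := fun n hn h => by have := (hN n hn).1; simp [h] at this; linarith
  set v : ℕ → ℝ := fun n => log r + log n - log X with hv
  have e1 : ∀ ξ : ℝ, mellinDensity G X N g ξ *
      Complex.exp (2 * π * Complex.I * (ξ * (log r : ℝ))) = ∑ n ∈ N, g n *
        Complex.exp (((log X - log n) / 2 : ℝ)) *
        (G ξ * Complex.exp (2 * π * Complex.I * (ξ * (v n : ℝ)))) := by
    intro ξ
    rw [mellinDensity, dirPoly, Finset.mul_sum, Finset.sum_mul]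
    refine Finset.sum_congr rfl fun n hn => ?_
    rw [div_natCast_cpow (hN0 n hn), eR]
    have : Complex.exp (((log X - log n) / 2 : ℝ)) *
          Complex.exp (2 * π * Complex.I * (ξ * (v n : ℝ)))
        = (exp (log X / 2) : ℝ) * Complex.exp (2 * π * Complex.I * (-(ξ * log X) : ℝ)) *
          Complex.exp (-(log n : ℂ) * (1 / 2 + Complex.I * (-(2 * π) * ξ : ℝ))) *
          Complex.exp (2 * π * Complex.I * (ξ * (log r : ℝ))) := by
      simp only [Complex.ofReal_exp, ← Complex.exp_add, hv]
      congr 1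
      push_cast
      ring
    calc _ = g n * G ξ * ((exp (log X / 2) : ℝ) *
          Complex.exp (2 * π * Complex.I * (-(ξ * log X) : ℝ)) *
          Complex.exp (-(log n : ℂ) * (1 / 2 + Complex.I * (-(2 * π) * ξ : ℝ))) *
          Complex.exp (2 * π * Complex.I * (ξ * (log r : ℝ)))) := by ring
      _ = _ := by rw [← this]; ring
  simp_rw [e1]
  have hint : ∀ n, Integrable fun ξ => G ξ * Complex.exp (2 * π * Complex.I * (ξ * (v n : ℝ))) := by
    intro n
    refine hGi.mul_bdd (c := 1) (by fun_prop) (Filter.Eventually.of_forall fun ξ => ?_)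
    have := norm_eR (ξ * v n)
    rw [eR] at this
    push_cast at this
    exact this.le
  rw [integral_finsetSum _ fun n _ => (hint n).const_mul _, Finset.mul_sum]
  refine Finset.sum_congr rfl fun n hn => ?_
  have hn1 := hN n hn
  have hnp : (0 : ℝ) < n := hX.trans hn1.1
  have hev : exp (v n) = r * n / X := by
    rw [hv, exp_sub, exp_add, exp_log hr0, exp_log hnp, exp_log hX]
  have hv2 : |v n| ≤ 2 := by
    have h1 : exp (v n) ≤ 3 := by
      rw [hev, div_le_iff₀ hX]; nlinarith [hr.2]
    have h2 : 1 / 2 ≤ exp (v n) := by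
      rw [hev, le_div_iff₀ hX]; nlinarith [hr.1]
    rw [abs_le]
    constructor
    · by_contra! h
      have h3 := exp_lt_exp.2 h
      have h4 := add_one_le_exp (2 : ℝ)
      have h5 : exp (-2) * exp 2 = 1 := by rw [← exp_add]; simp
      nlinarith [exp_pos (-2)]
    · by_contra! h
      have h3 := exp_lt_exp.2 h
      have h4 := add_one_le_exp (2 : ℝ)
      linarith
  rw [integral_const_mul, hG _ hv2, hev, eR]
  have h6 : (exp (-(log r / 2)) : ℝ) * (Complex.exp (((log X - log n) / 2 : ℝ)) *
      (exp (v n / 2) : ℝ)) = 1 := by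
    rw [Complex.ofReal_exp, Complex.ofReal_exp, ← Complex.exp_add, ← Complex.exp_add,
      ← Complex.exp_zero]
    congr 1
    simp only [hv]
    push_cast
    ring
  have h7 : β * X * (r * n / X) = β * r * n := by field_simp
  rw [h7]
  linear_combination ((-1 : ℂ) * (g n * Complex.exp (2 * π * Complex.I * (β * r * n : ℝ)))) * h6

lemma integral_tail_kernel_le {G : ℝ → ℂ} {C Y η : ℝ} (hC : 0 < C) (hY : Y ≠ 0) (hη : 0 < η)
    (hη1 : η ≤ 1 / 1000) (hGi : Integrable G)
    (h1 : ∀ ξ, |ξ| ≤ |Y| / 100 → ‖G ξ‖ ≤ C / Y ^ 2)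
    (h2 : ∀ ξ, 100 * |Y| ≤ |ξ| → ‖G ξ‖ ≤ C / ξ ^ 2) :
    ∫ ξ in {ξ : ℝ | η * |Y| ≤ 2 * π * |ξ| ∧ 2 * π * |ξ| ≤ |Y| / η}ᶜ, ‖G ξ‖ ≤
      50 * C * η / |Y| := by
  have hY0 : 0 < |Y| := abs_pos.2 hY
  have hp3 := pi_gt_three
  have hp4 := pi_lt_d2
  set R : ℝ := η * |Y| / (2 * π) with hR
  set S : ℝ := |Y| / (2 * π * η) with hS
  have hR0 : 0 < R := by positivity
  have hS0 : 0 < S := by positivity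
  set M : ℝ → ℝ := fun ξ =>
    2 * C / Y ^ 2 * (1 + (ξ / R) ^ 2)⁻¹ + 2 * C / S ^ 2 * (1 + (ξ / S) ^ 2)⁻¹
    with hM
  have i1 : ∀ R : ℝ, R ≠ 0 → Integrable fun ξ : ℝ => (1 + (ξ / R) ^ 2)⁻¹ := fun R hR =>
    integrable_inv_one_add_sq.comp_div hR
  have e1 : ∀ R : ℝ, 0 < R → ∫ ξ : ℝ, (1 + (ξ / R) ^ 2)⁻¹ = R * π := fun R hR => by
    rw [Measure.integral_comp_div (fun ξ : ℝ => (1 + ξ ^ 2)⁻¹), integral_univ_inv_one_add_sq,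
      abs_of_pos hR, smul_eq_mul]
  have hMi : Integrable M := ((i1 R hR0.ne').const_mul _).add ((i1 S hS0.ne').const_mul _)
  have hM0 : ∀ ξ, 0 ≤ M ξ := fun ξ => by simp only [hM]; positivity
  have hms : MeasurableSet {ξ : ℝ | η * |Y| ≤ 2 * π * |ξ| ∧ 2 * π * |ξ| ≤ |Y| / η} := by
    have hm : Measurable fun ξ : ℝ => 2 * π * |ξ| := by fun_prop
    exact hm measurableSet_Icc
  calc _ ≤ ∫ ξ in {ξ : ℝ | η * |Y| ≤ 2 * π * |ξ| ∧ 2 * π * |ξ| ≤ |Y| / η}ᶜ, M ξ := by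
        refine setIntegral_mono_on hGi.norm.integrableOn hMi.integrableOn hms.compl fun ξ hξ => ?_
        rcases not_and_or.1 hξ with h | h <;> rw [not_le] at h
        · have hξR : |ξ| ≤ R := by rw [hR, le_div_iff₀ (by positivity)]; linarith
          have hs : (ξ / R) ^ 2 ≤ 1 := by
            rw [div_pow, div_le_one (by positivity), sq_le_sq, abs_of_pos hR0]; exact hξR
          calc ‖G ξ‖ ≤ C / Y ^ 2 := h1 ξ (by nlinarith [abs_nonneg ξ])
            _ = 2 * C / Y ^ 2 * (2)⁻¹ := by ring
            _ ≤ 2 * C / Y ^ 2 * (1 + (ξ / R) ^ 2)⁻¹ := by gcongr; linarith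
            _ ≤ M ξ := by simp only [hM]; rw [le_add_iff_nonneg_right]; positivity
        · have hξS : S ≤ |ξ| := by
            rw [hS, div_le_iff₀ (by positivity)]
            rw [div_lt_iff₀ hη] at h
            linarith
          have hξ0 : 0 < |ξ| := hS0.trans_le hξS
          have hs : 1 ≤ (ξ / S) ^ 2 := by
            rw [div_pow, one_le_div (by positivity), sq_le_sq, abs_of_pos hS0]; exact hξS
          have hbig : 100 * |Y| ≤ |ξ| := by
            refine le_trans ?_ hξS
            rw [hS, le_div_iff₀ (by positivity)]
            have : 2 * π * η ≤ 2 * 3.15 * (1 / 1000) := by gcongr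
            nlinarith
          have hx2 : 0 < ξ ^ 2 := by rw [← sq_abs]; positivity
          calc ‖G ξ‖ ≤ C / ξ ^ 2 := h2 ξ hbig
            _ = 2 * C / S ^ 2 * (2 * (ξ / S) ^ 2)⁻¹ := by field_simp
            _ ≤ 2 * C / S ^ 2 * (1 + (ξ / S) ^ 2)⁻¹ := by gcongr; linarith
            _ ≤ M ξ := by simp only [hM]; rw [le_add_iff_nonneg_left]; positivity
    _ ≤ ∫ ξ, M ξ := setIntegral_le_integral hMi (Filter.Eventually.of_forall hM0)
    _ = 2 * C / Y ^ 2 * (R * π) + 2 * C / S ^ 2 * (S * π) := by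
        simp only [hM]
        rw [integral_add ((i1 R hR0.ne').const_mul _) ((i1 S hS0.ne').const_mul _),
          integral_const_mul, integral_const_mul, e1 R hR0, e1 S hS0]
    _ = (1 + 4 * π ^ 2) * C * η / |Y| := by
        rw [hR, hS, ← sq_abs Y]; field_simp; ring
    _ ≤ _ := by gcongr; nlinarith

lemma continuous_intervalIntegral_window {φ : ℝ → ℝ} (hφ : Continuous φ) (w : ℝ) :
    Continuous fun t => ∫ s in (t - w)..(t + w), φ s := by
  have h := intervalIntegral.continuous_primitive (f := φ) (μ := volume)
    (fun a b => hφ.intervalIntegrable a b) 0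
  have e : (fun t => ∫ s in (t - w)..(t + w), φ s) =
      fun t => (∫ s in (0 : ℝ)..(t + w), φ s) - ∫ s in (0 : ℝ)..(t - w), φ s := by
    ext t
    rw [intervalIntegral.integral_interval_sub_left] <;> exact hφ.intervalIntegrable _ _
  rw [e]
  exact (h.comp (by fun_prop)).sub (h.comp (by fun_prop))

lemma isCompact_annulus (A B : ℝ) : IsCompact {t : ℝ | A ≤ |t| ∧ |t| ≤ B} := by
  refine IsCompact.of_isClosed_subset (isCompact_Icc (a := -B) (b := B)) ?_
    fun t ht => abs_le.1 ht.2
  have hm : Continuous fun t : ℝ => |t| := continuous_abs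
  exact isClosed_Icc.preimage hm

lemma integral_sq_window_le {φ : ℝ → ℝ} (hφ : Continuous φ) (hφ0 : ∀ t, 0 ≤ φ t) {A B w : ℝ}
    (hA : 0 < A) (hw : 0 < w) (hAB : w ≤ B - A) :
    ∫ x, (∫ ξ, windowInd (w / (2 * π)) (ξ - x) *
        {ξ : ℝ | A ≤ 2 * π * |ξ| ∧ 2 * π * |ξ| ≤ B}.indicator (fun ξ => φ (-(2 * π) * ξ)) ξ) ^ 2 ≤
      1 / (4 * π ^ 3) * ∫ t in {t : ℝ | A ≤ |t| ∧ |t| ≤ B},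
        (∫ s in (t - w)..(t + w), φ s) ^ 2 := by
  have hp := pi_pos
  have h2p := two_pi_pos
  set J : Set ℝ := {ξ : ℝ | A ≤ 2 * π * |ξ| ∧ 2 * π * |ξ| ≤ B} with hJ
  set I : Set ℝ := {t : ℝ | A ≤ |t| ∧ |t| ≤ B} with hI
  set l : ℝ := w / (2 * π) with hl
  have hl0 : 0 < l := by positivity
  have hlw : 2 * π * l = w := by rw [hl]; field_simp
  set W : ℝ → ℝ := fun t => ∫ s in (t - w)..(t + w), φ s with hW
  have hWc : Continuous W := continuous_intervalIntegral_window hφ w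
  have hJm : MeasurableSet J := by
    have hm : Measurable fun ξ : ℝ => 2 * π * |ξ| := by fun_prop
    exact hm measurableSet_Icc
  have hIm : MeasurableSet I := (isCompact_annulus A B).measurableSet
  set F : ℝ → ℝ := fun x => ∫ ξ, windowInd l (ξ - x) * J.indicator (fun ξ => φ (-(2 * π) * ξ)) ξ
    with hF
  set K : ℝ → ℝ := I.indicator fun t => W t ^ 2 with hK
  have hK0 : ∀ t, 0 ≤ K t := fun t => Set.indicator_nonneg (fun _ _ => sq_nonneg _) t
  have hKi : Integrable K := by
    rw [hK, integrable_indicator_iff hIm]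
    exact (hWc.pow 2).continuousOn.integrableOn_compact (isCompact_annulus A B)
  have hF0 : ∀ x, 0 ≤ F x := fun x => integral_nonneg fun ξ =>
    mul_nonneg (windowInd_nonneg _ _) (Set.indicator_nonneg (fun _ _ => hφ0 _) _)
  have hint : ∀ x, F x ≤ 1 / (2 * π) * ∫ s in (-(2 * π) * x - w)..(-(2 * π) * x), φ s := by
    intro x
    have e : ∫ ξ in x..(x + l), φ (-(2 * π) * ξ) =
        1 / (2 * π) * ∫ s in (-(2 * π) * x - w)..(-(2 * π) * x), φ s := by
      rw [intervalIntegral.integral_comp_mul_left φ (by linarith : -(2 * π) ≠ 0),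
        intervalIntegral.integral_symm, smul_eq_mul]
      have : -(2 * π) * (x + l) = -(2 * π) * x - w := by rw [← hlw]; ring
      rw [this, inv_neg]; ring
    rw [← e, intervalIntegral.integral_of_le (by linarith), ← integral_Icc_eq_integral_Ioc,
      ← integral_indicator measurableSet_Icc]
    refine integral_mono_of_nonneg (Filter.Eventually.of_forall fun ξ =>
      mul_nonneg (windowInd_nonneg _ _) (Set.indicator_nonneg (fun _ _ => hφ0 _) _)) ?_
      (Filter.Eventually.of_forall fun ξ => ?_)
    · rw [integrable_indicator_iff measurableSet_Icc]
      exact Continuous.integrableOn_Icc (by fun_prop)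
    · by_cases h : ξ ∈ Set.Icc x (x + l)
      · simp only [Set.indicator_of_mem h]
        rw [windowInd_of_mem ⟨by linarith [h.1], by linarith [h.2]⟩, one_mul]
        exact Set.indicator_le_self' (fun _ _ => hφ0 _) ξ
      · simp only [Set.indicator_of_notMem h]
        rw [windowInd_of_notMem (fun h' => h ⟨by linarith [h'.1], by linarith [h'.2]⟩), zero_mul]
  have hle1 : ∀ x, F x ≤ 1 / (2 * π) * W (-(2 * π) * x) := by
    intro x
    refine (hint x).trans ?_
    gcongr
    exact intervalIntegral.integral_mono_interval le_rfl (by linarith) (by linarith)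
      (Filter.Eventually.of_forall hφ0) (hφ.intervalIntegrable _ _)
  have hle2 : ∀ x, F x ≤ 1 / (2 * π) * W (-(2 * π) * x - w) := by
    intro x
    refine (hint x).trans ?_
    gcongr
    exact intervalIntegral.integral_mono_interval (by linarith) (by linarith) (by linarith)
      (Filter.Eventually.of_forall hφ0) (hφ.intervalIntegrable _ _)
  have hpt : ∀ x, F x ^ 2 ≤ 1 / (4 * π ^ 2) * (K (-(2 * π) * x) + K (-(2 * π) * x - w)) := by
    intro x
    have c1 : -(2 * π) * x ∈ I → F x ^ 2 ≤ 1 / (4 * π ^ 2) * K (-(2 * π) * x) := by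
      intro h
      rw [hK, Set.indicator_of_mem h]
      calc F x ^ 2 ≤ (1 / (2 * π) * W (-(2 * π) * x)) ^ 2 :=
            pow_le_pow_left₀ (hF0 x) (hle1 x) 2
        _ = _ := by rw [mul_pow]; congr 1; field_simp; norm_num
    have c2 : -(2 * π) * x - w ∈ I → F x ^ 2 ≤ 1 / (4 * π ^ 2) * K (-(2 * π) * x - w) := by
      intro h
      rw [hK, Set.indicator_of_mem h]
      calc F x ^ 2 ≤ (1 / (2 * π) * W (-(2 * π) * x - w)) ^ 2 :=
            pow_le_pow_left₀ (hF0 x) (hle2 x) 2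
        _ = _ := by rw [mul_pow]; congr 1; field_simp; norm_num
    have hn1 := hK0 (-(2 * π) * x)
    have hn2 := hK0 (-(2 * π) * x - w)
    have h4 : 0 ≤ 1 / (4 * π ^ 2) := by positivity
    by_cases h1 : -(2 * π) * x ∈ I
    · refine (c1 h1).trans ?_
      gcongr; linarith
    by_cases h2 : -(2 * π) * x - w ∈ I
    · refine (c2 h2).trans ?_
      gcongr; linarith
    have hz : F x = 0 := by
      refine integral_eq_zero_of_ae (Filter.Eventually.of_forall fun ξ => ?_)
      by_cases hξ : ξ - x ∈ Set.Icc 0 l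
      · by_cases hξJ : ξ ∈ J
        · exfalso
          have b1 := mul_le_mul_of_nonneg_left hξ.1 h2p.le
          have b2 := mul_le_mul_of_nonneg_left hξ.2 h2p.le
          rw [hlw] at b2
          obtain ⟨j1, j2⟩ := hξJ
          have e1 : 2 * π * |ξ| = |-(2 * π) * ξ| := by
            rw [abs_mul, abs_neg, abs_of_pos h2p]
          rw [e1] at j1 j2
          simp only [hI, Set.mem_ofPred_eq, not_and_or, not_le] at h1 h2
          generalize hs : -(2 * π) * ξ = s at *
          generalize ht : -(2 * π) * x = t at *
          have b3 : s ≤ t := by linarith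
          have b4 : t - w ≤ s := by linarith
          clear * - h1 h2 j1 j2 b3 b4 hA hw hAB
          rcases abs_cases s with ⟨q1, _⟩ | ⟨q1, _⟩ <;>
          rcases abs_cases t with ⟨q2, _⟩ | ⟨q2, _⟩ <;>
          rcases abs_cases (t - w) with ⟨q3, _⟩ | ⟨q3, _⟩ <;>
          rw [q1] at j1 j2 <;> rw [q2] at h1 <;> rw [q3] at h2 <;>
          rcases h1 with h1 | h1 <;> rcases h2 with h2 | h2 <;> linarith
        · simp [Set.indicator_of_notMem hξJ]
      · simp [windowInd_of_notMem hξ]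
    rw [hz, zero_pow two_ne_zero]
    exact mul_nonneg h4 (add_nonneg hn1 hn2)
  have hi1 : Integrable fun x => K (-(2 * π) * x) := hKi.comp_mul_left' (by linarith)
  have hi2 : Integrable fun x => K (-(2 * π) * x - w) :=
    (hKi.comp_sub_right w).comp_mul_left' (R := -(2 * π)) (by linarith)
  have hKe : ∫ t, K t = ∫ t in I, W t ^ 2 := integral_indicator hIm
  have habs : |(-(2 * π))⁻¹| = 1 / (2 * π) := by
    rw [inv_neg, abs_neg, abs_of_pos (by positivity), one_div]
  calc ∫ x, F x ^ 2 ≤ ∫ x, 1 / (4 * π ^ 2) * (K (-(2 * π) * x) + K (-(2 * π) * x - w)) :=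
        integral_mono_of_nonneg (Filter.Eventually.of_forall fun x => sq_nonneg _)
          ((hi1.add hi2).const_mul _) (Filter.Eventually.of_forall hpt)
    _ = 1 / (4 * π ^ 2) * (1 / (2 * π) * (∫ t, K t) + 1 / (2 * π) * ∫ t, K t) := by
        rw [integral_const_mul, integral_add hi1 hi2, Measure.integral_comp_mul_left K,
          Measure.integral_comp_mul_left (fun y => K (y - w)), integral_sub_right_eq_self K w, habs,
          smul_eq_mul]
    _ = 1 / (4 * π ^ 3) * ∫ t in I, W t ^ 2 := by rw [hKe]; field_simp; ring

lemma continuous_integral_mul_exp {ψ : ℝ → ℂ} (hψ : Integrable ψ) :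
    Continuous fun u : ℝ => ∫ ξ, ψ ξ * Complex.exp (2 * π * Complex.I * (ξ * u)) := by
  refine continuous_of_dominated (bound := fun ξ => ‖ψ ξ‖)
    (fun u => hψ.aestronglyMeasurable.mul (by fun_prop))
    (fun u => Filter.Eventually.of_forall fun ξ => ?_) hψ.norm
    (Filter.Eventually.of_forall fun ξ => by fun_prop)
  have := norm_eR (ξ * u)
  rw [eR] at this
  push_cast at this
  rw [norm_mul, this, mul_one]

lemma norm_integral_mul_exp_le (ψ : ℝ → ℂ) (u : ℝ) :
    ‖∫ ξ, ψ ξ * Complex.exp (2 * π * Complex.I * (ξ * u))‖ ≤ ∫ ξ, ‖ψ ξ‖ := by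
  refine (norm_integral_le_integral_norm _).trans_eq ?_
  congr 1
  ext ξ
  have := norm_eR (ξ * u)
  rw [eR] at this
  push_cast at this
  rw [norm_mul, this, mul_one]

lemma integral_scale_window (Φ : ℝ → ℝ) {β H : ℝ} (hβ : β ≠ 0) (hH : 0 < H) :
    ∫ θ in (β - 1 / H)..(β + 1 / H), Φ θ =
      |β| * ∫ r in (1 - 1 / (|β| * H))..(1 + 1 / (|β| * H)), Φ (β * r) := by
  rw [intervalIntegral.integral_comp_mul_left Φ hβ, smul_eq_mul, ← mul_assoc]
  rcases lt_or_gt_of_ne hβ with h | h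
  · rw [abs_of_neg h, intervalIntegral.integral_symm, neg_mul, mul_inv_cancel₀ hβ, neg_one_mul]
    congr 2 <;> field_simp <;> ring
  · rw [abs_of_pos h, mul_inv_cancel₀ hβ, one_mul]
    congr 1 <;> field_simp

lemma integral_inv_mul_comp_log_le {Φ : ℝ → ℝ} (hΦ : Continuous Φ) (hΦ0 : ∀ u, 0 ≤ Φ u) {δ L : ℝ}
    (hδ : 0 < δ) (hδ1 : δ ≤ 1 / 2) (hL : 2 * δ ≤ L) :
    ∫ r in (1 - δ)..(1 + δ), r⁻¹ * Φ (log r) ≤ ∫ u in (-L)..L, Φ u := by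
  have h0 : ∀ r ∈ Set.uIcc (1 - δ) (1 + δ), 0 < r := by
    intro r hr
    rw [Set.uIcc_of_le (by linarith)] at hr
    linarith [hr.1]
  have e : ∫ r in (1 - δ)..(1 + δ), r⁻¹ * Φ (log r) =
      ∫ u in (log (1 - δ))..(log (1 + δ)), Φ u := by
    rw [← intervalIntegral.integral_comp_mul_deriv (f := log) (f' := fun r => r⁻¹) (g := Φ)
      (fun r hr => hasDerivAt_log (h0 r hr).ne') _ hΦ]
    · simp only [Function.comp, mul_comm]
    · exact ContinuousOn.inv₀ continuousOn_id fun r hr => (h0 r hr).ne'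
  rw [e]
  have h1 : log (1 + δ) ≤ L := by
    have := log_le_sub_one_of_pos (by linarith : 0 < 1 + δ)
    linarith
  have h2 : -L ≤ log (1 - δ) := by
    have := one_sub_inv_le_log_of_pos (by linarith : 0 < 1 - δ)
    have h3 : (1 - δ)⁻¹ ≤ 1 + 2 * δ := by
      rw [inv_le_iff_one_le_mul₀ (by linarith)]; nlinarith
    linarith
  exact intervalIntegral.integral_mono_interval h2 (log_le_log (by linarith) (by linarith)) h1
    (Filter.Eventually.of_forall hΦ0) (hΦ.intervalIntegrable _ _)

lemma integral_sq_add_le {ψ₁ ψ₂ : ℝ → ℂ} (h1 : Integrable ψ₁) (h2 : Integrable ψ₂) {δ M : ℝ}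
    (hδ : 0 < δ) (hδ1 : δ ≤ 1 / 2) (hM : ∫ ξ, ‖ψ₂ ξ‖ ≤ M) :
    ∫ r in (1 - δ)..(1 + δ), r⁻¹ *
        ‖∫ ξ, (ψ₁ ξ + ψ₂ ξ) * Complex.exp (2 * π * Complex.I * (ξ * (log r : ℝ)))‖ ^ 2 ≤
      2 * (π ^ 2 / (1 / (2 * π * δ)) ^ 2 *
        ∫ x, windowMass volume ψ₁ (fun ξ => ξ) (1 / (2 * π * δ)) x ^ 2) +
        8 * π * δ * M ^ 2 := by
  have hp := pi_gt_three
  set l : ℝ := 1 / (2 * π * δ) with hl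
  have hl0 : 0 < l := by positivity
  have hl1 : 1 / l = 2 * π * δ := by rw [hl, one_div_one_div]
  have hc := continuous_integral_mul_exp (h1.add h2)
  have hc1 := continuous_integral_mul_exp h1
  have hM0 : 0 ≤ M := (integral_nonneg fun ξ => norm_nonneg _).trans hM
  set P : ℝ → ℂ := fun u => ∫ ξ, (ψ₁ ξ + ψ₂ ξ) * Complex.exp (2 * π * Complex.I * (ξ * u)) with hP
  set P₁ : ℝ → ℂ := fun u => ∫ ξ, ψ₁ ξ * Complex.exp (2 * π * Complex.I * (ξ * u)) with hP1
  have hadd : ∀ u, P u = P₁ u + ∫ ξ, ψ₂ ξ * Complex.exp (2 * π * Complex.I * (ξ * u)) := by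
    intro u
    have hi : ∀ ψ : ℝ → ℂ, Integrable ψ →
        Integrable fun ξ => ψ ξ * Complex.exp (2 * π * Complex.I * (ξ * u)) := by
      intro ψ hψ
      refine hψ.mul_bdd (c := 1) (by fun_prop) (Filter.Eventually.of_forall fun ξ => ?_)
      have := norm_eR (ξ * u)
      rw [eR] at this
      push_cast at this
      exact this.le
    rw [hP, hP1, ← integral_add (hi _ h1) (hi _ h2)]
    simp only [add_mul]
  have hsq : ∀ u, ‖P u‖ ^ 2 ≤ 2 * ‖P₁ u‖ ^ 2 + 2 * M ^ 2 := by
    intro u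
    have h3 := (norm_integral_mul_exp_le ψ₂ u).trans hM
    have h4 : ‖P u‖ ≤ ‖P₁ u‖ + M := by
      rw [hadd]; exact (norm_add_le _ _).trans (by gcongr)
    calc ‖P u‖ ^ 2 ≤ (‖P₁ u‖ + M) ^ 2 := by gcongr
      _ ≤ _ := by nlinarith [sq_nonneg (‖P₁ u‖ - M)]
  have hg := gallagher (μ := volume) (ψ := ψ₁) (ξ := fun ξ : ℝ => ξ) hl0 h1 measurable_id
  rw [hl1] at hg
  calc _ ≤ ∫ u in (-(2 * π * δ))..(2 * π * δ), ‖P u‖ ^ 2 :=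
        integral_inv_mul_comp_log_le (Φ := fun u => ‖P u‖ ^ 2) (hc.norm.pow 2)
          (fun u => sq_nonneg _) hδ hδ1 (by nlinarith)
    _ ≤ ∫ u in (-(2 * π * δ))..(2 * π * δ), (2 * ‖P₁ u‖ ^ 2 + 2 * M ^ 2) := by
        refine intervalIntegral.integral_mono_on (by nlinarith)
          ((hc.norm.pow 2).intervalIntegrable _ _)
          (((hc1.norm.pow 2).const_mul _).add continuous_const |>.intervalIntegrable _ _)
          fun u _ => hsq u
    _ = 2 * (∫ u in (-(2 * π * δ))..(2 * π * δ), ‖P₁ u‖ ^ 2) + 8 * π * δ * M ^ 2 := by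
        rw [intervalIntegral.integral_add, intervalIntegral.integral_const_mul,
          intervalIntegral.integral_const, smul_eq_mul]
        · ring
        · exact ((hc1.norm.pow 2).const_mul _).intervalIntegrable _ _
        · exact continuous_const.intervalIntegrable _ _
    _ ≤ _ := by gcongr

lemma integral_windowMass_mellin_le {G : ℝ → ℂ} (hG : Continuous G) (hGi : Integrable G)
    {X : ℝ} (hX : 0 < X) {N : Finset ℕ} (hN : ∀ n ∈ N, X < (n : ℝ)) (g : ℕ → ℂ) {A B w k : ℝ}
    (hk : ∀ ξ, ‖G ξ‖ * exp (log X / 2) ≤ k) (hA : 0 < A) (hw : 0 < w) (hAB : w ≤ B - A) :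
    ∫ x, windowMass volume ({ξ : ℝ | A ≤ 2 * π * |ξ| ∧ 2 * π * |ξ| ≤ B}.indicator
        (mellinDensity G X N g)) (fun ξ => ξ) (w / (2 * π)) x ^ 2 ≤
      k ^ 2 * (1 / (4 * π ^ 3) * ∫ t in {t : ℝ | A ≤ |t| ∧ |t| ≤ B},
        (∫ s in (t - w)..(t + w), ‖dirPoly N g s‖) ^ 2) := by
  have h2p := two_pi_pos
  have hN0 : ∀ n ∈ N, n ≠ 0 := fun n hn h => by have := hN n hn; simp [h] at this; linarith
  have hDc := continuous_dirPoly hN0 g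
  refine le_trans ?_ (mul_le_mul_of_nonneg_left
    (integral_sq_window_le hDc.norm (fun t => norm_nonneg _) hA hw hAB) (sq_nonneg k))
  set J : Set ℝ := {ξ : ℝ | A ≤ 2 * π * |ξ| ∧ 2 * π * |ξ| ≤ B} with hJ
  have hJm : MeasurableSet J := by
    have hm : Measurable fun ξ : ℝ => 2 * π * |ξ| := by fun_prop
    exact hm measurableSet_Icc
  set D : ℝ → ℂ := J.indicator fun ξ => dirPoly N g (-(2 * π) * ξ) with hD
  have hDi : Integrable D := by
    rw [hD, integrable_indicator_iff hJm]
    refine IntegrableOn.mono_set (t := Set.Icc (-(B / (2 * π))) (B / (2 * π)))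
      (Continuous.integrableOn_Icc (by fun_prop)) fun ξ hξ => ?_
    refine abs_le.1 ?_
    rw [le_div_iff₀ h2p, mul_comm]
    exact hξ.2
  have hDw : ∀ x, windowMass volume D (fun ξ => ξ) (w / (2 * π)) x =
      ∫ ξ, windowInd (w / (2 * π)) (ξ - x) *
        J.indicator (fun ξ => ‖dirPoly N g (-(2 * π) * ξ)‖) ξ := by
    intro x
    simp only [windowMass, hD, norm_indicator_eq_indicator_norm]
  simp_rw [← hDw]
  rw [← integral_const_mul]
  have hk0 : 0 ≤ k := le_trans (by positivity) (hk 0)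
  have hmi := (integrable_mellinDensity hG hGi hX hN g).indicator hJm
  have hwi : ∀ ψ : ℝ → ℂ, Integrable ψ → ∀ x,
      Integrable fun ξ => windowInd (w / (2 * π)) (ξ - x) * ‖ψ ξ‖ := by
    intro ψ hψ x
    refine hψ.norm.bdd_mul (c := 1) ?_ (Filter.Eventually.of_forall fun ξ => ?_)
    · have := measurable_windowInd (w / (2 * π))
      exact Measurable.aestronglyMeasurable (by fun_prop)
    · rw [Real.norm_of_nonneg (windowInd_nonneg _ _)]; exact windowInd_le_one _ _
  refine integral_mono (integrable_windowMass_sq hmi measurable_id)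
    ((integrable_windowMass_sq hDi measurable_id).const_mul _) fun x => ?_
  simp only
  rw [← mul_pow]
  refine pow_le_pow_left₀ (integral_nonneg fun ξ =>
    mul_nonneg (windowInd_nonneg _ _) (norm_nonneg _)) ?_ 2
  simp only [windowMass]
  rw [← integral_const_mul]
  refine integral_mono (hwi _ hmi x) ((hwi _ hDi x).const_mul _) fun ξ => ?_
  simp only
  rw [mul_left_comm]
  refine mul_le_mul_of_nonneg_left ?_ (windowInd_nonneg _ _)
  by_cases h : ξ ∈ J
  · rw [hD, Set.indicator_of_mem h, Set.indicator_of_mem h, norm_mellinDensity, ← mul_assoc]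
    exact mul_le_mul_of_nonneg_right (hk ξ) (norm_nonneg _)
  · rw [hD, Set.indicator_of_notMem h, Set.indicator_of_notMem h]
    simp

lemma mean_square_expSum_le_of_kernel {C H X β η : ℝ} (hC : 0 < C) (hH : 1 ≤ H) (hHX : H ≤ X)
    (hβ : β ≠ 0) (hη : 0 < η) (hη1 : η ≤ 1 / 1000) (hβH : 2 ≤ |β| * H)
    {N : Finset ℕ} (hN : ∀ n ∈ N, X < (n : ℝ) ∧ (n : ℝ) ≤ 2 * X) (g : ℕ → ℂ) {G : ℝ → ℂ}
    (hGi : Integrable G) (hGc : Continuous G)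
    (hG : ∀ v : ℝ, |v| ≤ 2 → ∫ ξ, G ξ * Complex.exp (2 * π * Complex.I * (ξ * v)) =
      (exp (v / 2) : ℂ) * Complex.exp (2 * π * Complex.I * (β * X * exp v : ℝ)))
    (hG0 : ∀ ξ, ‖G ξ‖ ≤ C / √|β * X|)
    (hG1 : ∀ ξ, |ξ| ≤ |β * X| / 100 → ‖G ξ‖ ≤ C / (β * X) ^ 2)
    (hG2 : ∀ ξ, 100 * |β * X| ≤ |ξ| → ‖G ξ‖ ≤ C / ξ ^ 2) :
    ∫ θ in (β - 1 / H)..(β + 1 / H), ‖∑ n ∈ N, g n * eR (θ * n)‖ ^ 2 ≤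
      2 * π * C ^ 2 * (1 / (|β| ^ 2 * H ^ 2) *
        ∫ t in {t : ℝ | η * |β| * X ≤ |t| ∧ |t| ≤ |β| * X / η},
          (∫ s in (t - |β| * H)..(t + |β| * H), ‖dirPoly N g s‖) ^ 2) +
      10000 * π * C ^ 2 * (η ^ 2 / H ^ 2 * ∫ x, shortMass N g H x ^ 2) := by
  have hp := pi_gt_three
  have hX : 0 < X := by linarith
  have hH0 : 0 < H := by linarith
  have hb : 0 < |β| := abs_pos.2 hβ
  have hY : β * X ≠ 0 := mul_ne_zero hβ hX.ne'
  have hYabs : |β * X| = |β| * X := by rw [abs_mul, abs_of_pos hX]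
  have hY0 : 0 < |β * X| := abs_pos.2 hY
  set w := |β| * H with hw
  have hw0 : 0 < w := by positivity
  set δ := 1 / w with hδ
  have hδ0 : 0 < δ := by positivity
  have hδ1 : δ ≤ 1 / 2 := by
    rw [hδ]; exact one_div_le_one_div_of_le two_pos hβH
  set ψ := mellinDensity G X N g with hψ
  have hψi : Integrable ψ := integrable_mellinDensity hGc hGi hX (fun n hn => (hN n hn).1) g
  set J : Set ℝ := {ξ : ℝ | η * |β * X| ≤ 2 * π * |ξ| ∧ 2 * π * |ξ| ≤ |β * X| / η} with hJ
  have hJm : MeasurableSet J := by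
    have hm : Measurable fun ξ : ℝ => 2 * π * |ξ| := by fun_prop
    exact hm measurableSet_Icc
  set T := ∑ n ∈ N, ‖g n‖ with hT
  have hT0 : 0 ≤ T := Finset.sum_nonneg fun n _ => norm_nonneg _
  set M := 50 * C * η / |β * X| * T with hM
  have hψ2 : ∫ ξ, ‖Jᶜ.indicator ψ ξ‖ ≤ M := by
    simp_rw [norm_indicator_eq_indicator_norm]
    rw [integral_indicator hJm.compl]
    refine le_trans ?_ (mul_le_mul_of_nonneg_right
      (integral_tail_kernel_le hC hY hη hη1 hGi hG1 hG2) hT0)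
    rw [← integral_mul_const]
    refine setIntegral_mono hψi.norm.integrableOn (hGi.norm.mul_const _).integrableOn fun ξ => ?_
    simp only
    rw [hψ, norm_mellinDensity]
    exact mul_le_mul_of_nonneg_left (norm_dirPoly_le hX (fun n hn => (hN n hn).1) g _)
      (norm_nonneg _)
  have hsplit := integral_sq_add_le (hψi.indicator hJm) (hψi.indicator hJm.compl) hδ0 hδ1 hψ2
  simp_rw [Set.indicator_self_add_compl_apply] at hsplit
  have hmass := integral_windowMass_mellin_le hGc hGi hX (fun n hn => (hN n hn).1) g
    (A := η * |β * X|) (B := |β * X| / η) (w := w) (k := C / √|β * X| * exp (log X / 2))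
    (fun ξ => by gcongr; exact hG0 ξ) (by positivity) hw0 (by
      have h1 : w ≤ |β * X| := by rw [hw, hYabs]; gcongr
      have h2 : 1000 * |β * X| ≤ |β * X| / η := by
        rw [le_div_iff₀ hη]; nlinarith
      nlinarith)
  have hl : 1 / (2 * π * δ) = w / (2 * π) := by rw [hδ]; field_simp
  rw [hl] at hsplit
  have hk : (C / √|β * X| * exp (log X / 2)) ^ 2 = C ^ 2 / |β| := by
    rw [mul_pow, div_pow, sq_sqrt hY0.le, ← exp_nat_mul, hYabs]
    have : ((2 : ℕ) : ℝ) * (log X / 2) = log X := by push_cast; ring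
    rw [this, exp_log hX]
    field_simp
  rw [hk] at hmass
  have hcore : ∫ θ in (β - 1 / H)..(β + 1 / H), ‖∑ n ∈ N, g n * eR (θ * n)‖ ^ 2 =
      |β| * ∫ r in (1 - δ)..(1 + δ), r⁻¹ *
        ‖∫ ξ, ψ ξ * Complex.exp (2 * π * Complex.I * (ξ * (log r : ℝ)))‖ ^ 2 := by
    rw [integral_scale_window _ hβ hH0]
    congr 1
    refine intervalIntegral.integral_congr fun r hr => ?_
    rw [Set.uIcc_of_le (by linarith)] at hr
    have hr1 : r ∈ Set.Icc (1 / 2) (3 / 2) := ⟨by linarith [hr.1], by linarith [hr.2]⟩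
    have hr0 : 0 < r := by linarith [hr1.1]
    rw [expSum_eq_integral_mellinDensity hX hr1 hN g hGi hG, norm_mul, mul_pow, Complex.norm_real,
      Real.norm_of_nonneg (exp_pos _).le, ← exp_nat_mul]
    congr 1
    have : ((2 : ℕ) : ℝ) * (-(log r / 2)) = -log r := by push_cast; ring
    rw [this, exp_neg, exp_log hr0]
  have hset : {t : ℝ | η * |β * X| ≤ |t| ∧ |t| ≤ |β * X| / η} =
      {t : ℝ | η * |β| * X ≤ |t| ∧ |t| ≤ |β| * X / η} := by
    rw [hYabs, mul_assoc]
  rw [hset] at hmass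
  set W := ∫ t in {t : ℝ | η * |β| * X ≤ |t| ∧ |t| ≤ |β| * X / η},
          (∫ s in (t - w)..(t + w), ‖dirPoly N g s‖) ^ 2 with hW
  have hTX := sq_sum_norm_le hH hHX g hN
  set V := ∫ x, shortMass N g H x ^ 2 with hV
  have hV0 : 0 ≤ V := integral_nonneg fun x => sq_nonneg _
  have e1 : |β| * (2 * (π ^ 2 / (w / (2 * π)) ^ 2 * (C ^ 2 / |β| * (1 / (4 * π ^ 3) * W)))) =
      2 * π * C ^ 2 * (1 / (|β| ^ 2 * H ^ 2) * W) := by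
    rw [hw]; field_simp; norm_num
  have e2 : |β| * (8 * π * δ * M ^ 2) ≤ 10000 * π * C ^ 2 * (η ^ 2 / H ^ 2 * V) := by
    have hY2 : 2 ≤ |β * X| := by rw [hYabs]; exact hβH.trans (by rw [hw]; gcongr)
    calc |β| * (8 * π * δ * M ^ 2)
        = 20000 * π * C ^ 2 * η ^ 2 * (1 / w * (1 / |β * X|)) * (T ^ 2 / X) := by
          rw [hM, hδ, hYabs, hw]; field_simp; ring
      _ ≤ 20000 * π * C ^ 2 * η ^ 2 * (1 / 2 * (1 / 2)) * (2 / H ^ 2 * V) := by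
          gcongr
      _ = _ := by ring
  rw [hcore]
  calc _ ≤ |β| * (2 * (π ^ 2 / (w / (2 * π)) ^ 2 * (C ^ 2 / |β| * (1 / (4 * π ^ 3) * W))) +
        8 * π * δ * M ^ 2) := by
        gcongr
        refine hsplit.trans ?_
        gcongr
    _ ≤ _ := by rw [mul_add, e1]; gcongr

/-- Mean square of an exponential sum over a short interval of frequencies, in terms of the
Dirichlet polynomial with the same coefficients. -/
theorem exists_mean_square_expSum_le : ∃ C : ℝ, 0 < C ∧ ∀ H X β η : ℝ, 1 ≤ H → H ≤ X → β ≠ 0 →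
    0 < η → η ≤ 1 / 1000 → ∀ (N : Finset ℕ) (g : ℕ → ℂ),
    (∀ n ∈ N, X < (n : ℝ) ∧ (n : ℝ) ≤ 2 * X) →
    ∫ θ in (β - 1 / H)..(β + 1 / H), ‖∑ n ∈ N, g n * eR (θ * n)‖ ^ 2 ≤
      C * (1 / (|β| ^ 2 * H ^ 2) *
        (∫ t in {t : ℝ | η * |β| * X ≤ |t| ∧ |t| ≤ |β| * X / η},
          (∫ s in (t - |β| * H)..(t + |β| * H), ‖dirPoly N g s‖) ^ 2) +
      (η + 1 / (|β| * H)) ^ 2 / H ^ 2 * ∫ x, shortMass N g H x ^ 2) := by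
  obtain ⟨C, hC, hker⟩ := exists_phase_kernel
  have hp := pi_gt_three
  refine ⟨4 * π ^ 2 + 10000 * π * C ^ 2, by positivity, ?_⟩
  intro H X β η hH hHX hβ hη hη1 N g hN
  have hX : 0 < X := by linarith
  have hH0 : 0 < H := by linarith
  have hb : 0 < |β| := abs_pos.2 hβ
  have hW0 : 0 ≤ 1 / (|β| ^ 2 * H ^ 2) *
        (∫ t in {t : ℝ | η * |β| * X ≤ |t| ∧ |t| ≤ |β| * X / η},
          (∫ s in (t - |β| * H)..(t + |β| * H), ‖dirPoly N g s‖) ^ 2) :=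
    mul_nonneg (by positivity) (integral_nonneg fun x => sq_nonneg _)
  have hV0 : 0 ≤ ∫ x, shortMass N g H x ^ 2 := integral_nonneg fun x => sq_nonneg _
  have hV1 : 0 ≤ (η + 1 / (|β| * H)) ^ 2 / H ^ 2 * ∫ x, shortMass N g H x ^ 2 := by positivity
  have hC1 : 0 ≤ 4 * π ^ 2 := by positivity
  have hC2 : 0 ≤ 10000 * π * C ^ 2 := by positivity
  rcases le_total 2 (|β| * H) with h | h
  · obtain ⟨G, h1, h2, h3, h4, h5, h6⟩ := hker (β * X) (mul_ne_zero hβ hX.ne')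
    refine (mean_square_expSum_le_of_kernel hC hH hHX hβ hη hη1 h hN g h1 h2 h3 h4 h5 h6).trans ?_
    rw [mul_add]
    gcongr
    · nlinarith [sq_nonneg C]
    · nlinarith
    · have : 0 ≤ 1 / (|β| * H) := by positivity
      linarith
  · refine (gallagher_sum hH0 N g β).trans ?_
    have h1 : 1 / 2 ≤ 1 / (|β| * H) := one_div_le_one_div_of_le (by positivity) h
    have h2 : 1 ≤ 4 * (η + 1 / (|β| * H)) ^ 2 := by nlinarith
    calc π ^ 2 / H ^ 2 * ∫ x, shortMass N g H x ^ 2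
        ≤ π ^ 2 * (4 * (η + 1 / (|β| * H)) ^ 2) / H ^ 2 * ∫ x, shortMass N g H x ^ 2 := by
          gcongr
          nlinarith [sq_nonneg π]
      _ = 4 * π ^ 2 * ((η + 1 / (|β| * H)) ^ 2 / H ^ 2 * ∫ x, shortMass N g H x ^ 2) := by ring
      _ ≤ _ := by
          gcongr <;> linarith

lemma norm_gaussSum_sq_le {q : ℕ} [NeZero q] (χ : DirichletCharacter ℂ q) :
    ‖gaussSum χ (ZMod.stdAddChar (N := q))‖ ^ 2 ≤ q := by
  set ψ := ZMod.stdAddChar (N := q) with hψ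
  set F : ZMod q → ℂ := fun c => ∑ b, χ b * ψ (c * b) with hF
  have hunit : ∀ u : (ZMod q)ˣ, ‖F u‖ = ‖gaussSum χ ψ‖ := by
    intro u
    have h := gaussSum_mulShift χ ψ u
    rw [← h, norm_mul, χ.unit_norm_eq_one, one_mul]
    rfl
  have hpars : ∑ c, ‖F c‖ ^ 2 = q * ∑ b : ZMod q, ‖χ b‖ ^ 2 := by
    apply Complex.ofReal_injective
    push_cast
    have e1 : ∀ c, (‖F c‖ : ℂ) ^ 2 =
        ∑ b, ∑ b', χ b * (starRingEnd ℂ) (χ b') * ψ (c * (b - b')) := by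
      intro c
      rw [← Complex.mul_conj', hF, map_sum, Finset.sum_mul_sum]
      refine Finset.sum_congr rfl fun b _ => Finset.sum_congr rfl fun b' _ => ?_
      rw [(starRingEnd ℂ).map_mul, ← AddChar.map_neg_eq_conj, mul_sub, sub_eq_add_neg,
        AddChar.map_add_eq_mul]
      ring
    simp_rw [e1]
    rw [Finset.sum_comm, Finset.mul_sum]
    refine Finset.sum_congr rfl fun b _ => ?_
    rw [Finset.sum_comm]
    have hs : ∀ x : ZMod q, ∑ c, ψ (c * x) = if x = 0 then (q : ℂ) else 0 := by
      intro x
      rw [hψ, AddChar.sum_mulShift x (ZMod.isPrimitive_stdAddChar q), ZMod.card]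
      push_cast
      rfl
    simp_rw [← Finset.mul_sum, hs, sub_eq_zero]
    simp [Complex.mul_conj', mul_comm]
  have hchi : ∑ b : ZMod q, ‖χ b‖ ^ 2 = Fintype.card (ZMod q)ˣ := by
    rw [← Fintype.sum_of_injective (Units.val : (ZMod q)ˣ → ZMod q) Units.val_injective
      (fun _ => (1 : ℝ)) _ _ _]
    · simp
    · intro b hb
      rw [χ.map_nonunit fun ⟨u, hu⟩ => hb ⟨u, hu⟩]
      simp
    · intro u
      rw [χ.unit_norm_eq_one, one_pow]
  have hle : ∑ u : (ZMod q)ˣ, ‖F u‖ ^ 2 ≤ ∑ c, ‖F c‖ ^ 2 := by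
    have := Finset.sum_le_univ_sum_of_nonneg (f := fun c => ‖F c‖ ^ 2) (fun c => sq_nonneg _)
      (s := Finset.univ.map ⟨(Units.val : (ZMod q)ˣ → ZMod q), Units.val_injective⟩)
    rwa [Finset.sum_map] at this
  simp_rw [hunit] at hle
  rw [hpars, hchi, Finset.sum_const, nsmul_eq_mul, mul_comm] at hle
  have hpos : (0 : ℝ) < Fintype.card (ZMod q)ˣ := by exact_mod_cast Fintype.card_pos
  exact le_of_mul_le_mul_right hle hpos

/-- Expansion of an additive character into multiplicative ones, with small coefficients. -/
lemma exists_character_expansion {q : ℕ} [NeZero q] (a : (ZMod q)ˣ) :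
    ∃ τ : DirichletCharacter ℂ q → ℂ, (∀ χ, ‖τ χ‖ ≤ √q) ∧ ∀ n : ZMod q,
      (∑ χ, τ χ * χ n) =
        if IsUnit n then q.totient * ZMod.stdAddChar ((a : ZMod q) * n) else 0 := by
  set ψ := ZMod.stdAddChar (N := q) with hψ
  refine ⟨fun χ => ∑ b, χ⁻¹ b * ψ (a * b), fun χ => ?_, fun n => ?_⟩
  · have h := gaussSum_mulShift χ⁻¹ ψ a
    have h2 : ‖gaussSum χ⁻¹ (AddChar.mulShift ψ a)‖ = ‖gaussSum χ⁻¹ ψ‖ := by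
      rw [← h, norm_mul, χ⁻¹.unit_norm_eq_one, one_mul]
    refine le_sqrt_of_sq_le ?_
    change ‖gaussSum χ⁻¹ (AddChar.mulShift ψ a)‖ ^ 2 ≤ q
    rw [h2]
    exact norm_gaussSum_sq_le χ⁻¹
  · split_ifs with hn
    · simp_rw [Finset.sum_mul]
      rw [Finset.sum_comm]
      have e : ∀ b, ∑ χ : DirichletCharacter ℂ q, χ⁻¹ b * ψ (a * b) * χ n =
          (if b = n then (q.totient : ℂ) else 0) * ψ (a * b) := by
        intro b
        by_cases hb : IsUnit b
        · rw [← DirichletCharacter.sum_char_inv_mul_char_eq ℂ hb n, Finset.sum_mul]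
          refine Finset.sum_congr rfl fun χ _ => ?_
          obtain ⟨u, rfl⟩ := hb
          rw [MulChar.inv_apply, Ring.inverse_unit, ZMod.inv_coe_unit]
          ring
        · rw [if_neg (by rintro rfl; exact hb hn), zero_mul]
          exact Finset.sum_eq_zero fun χ _ => by rw [χ⁻¹.map_nonunit hb]; ring
      simp [e]
    · exact Finset.sum_eq_zero fun χ _ => by rw [χ.map_nonunit hn, mul_zero]

lemma le_card_divisors_mul_totient (q : ℕ) : q ≤ q.divisors.card * q.totient := by
  rcases Nat.eq_zero_or_pos q with rfl | hq
  · simp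
  conv_lhs => rw [← Nat.sum_totient q]
  rw [← smul_eq_mul]
  exact Finset.sum_le_card_nsmul _ _ _ fun d hd =>
    Nat.le_of_dvd (Nat.totient_pos.2 hq) (Nat.totient_dvd_of_dvd (Nat.dvd_of_mem_divisors hd))

lemma le_iSup_factorization {E : ℕ → ℕ → ℝ} {q m n : ℕ} (hq : 1 ≤ q)
    (h : q = m * n) : E m n ≤ ⨆ (q₀ : ℕ) (q₁ : ℕ) (_ : q = q₀ * q₁), E q₀ q₁ := by
  have bdd : ∀ u : ℕ → ℝ, (∀ k, q < k → u k = 0) → BddAbove (Set.range u) := by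
    intro u hu
    refine Set.Finite.bddAbove (Set.Finite.subset
      (((Set.finite_Iic q).image u).insert 0) ?_)
    rintro _ ⟨k, rfl⟩
    rcases le_or_gt k q with hk | hk
    · exact Or.inr ⟨k, hk, rfl⟩
    · exact Or.inl (hu k hk)
  have hne : ∀ q₀ q₁ : ℕ, q ≠ q₀ * q₁ → ⨆ _ : q = q₀ * q₁, E q₀ q₁ = 0 := by
    intro q₀ q₁ h'
    have : IsEmpty (q = q₀ * q₁) := ⟨h'⟩
    exact Real.iSup_of_isEmpty _
  have h1 : ∀ q₀ q₁ : ℕ, q < q₁ → ⨆ _ : q = q₀ * q₁, E q₀ q₁ = 0 := by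
    intro q₀ q₁ hlt
    refine hne _ _ fun h' => ?_
    exact absurd (Nat.le_of_dvd hq (Dvd.intro_left _ h'.symm)) (not_le.2 hlt)
  have h0 : ∀ q₀ : ℕ, q < q₀ → ⨆ (q₁ : ℕ) (_ : q = q₀ * q₁), E q₀ q₁ = 0 := by
    intro q₀ hlt
    have : ∀ q₁ : ℕ, ⨆ _ : q = q₀ * q₁, E q₀ q₁ = 0 := fun q₁ => hne _ _ fun h' =>
      absurd (Nat.le_of_dvd hq (Dvd.intro _ h'.symm)) (not_le.2 hlt)
    simp [this]
  calc E m n = ⨆ _ : q = m * n, E m n := (ciSup_pos (f := fun _ => E m n) h).symm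
    _ ≤ ⨆ (q₁ : ℕ) (_ : q = m * q₁), E m q₁ :=
      le_ciSup (f := fun q₁ => ⨆ _ : q = m * q₁, E m q₁) (bdd _ (h1 m)) n
    _ ≤ _ := le_ciSup (f := fun q₀ => ⨆ (q₁ : ℕ) (_ : q = q₀ * q₁), E q₀ q₁) (bdd _ h0) m

lemma dirPolyChar_eq_dirPoly {f : ℕ → ℂ} {K : ℕ} (hf0 : f 0 = 0) (hK : ∀ n, f n ≠ 0 → n < K)
    {q₀ q₁ : ℕ} (hq₀ : 0 < q₀) (χ : DirichletCharacter ℂ q₁) (t : ℝ) :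
    dirPolyChar f (1 / 2 + Complex.I * (t : ℂ)) χ q₀ =
      dirPoly (Finset.Ico 1 K) (fun m => f (q₀ * m) * χ (m : ZMod q₁)) t := by
  rw [dirPolyChar, dirPoly]
  refine finsum_eq_sum_of_support_subset _ fun m hm => ?_
  have hfm : f (q₀ * m) ≠ 0 := fun h => hm (by simp [h])
  have h1 := hK _ hfm
  have h2 : m ≠ 0 := by rintro rfl; exact hfm (by simpa using hf0)
  rw [Finset.coe_Ico]
  exact ⟨Nat.pos_of_ne_zero h2, lt_of_le_of_lt (Nat.le_mul_of_pos_left m hq₀) h1⟩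

lemma continuous_dirPolyChar {f : ℕ → ℂ} {K : ℕ} (hf0 : f 0 = 0) (hK : ∀ n, f n ≠ 0 → n < K)
    {q₀ q₁ : ℕ} (hq₀ : 0 < q₀) (χ : DirichletCharacter ℂ q₁) :
    Continuous fun t : ℝ => dirPolyChar f (1 / 2 + Complex.I * (t : ℂ)) χ q₀ := by
  simp_rw [dirPolyChar_eq_dirPoly hf0 hK hq₀ χ]
  exact continuous_dirPoly (fun n hn => by have := (Finset.mem_Ico.1 hn).1; omega) _

lemma eR_div_mul_eq_stdAddChar {q₀ q₁ : ℕ} (hq₀ : 0 < q₀) [NeZero q₁] (a : ℤ) (m : ℕ) :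
    eR ((a : ℝ) / ((q₀ * q₁ : ℕ) : ℝ) * ((q₀ * m : ℕ) : ℝ)) =
      ZMod.stdAddChar (N := q₁) ((a : ZMod q₁) * (m : ZMod q₁)) := by
  have h := ZMod.stdAddChar_coe (N := q₁) (a * m)
  push_cast at h
  rw [h, eR]
  congr 1
  have : (q₀ : ℂ) ≠ 0 := Nat.cast_ne_zero.2 hq₀.ne'
  have : (q₁ : ℂ) ≠ 0 := Nat.cast_ne_zero.2 (NeZero.ne q₁)
  push_cast
  field_simp

lemma norm_sum_gcd_eq_le {f : ℕ → ℂ} {K : ℕ} (hf0 : f 0 = 0) (hK : ∀ n, f n ≠ 0 → n < K)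
    {N : Finset ℕ} (hN : ∀ n, n ∈ N ↔ f n ≠ 0) {q₀ q₁ : ℕ} (hq₀ : 0 < q₀) (hq₁ : 0 < q₁) {a : ℤ}
    (ha : Int.gcd a (q₀ * q₁ : ℕ) = 1) (t : ℝ) :
    ‖∑ n ∈ N with Nat.gcd n (q₀ * q₁) = q₀,
        f n * eR ((a : ℝ) / ((q₀ * q₁ : ℕ) : ℝ) * n) / (n : ℂ) ^ (1 / 2 + Complex.I * (t : ℂ))‖ ≤
      ((q₀ * q₁).divisors.card : ℝ) / √((q₀ * q₁ : ℕ) : ℝ) *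
        ∑ χ : DirichletCharacter ℂ q₁, ‖dirPolyChar f (1 / 2 + Complex.I * (t : ℂ)) χ q₀‖ := by
  have : NeZero q₁ := ⟨hq₁.ne'⟩
  set s : ℂ := 1 / 2 + Complex.I * (t : ℂ) with hs
  have hau : IsUnit (a : ZMod q₁) := by
    rw [ZMod.coe_int_isUnit_iff_isCoprime]
    have h1 := (Int.isCoprime_iff_gcd_eq_one.2 ha).symm
    push_cast at h1
    exact h1.of_mul_left_right
  obtain ⟨u, hu⟩ := hau
  obtain ⟨τ, hτ, hexp⟩ := exists_character_expansion u
  have hreindex : ∑ n ∈ N with Nat.gcd n (q₀ * q₁) = q₀,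
        f n * eR ((a : ℝ) / ((q₀ * q₁ : ℕ) : ℝ) * n) / (n : ℂ) ^ s =
      ∑ m ∈ Finset.Ico 1 K with Nat.Coprime m q₁,
        f (q₀ * m) * eR ((a : ℝ) / ((q₀ * q₁ : ℕ) : ℝ) * ((q₀ * m : ℕ) : ℝ)) /
          ((q₀ * m : ℕ) : ℂ) ^ s := by
    symm
    refine Finset.sum_bij_ne_zero (fun m _ _ => q₀ * m) ?_ ?_ ?_ (fun _ _ _ => rfl)
    · intro m hm hne
      have hfm : f (q₀ * m) ≠ 0 := fun h => hne (by simp [h])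
      rw [Finset.mem_filter, hN, Nat.gcd_mul_left,
        Nat.Coprime.gcd_eq_one (Finset.mem_filter.1 hm).2, mul_one]
      exact ⟨hfm, rfl⟩
    · intro m _ _ m' _ _ h
      exact Nat.eq_of_mul_eq_mul_left hq₀ h
    · intro n hn hne
      obtain ⟨h1, h2⟩ := Finset.mem_filter.1 hn
      obtain ⟨m, rfl⟩ : q₀ ∣ n := h2 ▸ Nat.gcd_dvd_left n (q₀ * q₁)
      have hfm := (hN _).1 h1
      have hm0 : m ≠ 0 := by rintro rfl; exact hfm (by simpa using hf0)
      refine ⟨m, ?_, hne, rfl⟩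
      rw [Finset.mem_filter, Finset.mem_Ico]
      refine ⟨⟨Nat.pos_of_ne_zero hm0, lt_of_le_of_lt (Nat.le_mul_of_pos_left m hq₀) (hK _ hfm)⟩,
        ?_⟩
      rw [Nat.gcd_mul_left] at h2
      exact Nat.eq_of_mul_eq_mul_left hq₀ (h2.trans (mul_one q₀).symm)
  rw [hreindex]
  have hmain : (q₁.totient : ℂ) * ∑ m ∈ Finset.Ico 1 K with Nat.Coprime m q₁,
        f (q₀ * m) * eR ((a : ℝ) / ((q₀ * q₁ : ℕ) : ℝ) * ((q₀ * m : ℕ) : ℝ)) /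
          ((q₀ * m : ℕ) : ℂ) ^ s =
      ((q₀ : ℂ) ^ s)⁻¹ * ∑ χ : DirichletCharacter ℂ q₁, τ χ * dirPolyChar f s χ q₀ := by
    simp_rw [hs, dirPolyChar_eq_dirPoly hf0 hK hq₀, dirPoly, ← hs]
    rw [Finset.sum_filter, Finset.mul_sum, Finset.mul_sum]
    simp_rw [Finset.mul_sum]
    rw [Finset.sum_comm]
    refine Finset.sum_congr rfl fun m _ => ?_
    have e : ∑ χ : DirichletCharacter ℂ q₁, ((q₀ : ℂ) ^ s)⁻¹ *
        (τ χ * (f (q₀ * m) * χ (m : ZMod q₁) / (m : ℂ) ^ s)) =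
        ((q₀ : ℂ) ^ s)⁻¹ * f (q₀ * m) / (m : ℂ) ^ s *
          ∑ χ : DirichletCharacter ℂ q₁, τ χ * χ (m : ZMod q₁) := by
      rw [Finset.mul_sum]
      exact Finset.sum_congr rfl fun χ _ => by ring
    rw [e, hexp]
    by_cases hm : Nat.Coprime m q₁
    · rw [if_pos hm, if_pos ((ZMod.isUnit_iff_coprime m q₁).2 hm), hu,
        eR_div_mul_eq_stdAddChar hq₀ a m, Nat.cast_mul, Complex.natCast_mul_natCast_cpow]
      ring
    · rw [if_neg hm, if_neg (fun h => hm ((ZMod.isUnit_iff_coprime m q₁).1 h))]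
      ring
  set S := ∑ m ∈ Finset.Ico 1 K with Nat.Coprime m q₁,
        f (q₀ * m) * eR ((a : ℝ) / ((q₀ * q₁ : ℕ) : ℝ) * ((q₀ * m : ℕ) : ℝ)) /
          ((q₀ * m : ℕ) : ℂ) ^ s with hS
  set B := ∑ χ : DirichletCharacter ℂ q₁, ‖dirPolyChar f s χ q₀‖ with hB
  have hB0 : 0 ≤ B := Finset.sum_nonneg fun χ _ => norm_nonneg _
  have hsre : s.re = 1 / 2 := by simp [hs]
  have hle : (q₁.totient : ℝ) * ‖S‖ ≤ (√q₀)⁻¹ * (√q₁ * B) := by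
    have h1 := congrArg norm hmain
    rw [norm_mul, norm_mul, norm_inv, Complex.norm_natCast, Complex.norm_natCast_cpow_of_pos hq₀,
      hsre, ← sqrt_eq_rpow] at h1
    rw [h1]
    gcongr
    refine (norm_sum_le _ _).trans ?_
    rw [hB, Finset.mul_sum]
    refine Finset.sum_le_sum fun χ _ => ?_
    rw [norm_mul]
    exact mul_le_mul_of_nonneg_right (hτ χ) (norm_nonneg _)
  have hφ : (0 : ℝ) < q₁.totient := by exact_mod_cast Nat.totient_pos.2 hq₁
  have hcard : (q₁ : ℝ) ≤ ((q₀ * q₁).divisors.card : ℝ) * q₁.totient := by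
    have h1 := le_card_divisors_mul_totient q₁
    have h2 : q₁.divisors.card ≤ (q₀ * q₁).divisors.card :=
      Finset.card_le_card (Nat.divisors_subset_of_dvd (by positivity) (Dvd.intro_left _ rfl))
    exact_mod_cast h1.trans (Nat.mul_le_mul_right _ h2)
  have hs0 : 0 < √(q₀ : ℝ) := sqrt_pos.2 (by exact_mod_cast hq₀)
  have hs1 : 0 < √(q₁ : ℝ) := sqrt_pos.2 (by exact_mod_cast hq₁)
  have hq1s : √(q₁ : ℝ) * √(q₁ : ℝ) = q₁ := mul_self_sqrt (by positivity)
  rw [Nat.cast_mul, sqrt_mul (by positivity)]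
  rw [← mul_le_mul_iff_right₀ hφ]
  refine hle.trans ?_
  calc (√(q₀ : ℝ))⁻¹ * (√q₁ * B) = (√(q₁ : ℝ) * √(q₁ : ℝ)) * (B / (√q₀ * √q₁)) := by
        field_simp
    _ = (q₁ : ℝ) * (B / (√q₀ * √q₁)) := by rw [hq1s]
    _ ≤ (((q₀ * q₁).divisors.card : ℝ) * q₁.totient) * (B / (√q₀ * √q₁)) := by gcongr
    _ = _ := by ring

/-- A Dirichlet polynomial twisted by an additive character of denominator `q`, bounded by
Dirichlet polynomials twisted by multiplicative characters. -/
lemma norm_dirPoly_additive_twist_le {f : ℕ → ℂ} {K : ℕ} (hf0 : f 0 = 0)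
    (hK : ∀ n, f n ≠ 0 → n < K) {N : Finset ℕ} (hN : ∀ n, n ∈ N ↔ f n ≠ 0) {q : ℕ} (hq : 1 ≤ q)
    {a : ℤ} (ha : Int.gcd a q = 1) (t : ℝ) :
    ‖dirPoly N (fun n => f n * eR ((a : ℝ) / (q : ℝ) * n)) t‖ ≤
      (q.divisors.card : ℝ) / √(q : ℝ) * ∑ q₀ ∈ q.divisors,
        ∑ χ : DirichletCharacter ℂ (q / q₀),
          ‖dirPolyChar f (1 / 2 + Complex.I * (t : ℂ)) χ q₀‖ := by
  rw [dirPoly, ← Finset.sum_fiberwise_of_maps_to (s := N) (t := q.divisors)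
    (g := fun n => Nat.gcd n q)
    fun n _ => Nat.mem_divisors.2 ⟨Nat.gcd_dvd_right n q, by omega⟩]
  refine (norm_sum_le _ _).trans ?_
  rw [Finset.mul_sum]
  refine Finset.sum_le_sum fun q₀ hq₀ => ?_
  obtain ⟨q₁, rfl⟩ := Nat.dvd_of_mem_divisors hq₀
  have h0 : 0 < q₀ := Nat.pos_of_mem_divisors hq₀
  have h1 : 0 < q₁ := by
    rcases Nat.eq_zero_or_pos q₁ with rfl | h
    · simp at hq
    · exact h
  rw [Nat.mul_div_cancel_left q₁ h0]
  exact norm_sum_gcd_eq_le hf0 hK hN h0 h1 ha t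

lemma eR_add (x y : ℝ) : eR (x + y) = eR x * eR y := by
  rw [eR, eR, eR, ← Complex.exp_add]
  congr 1
  push_cast
  ring

lemma expSumR_add_eq {f : ℕ → ℂ} {N : Finset ℕ} (hN : ∀ n, n ∈ N ↔ f n ≠ 0) (α θ : ℝ) :
    expSumR f (α + θ) = ∑ n ∈ N, f n * eR (α * n) * eR (θ * n) := by
  rw [expSumR, finsum_eq_sum_of_support_subset (s := N)]
  · refine Finset.sum_congr rfl fun n _ => ?_
    rw [add_mul, eR_add, mul_assoc]
  · intro n hn
    exact (hN n).2 fun h => hn (by simp [h])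

lemma shortMass_eq_sum_Icc {f g : ℕ → ℂ} (hfg : ∀ n, ‖g n‖ = ‖f n‖) (hf0 : f 0 = 0)
    {N : Finset ℕ} (hN : ∀ n, n ∈ N ↔ f n ≠ 0) (H x : ℝ) :
    shortMass N g H x = ∑ n ∈ Finset.Icc ⌈x⌉₊ ⌊x + H⌋₊, ‖f n‖ := by
  rw [shortMass]
  refine Finset.sum_congr_of_eq_on_inter ?_ ?_ ?_
  · intro n hn hn'
    rw [windowInd_of_notMem, zero_mul]
    intro h
    refine hn' (Finset.mem_Icc.2 ⟨Nat.ceil_le.2 (by linarith [h.1]),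
      Nat.le_floor (by linarith [h.2])⟩)
  · intro n _ hn'
    have : f n = 0 := by_contra fun h => hn' ((hN n).2 h)
    rw [this, norm_zero]
  · intro n hn hn'
    have hn0 : n ≠ 0 := by rintro rfl; exact (hN 0).1 hn hf0
    obtain ⟨h1, h2⟩ := Finset.mem_Icc.1 hn'
    rw [windowInd_of_mem, one_mul, hfg]
    have h3 := Nat.ceil_le.1 h1
    have h4 := (Nat.le_floor_iff' hn0).1 h2
    constructor <;> linarith

/-- The sum over the characters of modulus `q₁` of short averages of twisted Dirichlet
polynomials on the critical line. -/
noncomputable def charWindowSum (f : ℕ → ℂ) (w : ℝ) (q₀ q₁ : ℕ) (t : ℝ) : ℝ :=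
  ∑ᶠ χ : DirichletCharacter ℂ q₁,
    ∫ t' in (t - w)..(t + w), ‖dirPolyChar f (1 / 2 + Complex.I * (t' : ℂ)) χ q₀‖

lemma continuous_charWindowSum {f : ℕ → ℂ} {K : ℕ} (hf0 : f 0 = 0) (hK : ∀ n, f n ≠ 0 → n < K)
    (w : ℝ) {q₀ : ℕ} (hq₀ : 0 < q₀) (q₁ : ℕ) : Continuous (charWindowSum f w q₀ q₁) := by
  have : charWindowSum f w q₀ q₁ = fun t => ∑ χ : DirichletCharacter ℂ q₁,
      ∫ t' in (t - w)..(t + w), ‖dirPolyChar f (1 / 2 + Complex.I * (t' : ℂ)) χ q₀‖ :=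
    funext fun t => finsum_eq_sum_of_fintype _
  rw [this]
  exact continuous_finsetSum _ fun χ _ =>
    continuous_intervalIntegral_window (continuous_dirPolyChar hf0 hK hq₀ χ).norm w

lemma integral_window_norm_dirPoly_le {f : ℕ → ℂ} {K : ℕ} (hf0 : f 0 = 0)
    (hK : ∀ n, f n ≠ 0 → n < K) {N : Finset ℕ} (hN : ∀ n, n ∈ N ↔ f n ≠ 0) {q : ℕ} (hq : 1 ≤ q)
    {a : ℤ} (ha : Int.gcd a q = 1) {w : ℝ} (hw : 0 ≤ w) (t : ℝ) :
    ∫ s in (t - w)..(t + w), ‖dirPoly N (fun n => f n * eR ((a : ℝ) / (q : ℝ) * n)) s‖ ≤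
      (q.divisors.card : ℝ) / √(q : ℝ) *
        ∑ q₀ ∈ q.divisors, charWindowSum f w q₀ (q / q₀) t := by
  have hN0 : ∀ n ∈ N, n ≠ 0 := by
    rintro n hn rfl
    exact (hN 0).1 hn hf0
  have hc : ∀ q₀ ∈ q.divisors, ∀ χ : DirichletCharacter ℂ (q / q₀),
      Continuous fun s : ℝ => ‖dirPolyChar f (1 / 2 + Complex.I * (s : ℂ)) χ q₀‖ :=
    fun q₀ h χ => (continuous_dirPolyChar hf0 hK (Nat.pos_of_mem_divisors h) χ).norm
  have hcs : ∀ q₀ ∈ q.divisors, Continuous fun s : ℝ => ∑ χ : DirichletCharacter ℂ (q / q₀),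
      ‖dirPolyChar f (1 / 2 + Complex.I * (s : ℂ)) χ q₀‖ :=
    fun q₀ h => continuous_finsetSum _ fun χ _ => hc q₀ h χ
  refine (intervalIntegral.integral_mono_on (by linarith)
    ((continuous_dirPoly hN0 _).norm.intervalIntegrable _ _)
    ((continuous_const.mul (continuous_finsetSum _ hcs)).intervalIntegrable _ _)
    fun s _ => norm_dirPoly_additive_twist_le hf0 hK hN hq ha s).trans_eq ?_
  simp only [Pi.mul_apply]
  rw [intervalIntegral.integral_const_mul, intervalIntegral.integral_finsetSum
    fun q₀ h => (hcs q₀ h).intervalIntegrable _ _]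
  congr 1
  refine Finset.sum_congr rfl fun q₀ h => ?_
  rw [intervalIntegral.integral_finsetSum fun χ _ => (hc q₀ h χ).intervalIntegrable _ _,
    charWindowSum, finsum_eq_sum_of_fintype]

lemma setIntegral_window_sq_le {f : ℕ → ℂ} {K : ℕ} (hf0 : f 0 = 0)
    (hK : ∀ n, f n ≠ 0 → n < K) {N : Finset ℕ} (hN : ∀ n, n ∈ N ↔ f n ≠ 0) {q : ℕ} (hq : 1 ≤ q)
    {a : ℤ} (ha : Int.gcd a q = 1) {w : ℝ} (hw : 0 ≤ w) {I : Set ℝ} (hI : IsCompact I) :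
    ∫ t in I, (∫ s in (t - w)..(t + w),
        ‖dirPoly N (fun n => f n * eR ((a : ℝ) / (q : ℝ) * n)) s‖) ^ 2 ≤
      (q.divisors.card : ℝ) ^ 4 / (q : ℝ) *
        ⨆ (q₀ : ℕ) (q₁ : ℕ) (_ : q = q₀ * q₁), ∫ t in I, charWindowSum f w q₀ q₁ t ^ 2 := by
  have hN0 : ∀ n ∈ N, n ≠ 0 := by
    rintro n hn rfl
    exact (hN 0).1 hn hf0
  set d : ℝ := (q.divisors.card : ℝ) with hd
  have hd0 : 0 ≤ d := Nat.cast_nonneg _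
  have hq0 : (0 : ℝ) < q := by exact_mod_cast hq
  have hB : ∀ q₀ ∈ q.divisors, Continuous fun t => charWindowSum f w q₀ (q / q₀) t ^ 2 :=
    fun q₀ h => (continuous_charWindowSum hf0 hK w (Nat.pos_of_mem_divisors h) _).pow 2
  have hpt : ∀ t, (∫ s in (t - w)..(t + w),
      ‖dirPoly N (fun n => f n * eR ((a : ℝ) / (q : ℝ) * n)) s‖) ^ 2 ≤
      d ^ 3 / q * ∑ q₀ ∈ q.divisors, charWindowSum f w q₀ (q / q₀) t ^ 2 := by
    intro t
    have h0 : 0 ≤ ∫ s in (t - w)..(t + w),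
        ‖dirPoly N (fun n => f n * eR ((a : ℝ) / (q : ℝ) * n)) s‖ :=
      intervalIntegral.integral_nonneg (by linarith) fun _ _ => norm_nonneg _
    have h1 := pow_le_pow_left₀ h0 (integral_window_norm_dirPoly_le hf0 hK hN hq ha hw t) 2
    rw [mul_pow, div_pow, sq_sqrt hq0.le] at h1
    refine h1.trans ?_
    have h2 := sq_sum_le_card_mul_sum_sq (s := q.divisors)
      (f := fun q₀ => charWindowSum f w q₀ (q / q₀) t)
    calc _ ≤ d ^ 2 / q * (d * ∑ q₀ ∈ q.divisors, charWindowSum f w q₀ (q / q₀) t ^ 2) := by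
          gcongr
      _ = _ := by ring
  refine (setIntegral_mono
    (((continuous_intervalIntegral_window
      (continuous_dirPoly hN0 _).norm w).pow 2).continuousOn.integrableOn_compact hI)
    ((continuous_const.mul (continuous_finsetSum _ hB)).continuousOn.integrableOn_compact hI)
    hpt).trans ?_
  simp only [Pi.mul_apply]
  rw [integral_const_mul, integral_finsetSum _
    fun q₀ h => (hB q₀ h).continuousOn.integrableOn_compact hI]
  have hsum : ∑ q₀ ∈ q.divisors, ∫ t in I, charWindowSum f w q₀ (q / q₀) t ^ 2 ≤
      d * ⨆ (q₀ : ℕ) (q₁ : ℕ) (_ : q = q₀ * q₁), ∫ t in I, charWindowSum f w q₀ q₁ t ^ 2 := by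
    rw [hd, ← nsmul_eq_mul]
    refine Finset.sum_le_card_nsmul _ _ _ fun q₀ h => ?_
    exact le_iSup_factorization (E := fun m n => ∫ t in I, charWindowSum f w m n t ^ 2) hq
      (Nat.mul_div_cancel' (Nat.dvd_of_mem_divisors h)).symm
  calc _ ≤ d ^ 3 / q * (d * ⨆ (q₀ : ℕ) (q₁ : ℕ) (_ : q = q₀ * q₁),
        ∫ t in I, charWindowSum f w q₀ q₁ t ^ 2) := by gcongr
    _ = _ := by ring

/-- **Stationary phase estimate with Dirichlet characters (minor arc case).** -/
theorem stationary_phase_characters :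
    ∃ c C : ℝ, 0 < c ∧ c < 1 ∧ 0 < C ∧
    ∀ H X : ℝ, 1 ≤ H → H ≤ X →
    ∀ f : ℕ → ℂ, (∀ n : ℕ, f n ≠ 0 → X < (n : ℝ) ∧ (n : ℝ) ≤ 2 * X) →
    ∀ (q : ℕ) (a : ℤ), 1 ≤ q → Int.gcd a q = 1 →
    ∀ β η : ℝ, β ≠ 0 → 0 < η → η ≤ c → |β| ≤ c * η →
      (∫ θ in (β - 1 / H)..(β + 1 / H), ‖expSumR f ((a : ℝ) / (q : ℝ) + θ)‖ ^ 2)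
        ≤ C * (((q.divisors.card : ℝ) ^ 4 / (|β| ^ 2 * H ^ 2 * (q : ℝ))) *
              (⨆ (q₀ : ℕ) (q₁ : ℕ) (_ : q = q₀ * q₁),
                ∫ t in {t : ℝ | η * |β| * X ≤ |t| ∧ |t| ≤ |β| * X / η},
                  (∑ᶠ χ : DirichletCharacter ℂ q₁,
                    ∫ t' in (t - |β| * H)..(t + |β| * H),
                      ‖dirPolyChar f (1 / 2 + Complex.I * (t' : ℂ)) χ q₀‖) ^ 2)
            + ((η + 1 / (|β| * H)) ^ 2 / H ^ 2) *
              (∫ x : ℝ, (∑ n ∈ Finset.Icc ⌈x⌉₊ ⌊x + H⌋₊, ‖f n‖) ^ 2)) := by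
  obtain ⟨C, hC, hmain⟩ := exists_mean_square_expSum_le
  refine ⟨1 / 1000, C, by norm_num, by norm_num, hC, ?_⟩
  intro H X hH hHX f hf q a hq ha β η hβ hη hηc _
  have hX : 1 ≤ X := hH.trans hHX
  have hf0 : f 0 = 0 := by
    by_contra h
    have := (hf 0 h).1
    simp only [Nat.cast_zero] at this
    linarith
  have hK : ∀ n, f n ≠ 0 → n < ⌊2 * X⌋₊ + 1 := fun n h =>
    Nat.lt_succ_of_le (Nat.le_floor (hf n h).2)
  have hfin : {n | f n ≠ 0}.Finite := (Set.finite_Iio _).subset hK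
  have hN : ∀ n, n ∈ hfin.toFinset ↔ f n ≠ 0 := fun n => hfin.mem_toFinset
  have h := hmain H X β η hH hHX hβ hη hηc hfin.toFinset
    (fun n => f n * eR ((a : ℝ) / (q : ℝ) * n)) fun n hn => hf n ((hN n).1 hn)
  simp_rw [← expSumR_add_eq hN] at h
  have hfg : ∀ n, ‖f n * eR ((a : ℝ) / (q : ℝ) * n)‖ = ‖f n‖ := fun n => by
    rw [norm_mul, norm_eR, mul_one]
  simp_rw [shortMass_eq_sum_Icc hfg hf0 hN] at h
  refine h.trans ?_
  have hw : 0 ≤ |β| * H := by positivity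
  have h2 := setIntegral_window_sq_le hf0 hK hN hq ha hw
    (isCompact_annulus (η * |β| * X) (|β| * X / η))
  simp only [charWindowSum] at h2
  gcongr C * (?_ + _)
  refine (mul_le_mul_of_nonneg_left h2 (by positivity)).trans_eq ?_
  rw [← mul_assoc]
  congr 1
  rw [div_mul_div_comm, one_mul]
end

section
/- Pointwise bound for maximal exponential sums with phase log((m+ℓ)/(m−ℓ)) via the van der Corput exponent pair (1/14, 2/7) (key Type d₄ estimate): There exist an absolute constant ε₀ > 0 and an absolute constant C₀ such that for every 0 < ε ≤ ε₀ and every B > 0 there is a constant C = C(ε, B) with the following property. Let X ≥ 2, set H := X^{8/33+ε} and Q := (log X)^B, and let M₁ be a real number with X^{−ε²}H ≤ M₁ ≤ X^{1/4}. Let λ be a real number with X^{−1/6−2ε} ≤ λ ≤ 1. For real t', define Ỹ(t') := (H/M₁) ∑_{1 ≤ ℓ ≤ Q²M₁/H} |∑_{M₁ ≤ m ≤ 2M₁} e( (t'/(2π)) log((m+ℓ)/(m−ℓ)) )|*, where |·|* is the maximal sum over subintervals. Then for every real t' with Q^{−1/2}λX ≤ |t'| ≤ Q^{1/2}λX, one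 has Ỹ(t') ≤ C · X^{−ε + C₀ε²} · H. -/
open scoped BigOperators
open Real

/-- Maximal sum `|∑_{a ≤ n ≤ b} g(n)|* = sup_{a ≤ X₁ ≤ X₂ ≤ b} |∑_{X₁ ≤ n ≤ X₂} g(n)|`,
the inner sums ranging over the integers in the indicated ranges. -/
noncomputable def maxAbsSum (g : ℤ → ℂ) (a b : ℝ) : ℝ :=
  sSup {r : ℝ | ∃ c d : ℝ, a ≤ c ∧ c ≤ d ∧ d ≤ b ∧
    r = ‖∑ n ∈ Finset.Icc ⌈c⌉ ⌊d⌋, g n‖}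

/-- The quantity
`Ỹ(t') = (H/M₁) ∑_{1 ≤ ℓ ≤ Q²M₁/H} |∑_{M₁ ≤ m ≤ 2M₁} e((t'/2π) log((m+ℓ)/(m−ℓ)))|*`. -/
noncomputable def Ytil (H M₁ Q : ℝ) (t' : ℝ) : ℝ :=
  H / M₁ * ∑ ℓ ∈ Finset.Icc 1 ⌊Q ^ 2 * M₁ / H⌋₊,
    maxAbsSum (fun m => Complex.exp (2 * Real.pi * Complex.I *
        (t' / (2 * Real.pi) * Real.log (((m : ℝ) + (ℓ : ℝ)) / ((m : ℝ) - (ℓ : ℝ))))))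
      M₁ (2 * M₁)

/-- `e(x) = exp(2πix)`. -/
noncomputable def unitExp (x : ℝ) : ℂ := Complex.exp (2 * Real.pi * Complex.I * x)

lemma norm_unitExp (x : ℝ) : ‖unitExp x‖ = 1 := by
  rw [unitExp, Complex.norm_exp]
  simp

lemma unitExp_add (x y : ℝ) : unitExp (x + y) = unitExp x * unitExp y := by
  simp only [unitExp, ← Complex.exp_add]
  congr 1
  push_cast
  ring

lemma conj_unitExp (x : ℝ) : (starRingEnd ℂ) (unitExp x) = unitExp (-x) := by
  rw [unitExp, ← Complex.exp_conj, unitExp]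
  congr 1
  simp [map_ofNat]

lemma unitExp_int_add (k : ℤ) (x : ℝ) : unitExp (k + x) = unitExp x := by
  rw [unitExp_add]
  have : unitExp (k : ℝ) = 1 := by
    rw [unitExp, Complex.exp_eq_one_iff]
    exact ⟨k, by push_cast; ring⟩
  rw [this, one_mul]

lemma unitExp_sub_one_inv {x : ℝ} (hx : sin (π * x) ≠ 0) :
    (-(1 / 2) - Complex.I * ((cos (π * x) / (2 * sin (π * x)) : ℝ) : ℂ)) * (unitExp x - 1) = 1 := by
  have h : unitExp x = ((cos (π * x) : ℝ) + (sin (π * x) : ℝ) * Complex.I) ^ 2 := by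
    rw [unitExp]
    push_cast
    rw [← Complex.exp_mul_I, ← Complex.exp_nat_mul]
    congr 1
    push_cast
    ring
  have h1 : ((cos (π * x) : ℝ) : ℂ) ^ 2 + ((sin (π * x) : ℝ) : ℂ) ^ 2 = 1 := by
    exact_mod_cast cos_sq_add_sin_sq (π * x)
  have h2 : ((sin (π * x) : ℝ) : ℂ) ≠ 0 := by exact_mod_cast hx
  rw [h, Complex.ofReal_div, Complex.ofReal_mul]
  generalize ((cos (π * x) : ℝ) : ℂ) = c at *
  generalize ((sin (π * x) : ℝ) : ℂ) = s at *
  have hI := Complex.I_sq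
  have h3 : (c + s * Complex.I) ^ 2 - 1 = 2 * s * Complex.I * (c + s * Complex.I) := by
    linear_combination h1 - s ^ 2 * hI
  rw [h3]
  push_cast
  field_simp
  linear_combination (-c ^ 2 - s * c * Complex.I) * hI + h1 - s ^ 2 * hI

lemma two_mul_le_sin_pi_mul {x δ : ℝ} (hδ : 0 < δ) (h1 : δ ≤ x) (h2 : x ≤ 1 - δ) :
    2 * δ ≤ sin (π * x) := by
  have hp := pi_pos
  rcases le_total x (1 / 2) with h | h
  · have := mul_le_sin (x := π * x) (by nlinarith) (by nlinarith)
    have e : 2 / π * (π * x) = 2 * x := by field_simp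
    linarith
  · have := mul_le_sin (x := π * (1 - x)) (by nlinarith) (by nlinarith)
    have e : 2 / π * (π * (1 - x)) = 2 * (1 - x) := by field_simp
    rw [show π * (1 - x) = π - π * x by ring, sin_pi_sub] at this
    rw [show π - π * x = π * (1 - x) by ring] at this
    linarith

lemma cot_antitone_aux {x y : ℝ} (h0 : 0 < x) (hxy : x ≤ y) (h1 : y < 1) :
    cos (π * y) / (2 * sin (π * y)) ≤ cos (π * x) / (2 * sin (π * x)) := by
  have hp := pi_pos
  have sx : 0 < sin (π * x) := sin_pos_of_pos_of_lt_pi (by positivity) (by nlinarith)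
  have sy : 0 < sin (π * y) := sin_pos_of_pos_of_lt_pi (by nlinarith) (by nlinarith)
  rw [div_le_div_iff₀ (by positivity) (by positivity)]
  have : 0 ≤ sin (π * y - π * x) := sin_nonneg_of_nonneg_of_le_pi (by nlinarith) (by nlinarith)
  rw [sin_sub] at this
  nlinarith

lemma abs_half_cot_le {x δ : ℝ} (hδ : 0 < δ) (h1 : δ ≤ x) (h2 : x ≤ 1 - δ) :
    |cos (π * x) / (2 * sin (π * x))| ≤ 1 / (4 * δ) := by
  have hs := two_mul_le_sin_pi_mul hδ h1 h2
  rw [abs_div, abs_of_pos (show 0 < 2 * sin (π * x) by linarith)]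
  exact div_le_div₀ zero_le_one (abs_cos_le_one _) (by positivity) (by linarith)

/-- The Kusmin–Landau inequality. -/
lemma norm_sum_unitExp_le_of_monotone_diff {f : ℕ → ℝ} {k : ℤ} {δ : ℝ} (hδ : 0 < δ) (N : ℕ)
    (hlow : ∀ n < N, k + δ ≤ f (n + 1) - f n) (hupp : ∀ n < N, f (n + 1) - f n ≤ k + 1 - δ)
    (hmono : ∀ n, n + 1 < N → f (n + 1) - f n ≤ f (n + 2) - f (n + 1)) :
    ‖∑ n ∈ Finset.range N, unitExp (f n)‖ ≤ 2 / δ := by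
  rcases N with _ | N
  · simp; positivity
  set c : ℕ → ℝ := fun n =>
    cos (π * (f (n + 1) - f n - k)) / (2 * sin (π * (f (n + 1) - f n - k))) with hc
  set g : ℕ → ℂ := fun n => -(1 / 2) - Complex.I * (c n : ℂ) with hg
  have hz : ∀ n < N + 1, unitExp (f n) = g n * (unitExp (f (n + 1)) - unitExp (f n)) := by
    intro n hn
    have hs := two_mul_le_sin_pi_mul hδ (x := f (n + 1) - f n - k)
      (by linarith [hlow n hn]) (by linarith [hupp n hn])
    have h1 := unitExp_sub_one_inv (x := f (n + 1) - f n - k) (by linarith)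
    have h2 : unitExp (f (n + 1)) = unitExp (f (n + 1) - f n - k) * unitExp (f n) := by
      rw [← unitExp_add, ← unitExp_int_add k (f (n + 1) - f n - k + f n)]
      congr 1
      ring
    rw [h2]
    linear_combination -unitExp (f n) * h1
  have hcb : ∀ n < N + 1, |c n| ≤ 1 / (4 * δ) := fun n hn =>
    abs_half_cot_le hδ (by linarith [hlow n hn]) (by linarith [hupp n hn])
  have hgb : ∀ n < N + 1, ‖g n‖ ≤ 1 / 2 + 1 / (4 * δ) := by
    intro n hn
    refine (norm_sub_le _ _).trans ?_
    rw [norm_mul, Complex.norm_I, one_mul, Complex.norm_real, norm_neg]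
    have := hcb n hn
    rw [Real.norm_eq_abs]
    norm_num at this ⊢
    exact this
  have key : ∀ m < N + 1, ‖∑ n ∈ Finset.range (m + 1), unitExp (f n)
      - g m * unitExp (f (m + 1)) + g 0 * unitExp (f 0)‖ ≤ c 0 - c m := by
    intro m
    induction m with
    | zero =>
      intro h
      rw [sub_self, norm_le_zero_iff, zero_add, Finset.sum_range_one]
      linear_combination hz 0 h
    | succ m ih =>
      intro h
      have ih := ih (by omega)
      have hcm : c (m + 1) ≤ c m := cot_antitone_aux (by linarith [hlow m (by omega)])
        (by linarith [hmono m h]) (by linarith [hupp (m + 1) h])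
      rw [Finset.sum_range_succ]
      have e : ∑ n ∈ Finset.range (m + 1), unitExp (f n) + unitExp (f (m + 1))
          - g (m + 1) * unitExp (f (m + 1 + 1)) + g 0 * unitExp (f 0)
          = (∑ n ∈ Finset.range (m + 1), unitExp (f n)
            - g m * unitExp (f (m + 1)) + g 0 * unitExp (f 0))
            + (g m - g (m + 1)) * unitExp (f (m + 1)) := by
        linear_combination hz (m + 1) h
      rw [e]
      refine (norm_add_le _ _).trans ?_
      rw [norm_mul, norm_unitExp, mul_one]
      have : g m - g (m + 1) = -Complex.I * ((c m - c (m + 1) : ℝ) : ℂ) := by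
        simp only [hg]; push_cast; ring
      rw [this, norm_mul, norm_neg, Complex.norm_I, one_mul, Complex.norm_real,
        Real.norm_of_nonneg (by linarith)]
      linarith
  have hk := key N (by omega)
  have e : ∑ n ∈ Finset.range (N + 1), unitExp (f n) = (∑ n ∈ Finset.range (N + 1), unitExp (f n)
      - g N * unitExp (f (N + 1)) + g 0 * unitExp (f 0))
      + (g N * unitExp (f (N + 1)) - g 0 * unitExp (f 0)) := by ring
  have h0 := hgb 0 (by omega)
  have h1 := hgb N (by omega)
  have h2 := abs_le.1 (hcb 0 (by omega))
  have h3 := abs_le.1 (hcb N (by omega))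
  have hδ1 : 1 ≤ 1 / δ := by
    rw [le_div_iff₀ hδ]
    linarith [hlow 0 (by omega), hupp 0 (by omega)]
  have h4 : 1 / (4 * δ) = 1 / δ / 4 := by field_simp
  have h5 : ‖g N * unitExp (f (N + 1)) - g 0 * unitExp (f 0)‖ ≤ ‖g N‖ + ‖g 0‖ := by
    refine (norm_sub_le _ _).trans ?_
    simp [norm_unitExp]
  rw [e]
  refine (norm_add_le _ _).trans ?_
  rw [show 2 / δ = 2 * (1 / δ) by ring]
  linarith

/-- The discrete second derivative test. -/
lemma norm_sum_unitExp_le_of_second_diff {f : ℕ → ℝ} {lo up δ : ℝ} (hlo : 0 < lo) (hδ : 0 < δ)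
    (N : ℕ) (hl : ∀ n < N, lo ≤ f (n + 2) - 2 * f (n + 1) + f n)
    (hu : ∀ n < N, f (n + 2) - 2 * f (n + 1) + f n ≤ up) :
    ‖∑ n ∈ Finset.range N, unitExp (f n)‖ ≤ (up * N + 2) * (2 * (δ / lo + 1) + 2 / δ) := by
  rcases Nat.eq_zero_or_pos N with rfl | hN
  · simp; positivity
  have hup : 0 < up := hlo.trans_le ((hl 0 hN).trans (hu 0 hN))
  set d : ℕ → ℝ := fun n => f (n + 1) - f n with hd
  have hdl : ∀ n j, n + j ≤ N → lo * j ≤ d (n + j) - d n := by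
    intro n j
    induction j with
    | zero => simp
    | succ j ih =>
      intro h
      have h1 := ih (by omega)
      have h2 := hl (n + j) (by omega)
      simp only [hd, ← add_assoc] at h1 h2 ⊢
      push_cast
      linarith
  have hdu : ∀ n j, n + j ≤ N → d (n + j) - d n ≤ up * j := by
    intro n j
    induction j with
    | zero => simp
    | succ j ih =>
      intro h
      have h1 := ih (by omega)
      have h2 := hu (n + j) (by omega)
      simp only [hd, ← add_assoc] at h1 h2 ⊢
      push_cast
      linarith
  have hmono : ∀ m n, m ≤ n → n ≤ N → d m ≤ d n := by
    intro m n hmn hn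
    obtain ⟨j, rfl⟩ := Nat.exists_eq_add_of_le hmn
    have := hdl m j hn
    have : 0 ≤ lo * j := by positivity
    linarith
  -- a set on which `d` varies by at most `δ` has few elements
  have hcard : ∀ (S : Finset ℕ) (x : ℝ), S ⊆ Finset.range N →
      (∀ n ∈ S, x ≤ d n ∧ d n ≤ x + δ) → (S.card : ℝ) ≤ δ / lo + 1 := by
    intro S x hS hx
    rcases S.eq_empty_or_nonempty with rfl | hne
    · simp; positivity
    have hsub : S ⊆ Finset.Icc (S.min' hne) (S.max' hne) := fun n hn =>
      Finset.mem_Icc.2 ⟨S.min'_le n hn, S.le_max' n hn⟩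
    have hc := Finset.card_le_card hsub
    rw [Nat.card_Icc] at hc
    obtain ⟨j, hj⟩ := Nat.exists_eq_add_of_le (S.min'_le_max' hne)
    have h1 := hx _ (S.min'_mem hne)
    have h2 := hx _ (S.max'_mem hne)
    have h3 := Finset.mem_range.1 (hS (S.max'_mem hne))
    have h4 := hdl (S.min' hne) j (by omega)
    rw [← hj] at h4
    have h5 : (j : ℝ) ≤ δ / lo := by
      rw [le_div_iff₀ hlo]; linarith
    have h6 : (S.card : ℝ) ≤ j + 1 := by
      have : S.card ≤ j + 1 := by omega
      exact_mod_cast this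
    linarith
  have hnorm : ∀ S : Finset ℕ, ‖∑ n ∈ S, unitExp (f n)‖ ≤ S.card := by
    intro S
    refine (norm_sum_le _ _).trans ?_
    simp [norm_unitExp]
  -- the contribution of the `n` with `⌊d n⌋ = k`
  have hfib : ∀ k : ℤ, ‖∑ n ∈ (Finset.range N).filter (fun n => ⌊d n⌋ = k), unitExp (f n)‖
      ≤ 2 * (δ / lo + 1) + 2 / δ := by
    intro k
    set F := (Finset.range N).filter (fun n => ⌊d n⌋ = k) with hF
    have hFm : ∀ n ∈ F, n < N ∧ (k : ℝ) ≤ d n ∧ d n < k + 1 := by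
      intro n hn
      rw [hF, Finset.mem_filter, Finset.mem_range, Int.floor_eq_iff] at hn
      exact hn
    rw [← Finset.sum_filter_add_sum_filter_not F (fun n => d n < k + δ),
      ← Finset.sum_filter_add_sum_filter_not (F.filter (fun n => ¬ d n < k + δ))
        (fun n => d n ≤ k + 1 - δ)]
    have hA : ‖∑ n ∈ F.filter (fun n => d n < k + δ), unitExp (f n)‖ ≤ δ / lo + 1 := by
      refine (hnorm _).trans (hcard _ k ?_ ?_)
      · exact (Finset.filter_subset _ _).trans (Finset.filter_subset _ _)
      · intro n hn
        rw [Finset.mem_filter] at hn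
        exact ⟨(hFm n hn.1).2.1, hn.2.le⟩
    have hC : ‖∑ n ∈ (F.filter (fun n => ¬ d n < k + δ)).filter (fun n => ¬ d n ≤ k + 1 - δ),
        unitExp (f n)‖ ≤ δ / lo + 1 := by
      refine (hnorm _).trans (hcard _ (k + 1 - δ) ?_ ?_)
      · exact (Finset.filter_subset _ _).trans
          ((Finset.filter_subset _ _).trans (Finset.filter_subset _ _))
      · intro n hn
        rw [Finset.mem_filter, Finset.mem_filter] at hn
        have := hFm n hn.1.1
        constructor <;> linarith [hn.2]
    have hB : ‖∑ n ∈ (F.filter (fun n => ¬ d n < k + δ)).filter (fun n => d n ≤ k + 1 - δ),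
        unitExp (f n)‖ ≤ 2 / δ := by
      set S := (F.filter (fun n => ¬ d n < k + δ)).filter (fun n => d n ≤ k + 1 - δ) with hS
      have hSm : ∀ n, n ∈ S ↔ n < N ∧ k + δ ≤ d n ∧ d n ≤ k + 1 - δ := by
        intro n
        simp only [hS, hF, Finset.mem_filter, Finset.mem_range, Int.floor_eq_iff, not_lt]
        constructor
        · tauto
        · rintro ⟨h1, h2, h3⟩
          exact ⟨⟨⟨h1, by linarith, by linarith⟩, h2⟩, h3⟩
      rcases S.eq_empty_or_nonempty with h | hne
      · rw [h]; simp; positivity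
      have hmin := (hSm _).1 (S.min'_mem hne)
      have hmax := (hSm _).1 (S.max'_mem hne)
      obtain ⟨p, q, hSe⟩ : ∃ p q, S = Finset.Ico p q := by
        refine ⟨S.min' hne, S.max' hne + 1, ?_⟩
        ext n
        rw [Finset.mem_Ico]
        constructor
        · exact fun hn => ⟨S.min'_le n hn, Nat.lt_succ_of_le (S.le_max' n hn)⟩
        · rintro ⟨h1, h2⟩
          have h3 := hmono _ _ h1 (by omega)
          have h4 := hmono n (S.max' hne) (by omega) (by omega)
          exact (hSm n).2 ⟨by omega, by linarith, by linarith⟩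
      have hmem : ∀ n < q - p, p + n ∈ S := by
        intro n hn
        rw [hSe, Finset.mem_Ico]
        omega
      rw [hSe, Finset.sum_Ico_eq_sum_range]
      refine norm_sum_unitExp_le_of_monotone_diff (f := fun n => f (p + n)) (k := k) hδ _
        (fun n hn => ((hSm _).1 (hmem n hn)).2.1) (fun n hn => ((hSm _).1 (hmem n hn)).2.2)
        (fun n hn => ?_)
      have := ((hSm _).1 (hmem (n + 1) hn)).1
      exact hmono (p + n) (p + (n + 1)) (by omega) (by omega)
    refine (norm_add_le _ _).trans ?_
    have := norm_add_le
      (∑ n ∈ (F.filter (fun n => ¬ d n < k + δ)).filter (fun n => d n ≤ k + 1 - δ), unitExp (f n))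
      (∑ n ∈ (F.filter (fun n => ¬ d n < k + δ)).filter (fun n => ¬ d n ≤ k + 1 - δ),
        unitExp (f n))
    linarith
  have hmaps : ∀ n ∈ Finset.range N, ⌊d n⌋ ∈ Finset.Icc ⌊d 0⌋ ⌊d N⌋ := by
    intro n hn
    rw [Finset.mem_range] at hn
    exact Finset.mem_Icc.2 ⟨Int.floor_le_floor (hmono 0 n (by omega) hn.le),
      Int.floor_le_floor (hmono n N hn.le le_rfl)⟩
  rw [← Finset.sum_fiberwise_of_maps_to hmaps]
  refine (norm_sum_le_of_le _ (fun k _ => hfib k)).trans ?_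
  rw [Finset.sum_const, nsmul_eq_mul, Int.card_Icc]
  refine mul_le_mul_of_nonneg_right ?_ (by positivity)
  have h1 : ⌊d 0⌋ ≤ ⌊d N⌋ := Int.floor_le_floor (hmono 0 N (by omega) le_rfl)
  have h2 : (((⌊d N⌋ + 1 - ⌊d 0⌋).toNat : ℤ) : ℝ) = ⌊d N⌋ + 1 - ⌊d 0⌋ := by
    rw [Int.toNat_of_nonneg (by omega)]
    push_cast
    ring
  rw [Int.cast_natCast] at h2
  rw [h2]
  have h3 := hdu 0 N (by omega)
  rw [zero_add] at h3
  linarith [Int.floor_le (d N), Int.lt_floor_add_one (d 0)]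

/-- Van der Corput's inequality (Weyl differencing). -/
lemma norm_sum_sq_le_of_correlation {u : ℕ → ℂ} (hu : ∀ n, ‖u n‖ ≤ 1) (N : ℕ) {K : ℕ}
    (hK : 0 < K) {E : ℝ} (hE : 0 ≤ E)
    (hcor : ∀ h, 1 ≤ h → h < K →
      ‖∑ n ∈ Finset.range (N - h), u (n + h) * (starRingEnd ℂ) (u n)‖ ≤ E) :
    ‖∑ n ∈ Finset.range N, u n‖ ^ 2 ≤ (N + K) * (N / K + E) := by
  set v : ℕ → ℕ → ℂ := fun m h => if h ≤ m ∧ m < N + h then u (m - h) else 0 with hv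
  set S := ∑ n ∈ Finset.range N, u n with hS
  have hKR : (0 : ℝ) < K := by exact_mod_cast hK
  have hsum : ∀ h < K, ∑ m ∈ Finset.range (N + K), v m h = S := by
    intro h hh
    rw [hS, ← Finset.sum_filter]
    refine Finset.sum_nbij' (fun m => m - h) (fun n => n + h) ?_ ?_ ?_ ?_ ?_ <;>
      simp only [Finset.mem_filter, Finset.mem_range] <;> intros <;> first | omega | trivial
  have hpair : ∀ h k, h < k → k < K →
      ‖∑ m ∈ Finset.range (N + K), v m h * (starRingEnd ℂ) (v m k)‖ ≤ E := by
    intro h k hhk hk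
    have e : ∑ m ∈ Finset.range (N + K), v m h * (starRingEnd ℂ) (v m k)
        = ∑ n ∈ Finset.range (N - (k - h)), u (n + (k - h)) * (starRingEnd ℂ) (u n) := by
      have e1 : ∀ m, v m h * (starRingEnd ℂ) (v m k)
          = if k ≤ m ∧ m < N + h then u (m - h) * (starRingEnd ℂ) (u (m - k)) else 0 := by
        intro m
        simp only [hv]
        split_ifs <;> first | omega | simp
      simp only [e1]
      rw [← Finset.sum_filter]
      refine Finset.sum_nbij' (fun m => m - k) (fun n => n + k) ?_ ?_ ?_ ?_ ?_ <;>
        simp only [Finset.mem_filter, Finset.mem_range]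
      · intros; omega
      · intros; omega
      · intros; omega
      · intros; omega
      · intro m hm
        rw [show m - k + (k - h) = m - h by omega]
    rw [e]
    exact hcor _ (by omega) (by omega)
  have hdiag : ∀ h < K, ‖∑ m ∈ Finset.range (N + K), v m h * (starRingEnd ℂ) (v m h)‖ ≤ N := by
    intro h hh
    have e1 : ∀ m, v m h * (starRingEnd ℂ) (v m h)
        = if h ≤ m ∧ m < N + h then u (m - h) * (starRingEnd ℂ) (u (m - h)) else 0 := by
      intro m
      simp only [hv]
      split_ifs <;> simp
    simp only [e1]
    rw [← Finset.sum_filter]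
    have e2 : ((Finset.range (N + K)).filter (fun m => h ≤ m ∧ m < N + h)) =
        Finset.Ico h (N + h) := by
      ext m
      simp only [Finset.mem_filter, Finset.mem_range, Finset.mem_Ico]
      omega
    rw [e2]
    refine (norm_sum_le_of_le _ (f := fun m => u (m - h) * (starRingEnd ℂ) (u (m - h)))
      (n := fun _ => (1 : ℝ)) (fun m _ => ?_)).trans ?_
    · rw [norm_mul, RCLike.norm_conj]
      exact mul_le_one₀ (hu _) (norm_nonneg _) (hu _)
    · simp
  have hall : ∀ h < K, ∀ k < K, ‖∑ m ∈ Finset.range (N + K), v m h * (starRingEnd ℂ) (v m k)‖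
      ≤ (if h = k then (N : ℝ) else 0) + E := by
    intro h hh k hk
    rcases lt_trichotomy h k with hlt | rfl | hlt
    · rw [if_neg hlt.ne, zero_add]
      exact hpair h k hlt hk
    · rw [if_pos rfl]
      linarith [hdiag h hh]
    · rw [if_neg hlt.ne', zero_add, ← RCLike.norm_conj, map_sum]
      simp only [map_mul, RCLike.conj_conj]
      simp only [mul_comm ((starRingEnd ℂ) _)]
      exact hpair k h hlt hh
  have hKS : (K : ℂ) * S = ∑ m ∈ Finset.range (N + K), ∑ h ∈ Finset.range K, v m h := by
    rw [Finset.sum_comm, Finset.sum_congr rfl (fun h hh => hsum h (Finset.mem_range.1 hh))]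
    simp
  have hcs : (K * ‖S‖) ^ 2 ≤ (N + K) *
      ∑ m ∈ Finset.range (N + K), ‖∑ h ∈ Finset.range K, v m h‖ ^ 2 := by
    have h1 : K * ‖S‖ ≤ ∑ m ∈ Finset.range (N + K), ‖∑ h ∈ Finset.range K, v m h‖ := by
      have : K * ‖S‖ = ‖(K : ℂ) * S‖ := by simp
      rw [this, hKS]
      exact norm_sum_le _ _
    refine (pow_le_pow_left₀ (by positivity) h1 2).trans ?_
    refine sq_sum_le_card_mul_sum_sq.trans ?_
    simp
  have hexp : ∑ m ∈ Finset.range (N + K), ‖∑ h ∈ Finset.range K, v m h‖ ^ 2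
      ≤ K * N + K ^ 2 * E := by
    have e : ((∑ m ∈ Finset.range (N + K), ‖∑ h ∈ Finset.range K, v m h‖ ^ 2 : ℝ) : ℂ)
        = ∑ h ∈ Finset.range K, ∑ k ∈ Finset.range K,
          ∑ m ∈ Finset.range (N + K), v m h * (starRingEnd ℂ) (v m k) := by
      push_cast
      have : ∀ m, (‖∑ h ∈ Finset.range K, v m h‖ : ℂ) ^ 2
          = ∑ h ∈ Finset.range K, ∑ k ∈ Finset.range K, v m h * (starRingEnd ℂ) (v m k) := by
        intro m
        rw [← Complex.mul_conj', map_sum, Finset.sum_mul_sum]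
      simp only [this]
      rw [Finset.sum_comm]
      exact Finset.sum_congr rfl fun _ _ => Finset.sum_comm
    have h1 : ∑ m ∈ Finset.range (N + K), ‖∑ h ∈ Finset.range K, v m h‖ ^ 2
        = ‖∑ h ∈ Finset.range K, ∑ k ∈ Finset.range K,
          ∑ m ∈ Finset.range (N + K), v m h * (starRingEnd ℂ) (v m k)‖ := by
      rw [← e, Complex.norm_real, Real.norm_of_nonneg]
      exact Finset.sum_nonneg fun _ _ => by positivity
    rw [h1]
    refine (norm_sum_le_of_le _ fun h hh => norm_sum_le_of_le _ fun k hk =>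
      hall h (Finset.mem_range.1 hh) k (Finset.mem_range.1 hk)).trans (le_of_eq ?_)
    simp only [Finset.sum_add_distrib, Finset.sum_ite_eq, Finset.sum_const, Finset.card_range,
      nsmul_eq_mul]
    rw [Finset.sum_congr rfl (fun h hh => if_pos hh)]
    simp
    ring
  have hfin : (K * ‖S‖) ^ 2 ≤ (N + K) * (K * N + K ^ 2 * E) :=
    hcs.trans (mul_le_mul_of_nonneg_left hexp (by positivity))
  have e : (K * ‖S‖) ^ 2 = K ^ 2 * ‖S‖ ^ 2 := by ring
  have e2 : ((N : ℝ) + K) * (K * N + K ^ 2 * E) = K ^ 2 * ((N + K) * (N / K + E)) := by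
    field_simp
  rw [e, e2] at hfin
  exact le_of_mul_le_mul_left hfin (by positivity)

lemma norm_sum_unitExp_sq_le_of_fourth_diff {f : ℕ → ℝ} {N K₁ K₂ : ℕ} (hK₁ : 0 < K₁)
    (hK₂ : 0 < K₂) {lo up δ E₁ E₂ : ℝ} (hlo : 0 < lo) (hup : 0 ≤ up) (hδ : 0 < δ)
    (hf : ∀ h₁ h₂ n : ℕ, 1 ≤ h₁ → h₁ < K₁ → 1 ≤ h₂ → h₂ < K₂ → n + h₁ + h₂ < N →
      ∀ g : ℕ → ℝ, (∀ j, g j = (f (j + h₂ + h₁) - f (j + h₂)) - (f (j + h₁) - f j)) →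
      lo ≤ g (n + 2) - 2 * g (n + 1) + g n ∧ g (n + 2) - 2 * g (n + 1) + g n ≤ up)
    (hE₂ : (up * N + 2) * (2 * (δ / lo + 1) + 2 / δ) ≤ E₂) (hE₁ : 0 ≤ E₁)
    (hE₁₂ : (N + K₂) * (N / K₂ + E₂) ≤ E₁ ^ 2) :
    ‖∑ n ∈ Finset.range N, unitExp (f n)‖ ^ 2 ≤ (N + K₁) * (N / K₁ + E₁) := by
  have hE₂0 : 0 ≤ E₂ := le_trans (by positivity) hE₂
  have hmul : ∀ x y : ℝ, unitExp x * (starRingEnd ℂ) (unitExp y) = unitExp (x - y) := by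
    intro x y
    rw [conj_unitExp, ← unitExp_add, sub_eq_add_neg]
  refine norm_sum_sq_le_of_correlation (fun n => (norm_unitExp _).le) N hK₁ hE₁ ?_
  intro h₁ h1 h1K
  simp only [hmul]
  refine (pow_le_pow_iff_left₀ (norm_nonneg _) hE₁ two_ne_zero).1 ?_
  refine (norm_sum_sq_le_of_correlation (u := fun n => unitExp (f (n + h₁) - f n))
    (fun n => (norm_unitExp _).le) (N - h₁) hK₂ hE₂0 ?_).trans (le_trans ?_ hE₁₂)
  · intro h₂ h2 h2K
    simp only [hmul]
    refine (norm_sum_unitExp_le_of_second_diff (lo := lo) (up := up) hlo hδ _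
      (fun n hn => ?_) (fun n hn => ?_)).trans (le_trans ?_ hE₂)
    · exact (hf h₁ h₂ n h1 h1K h2 h2K (by omega)
        (fun j => f (j + h₂ + h₁) - f (j + h₂) - (f (j + h₁) - f j)) fun j => rfl).1
    · exact (hf h₁ h₂ n h1 h1K h2 h2K (by omega)
        (fun j => f (j + h₂ + h₁) - f (j + h₂) - (f (j + h₁) - f j)) fun j => rfl).2
    · gcongr
      omega
  · gcongr <;> omega

/-- Iterated forward differences with steps taken from a list. -/
def iterDiff : List ℝ → (ℝ → ℝ) → ℝ → ℝ
  | [], F, x => F x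
  | h :: t, F, x => iterDiff t (fun y => F (y + h) - F y) x

lemma iterDiff_mem_Icc {a c C : ℝ} (hs : List ℝ) (hpos : ∀ h ∈ hs, 0 < h) :
    ∀ (b : ℝ) (G : ℕ → ℝ → ℝ),
      (∀ i, ∀ x ∈ Set.Icc a b, HasDerivAt (G i) (G (i + 1) x) x) →
      (∀ x ∈ Set.Icc a b, G hs.length x ∈ Set.Icc c C) →
      ∀ x, a ≤ x → x + hs.sum ≤ b → iterDiff hs (G 0) x ∈ Set.Icc (c * hs.prod) (C * hs.prod) := by
  induction hs generalizing c C with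
  | nil =>
    intro b G _ h x hx hxb
    simpa [iterDiff] using h x ⟨hx, by simpa using hxb⟩
  | cons h t ih =>
    intro b G hG hb x hx hxb
    have hh : 0 < h := hpos h (by simp)
    rw [List.sum_cons] at hxb
    have := ih (c := c * h) (C := C * h) (fun h' hh' => hpos h' (by simp [hh'])) (b - h)
      (fun i y => G i (y + h) - G i y) ?_ ?_ x hx (by linarith)
    · rw [List.prod_cons, ← mul_assoc, ← mul_assoc]
      exact this
    · intro i y hy
      exact ((hG i (y + h) ⟨by linarith [hy.1], by linarith [hy.2]⟩).comp_add_const y h).sub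
        (hG i y ⟨hy.1, by linarith [hy.2]⟩)
    · intro y hy
      have hI : ∀ z ∈ Set.Icc y (y + h), z ∈ Set.Icc a b := fun z hz =>
        ⟨hy.1.trans hz.1, by linarith [hz.2, hy.2]⟩
      obtain ⟨z, hz, he⟩ := exists_hasDerivAt_eq_slope (G t.length) (G (t.length + 1))
        (show y < y + h by linarith)
        (fun z hz => (hG _ z (hI z hz)).continuousAt.continuousWithinAt)
        (fun z hz => hG _ z (hI z (Set.Ioo_subset_Icc_self hz)))
      have hz' := hb z (hI z (Set.Ioo_subset_Icc_self hz))
      rw [List.length_cons, he, add_sub_cancel_left, Set.mem_Icc, le_div_iff₀ hh,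
        div_le_iff₀ hh] at hz'
      exact hz'

/-- The iterated derivatives of `log`. -/
noncomputable def iteratedLogDeriv : ℕ → ℝ → ℝ
  | 0 => log
  | i + 1 => fun x => (-1) ^ i * i.factorial * (x ^ (i + 1))⁻¹

lemma hasDerivAt_iteratedLogDeriv (i : ℕ) {x : ℝ} (hx : 0 < x) :
    HasDerivAt (iteratedLogDeriv i) (iteratedLogDeriv (i + 1) x) x := by
  rcases i with _ | i
  · simpa [iteratedLogDeriv] using hasDerivAt_log hx.ne'
  · have := ((hasDerivAt_pow (i + 1) x).inv (by positivity)).const_mul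
      ((-1 : ℝ) ^ i * i.factorial)
    refine this.congr_deriv ?_
    simp only [iteratedLogDeriv, Nat.factorial_succ, Nat.add_sub_cancel]
    push_cast
    field_simp
    ring

lemma iterDiff_log_mem_Icc {a b : ℝ} (ha : 0 < a) (hs : List ℝ) (hpos : ∀ h ∈ hs, 0 < h)
    (hlen : hs.length = 5) {x : ℝ} (hx : a ≤ x) (hxb : x + hs.sum ≤ b) :
    iterDiff hs log x ∈ Set.Icc (24 / b ^ 5 * hs.prod) (24 / a ^ 5 * hs.prod) := by
  refine iterDiff_mem_Icc (a := a) hs hpos b iteratedLogDeriv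
    (fun i x hx => hasDerivAt_iteratedLogDeriv i (ha.trans_le hx.1)) ?_ x hx hxb
  intro y hy
  have hy0 : 0 < y := ha.trans_le hy.1
  have e : iteratedLogDeriv hs.length y = 24 / y ^ 5 := by
    rw [hlen]
    norm_num [iteratedLogDeriv, Nat.factorial, div_eq_mul_inv]
  rw [e]
  have h1 := hy.1
  have h2 := hy.2
  constructor <;> gcongr

lemma second_diff_log_ratio {T M : ℝ} (hT : 0 < T) (hM : 4 ≤ M) {l : ℕ} (hl : 1 ≤ l)
    (hlM : (l : ℝ) ≤ M / 2) {m₀ : ℤ} (hm₀ : M ≤ m₀) {N : ℕ} (hN : (m₀ : ℝ) + N ≤ 2 * M + 1)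
    {f : ℕ → ℝ} (hf : ∀ n : ℕ, f n = T / (2 * π) *
      log ((((m₀ + n : ℤ) : ℝ) + l) / (((m₀ + n : ℤ) : ℝ) - l)))
    {h₁ h₂ n : ℕ} (h1 : 1 ≤ h₁) (h2 : 1 ≤ h₂) (hn : n + h₁ + h₂ < N) {g : ℕ → ℝ}
    (hg : ∀ j, g j = (f (j + h₂ + h₁) - f (j + h₂)) - (f (j + h₁) - f j)) :
    g (n + 2) - 2 * g (n + 1) + g n ∈ Set.Icc
      (T / (2 * π) * (48 * l / (3 * M) ^ 5) * (h₁ * h₂))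
      (7776 * (T / (2 * π) * (48 * l / (3 * M) ^ 5)) * (h₁ * h₂)) := by
  have hpi := pi_pos
  have hl0 : (1 : ℝ) ≤ l := by exact_mod_cast hl
  have h10 : (1 : ℝ) ≤ h₁ := by exact_mod_cast h1
  have h20 : (1 : ℝ) ≤ h₂ := by exact_mod_cast h2
  have hn' : (n : ℝ) + h₁ + h₂ + 1 ≤ N := by exact_mod_cast hn
  have hn0 : (0 : ℝ) ≤ n := by positivity
  have hL := iterDiff_log_mem_Icc (a := M / 2) (b := 3 * M) (by linarith)
    [2 * (l : ℝ), h₁, h₂, 1, 1] (by simp; refine ⟨?_, ?_, ?_⟩ <;> omega) rfl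
    (x := m₀ + n - l) (by linarith) (by simp; linarith)
  set F : ℝ → ℝ := fun y => log (y + 2 * l) - log y with hF
  have hfF : ∀ j : ℕ, f j = T / (2 * π) * F (m₀ - l + j) := by
    intro j
    have hj : (0 : ℝ) ≤ j := by positivity
    rw [hf, hF, log_div]
    · push_cast
      ring_nf
    · push_cast; linarith
    · push_cast; linarith
  have e : g (n + 2) - 2 * g (n + 1) + g n
      = T / (2 * π) * iterDiff [2 * (l : ℝ), h₁, h₂, 1, 1] log (m₀ + n - l) := by
    simp only [hg, hfF, iterDiff, hF]
    push_cast
    ring_nf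
  rw [e]
  have hc : 0 < T / (2 * π) := by positivity
  simp only [List.prod_cons, List.prod_nil, mul_one] at hL
  have hM0 : M ≠ 0 := by linarith
  constructor
  · refine le_trans (le_of_eq ?_) (mul_le_mul_of_nonneg_left hL.1 hc.le)
    ring
  · refine (mul_le_mul_of_nonneg_left hL.2 hc.le).trans (le_of_eq ?_)
    field_simp
    norm_num

lemma norm_sum_unitExp_log_ratio_le {T M Y : ℝ} (hT : 0 < T) (hM : 4 ≤ M) (hY : 1 ≤ Y)
    (hMY : M ≤ Y ^ 132) {l : ℕ} (hl : 1 ≤ l) (hlM : (l : ℝ) ≤ M / 2)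
    (hup : T / (2 * π) * (48 * l / (3 * M) ^ 5) * Y ^ 100 ≤ 1)
    (hlow : 1 ≤ T / (2 * π) * (48 * l / (3 * M) ^ 5) * Y ^ 224)
    {m₀ : ℤ} (hm₀ : M ≤ m₀) {N : ℕ} (hN : (m₀ : ℝ) + N ≤ 2 * M + 1) :
    ‖∑ n ∈ Finset.range N, unitExp (T / (2 * π) *
      log ((((m₀ + n : ℤ) : ℝ) + l) / (((m₀ + n : ℤ) : ℝ) - l)))‖ ≤ 70 * Y ^ 127 := by
  have hpi := pi_pos
  have hl0 : (1 : ℝ) ≤ l := by exact_mod_cast hl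
  set κ := T / (2 * π) * (48 * l / (3 * M) ^ 5) with hκ
  have hκ0 : 0 < κ := by positivity
  set r := √κ with hr
  have hr0 : 0 < r := sqrt_pos.2 hκ0
  have hr2 : r ^ 2 = κ := sq_sqrt hκ0.le
  have hrup : r * Y ^ 50 ≤ 1 := by
    refine (pow_le_pow_iff_left₀ (by positivity) zero_le_one two_ne_zero).1 ?_
    calc (r * Y ^ 50) ^ 2 = r ^ 2 * Y ^ 100 := by ring
      _ ≤ 1 ^ 2 := by rw [hr2]; simpa using hup
  have hrlow : 1 ≤ r * Y ^ 112 := by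
    refine (pow_le_pow_iff_left₀ zero_le_one (by positivity) two_ne_zero).1 ?_
    calc (1 : ℝ) ^ 2 ≤ r ^ 2 * Y ^ 224 := by rw [hr2]; simpa using hlow
      _ = (r * Y ^ 112) ^ 2 := by ring
  have hpow : ∀ k, 1 ≤ Y ^ k := fun k => one_le_pow₀ hY
  have hceil : ∀ k, Y ^ k ≤ (⌈Y ^ k⌉₊ : ℝ) ∧ (⌈Y ^ k⌉₊ : ℝ) ≤ 2 * Y ^ k ∧ 0 < ⌈Y ^ k⌉₊ := by
    intro k
    refine ⟨Nat.le_ceil _, ?_, Nat.ceil_pos.2 (by linarith [hpow k])⟩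
    linarith [hpow k, Nat.ceil_lt_add_one (show 0 ≤ Y ^ k by positivity)]
  obtain ⟨hK1l, hK1u, hK1⟩ := hceil 10
  obtain ⟨hK2l, hK2u, hK2⟩ := hceil 20
  set K₁ := ⌈Y ^ 10⌉₊
  set K₂ := ⌈Y ^ 20⌉₊
  have hK10 : (0 : ℝ) < K₁ := by exact_mod_cast hK1
  have hK20 : (0 : ℝ) < K₂ := by exact_mod_cast hK2
  have hNY : (N : ℝ) ≤ 2 * Y ^ 132 := by linarith [hpow 132]
  have hmono : ∀ {i j : ℕ}, i ≤ j → Y ^ i ≤ Y ^ j := fun h => pow_le_pow_right₀ hY h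
  have hdiv : ∀ (K : ℝ) (i j : ℕ), 0 < K → Y ^ i ≤ K → i + j = 132 → N / K ≤ 2 * Y ^ j := by
    intro K i j hK hiK hij
    rw [div_le_iff₀ hK]
    calc (N : ℝ) ≤ 2 * Y ^ j * Y ^ i := by rw [mul_assoc, ← pow_add, add_comm j, hij]; exact hNY
      _ ≤ _ := by gcongr
  have hE2 : (7776 * κ * (K₁ * K₂) * N + 2) * (2 * (r / κ + 1) + 2 / r) ≤ 373260 * Y ^ 112 := by
    have hr1 : 1 ≤ 1 / r := by
      rw [le_div_iff₀ hr0]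
      nlinarith [hpow 50]
    have hrκ : r / κ = 1 / r := by rw [← hr2]; field_simp
    have hri : 1 / r ≤ Y ^ 112 := by
      rw [div_le_iff₀ hr0]; linarith
    have h1 : 2 * (r / κ + 1) + 2 / r ≤ 6 * (1 / r) := by
      rw [hrκ, show 2 / r = 2 * (1 / r) by ring]
      linarith
    calc (7776 * κ * (K₁ * K₂) * N + 2) * (2 * (r / κ + 1) + 2 / r)
        ≤ (7776 * κ * ((2 * Y ^ 10) * (2 * Y ^ 20)) * (2 * Y ^ 132) + 2) * (6 * (1 / r)) := by
          gcongr
      _ = 373248 * (r * Y ^ 50) * Y ^ 112 + 12 * (1 / r) := by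
          rw [← hr2]; field_simp; ring
      _ ≤ 373248 * 1 * Y ^ 112 + 12 * Y ^ 112 := by gcongr
      _ = _ := by ring
  have key := norm_sum_unitExp_sq_le_of_fourth_diff (N := N) hK1 hK2 (lo := κ)
    (up := 7776 * κ * (K₁ * K₂)) (δ := r) (E₁ := 1222 * Y ^ 122) (E₂ := 373260 * Y ^ 112)
    (f := fun n : ℕ => T / (2 * π) *
      log ((((m₀ + n : ℤ) : ℝ) + l) / (((m₀ + n : ℤ) : ℝ) - l)))
    hκ0 (by positivity) hr0 ?_ hE2 (by positivity) ?_
  · refine (pow_le_pow_iff_left₀ (norm_nonneg _) (by positivity) two_ne_zero).1 (key.trans ?_)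
    have h1 := hdiv K₁ 10 122 hK10 hK1l rfl
    calc ((N : ℝ) + K₁) * (N / K₁ + 1222 * Y ^ 122)
        ≤ (2 * Y ^ 132 + 2 * Y ^ 132) * (2 * Y ^ 122 + 1222 * Y ^ 122) := by
          gcongr
          exact hK1u.trans (by gcongr 2 * ?_; exact hmono (by norm_num))
      _ = 4896 * Y ^ 254 := by ring
      _ ≤ 4900 * Y ^ 254 := by gcongr; norm_num
      _ = _ := by ring
  · intro h₁ h₂ n h1 h1K h2 h2K hn g hg
    have h10 : (1 : ℝ) ≤ h₁ := by exact_mod_cast h1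
    have h20 : (1 : ℝ) ≤ h₂ := by exact_mod_cast h2
    have := second_diff_log_ratio hT hM hl hlM hm₀ hN (fun _ => rfl) h1 h2 hn hg
    rw [← hκ] at this
    refine ⟨le_trans ?_ this.1, this.2.trans ?_⟩
    · exact le_mul_of_one_le_right hκ0.le (one_le_mul_of_one_le_of_one_le h10 h20)
    · gcongr
  · have h1 := hdiv K₂ 20 112 hK20 hK2l rfl
    calc ((N : ℝ) + K₂) * (N / K₂ + 373260 * Y ^ 112)
        ≤ (2 * Y ^ 132 + 2 * Y ^ 132) * (2 * Y ^ 112 + 373260 * Y ^ 112) := by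
          gcongr
          exact hK2u.trans (by gcongr 2 * ?_; exact hmono (by norm_num))
      _ = 1493048 * Y ^ 244 := by ring
      _ ≤ 1493284 * Y ^ 244 := by gcongr; norm_num
      _ = _ := by ring

lemma maxAbsSum_le {g : ℤ → ℂ} {a b R : ℝ} (hR : 0 ≤ R)
    (h : ∀ (m₀ : ℤ) (N : ℕ), a ≤ m₀ → (m₀ : ℝ) + N ≤ b + 1 →
      ‖∑ n ∈ Finset.range N, g (m₀ + n)‖ ≤ R) : maxAbsSum g a b ≤ R := by
  refine Real.sSup_le ?_ hR
  rintro _ ⟨c, d, hac, hcd, hdb, rfl⟩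
  have e : ∑ n ∈ Finset.Icc ⌈c⌉ ⌊d⌋, g n
      = ∑ n ∈ Finset.range (⌊d⌋ + 1 - ⌈c⌉).toNat, g (⌈c⌉ + n) := by
    symm
    refine Finset.sum_nbij' (fun n => ⌈c⌉ + n) (fun m => (m - ⌈c⌉).toNat) ?_ ?_ ?_ ?_ ?_ <;>
      simp only [Finset.mem_Icc, Finset.mem_range] <;> intros <;> first | omega | trivial
  rw [e]
  refine h _ _ (hac.trans (Int.le_ceil c)) ?_
  rcases le_total (⌊d⌋ + 1 - ⌈c⌉) 0 with h0 | h0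
  · rw [Int.toNat_of_nonpos h0]
    have := Int.ceil_lt_add_one c
    push_cast
    linarith
  · have : ((⌈c⌉ + (⌊d⌋ + 1 - ⌈c⌉).toNat : ℤ) : ℝ) = ((⌊d⌋ + 1 : ℤ) : ℝ) := by
      rw [Int.toNat_of_nonneg h0]
      congr 1
      ring
    push_cast at this
    rw [this]
    linarith [Int.floor_le d]

lemma Ytil_le {H M Q t R : ℝ} (hH : 0 < H) (hM : 0 < M) (hR : 0 ≤ R)
    (h : ∀ l : ℕ, 1 ≤ l → (l : ℝ) ≤ Q ^ 2 * M / H → ∀ (m₀ : ℤ) (N : ℕ), M ≤ m₀ →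
      (m₀ : ℝ) + N ≤ 2 * M + 1 → ‖∑ n ∈ Finset.range N, unitExp (t / (2 * π) *
      log ((((m₀ + n : ℤ) : ℝ) + l) / (((m₀ + n : ℤ) : ℝ) - l)))‖ ≤ R) :
    Ytil H M Q t ≤ Q ^ 2 * R := by
  have hnn : 0 ≤ Q ^ 2 * M / H := by positivity
  have h1 : ∀ l ∈ Finset.Icc 1 ⌊Q ^ 2 * M / H⌋₊,
      maxAbsSum (fun m => Complex.exp (2 * Real.pi * Complex.I *
        (t / (2 * Real.pi) * Real.log (((m : ℝ) + (l : ℝ)) / ((m : ℝ) - (l : ℝ))))))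
      M (2 * M) ≤ R := by
    intro l hl
    rw [Finset.mem_Icc] at hl
    refine maxAbsSum_le hR fun m₀ N hm₀ hN => ?_
    have := h l hl.1 ((Nat.le_floor_iff hnn).1 hl.2) m₀ N hm₀ hN
    simp only [unitExp] at this
    convert this using 6
    push_cast
    rfl
  calc Ytil H M Q t ≤ H / M * (⌊Q ^ 2 * M / H⌋₊ * R) := by
        refine mul_le_mul_of_nonneg_left ?_ (by positivity)
        refine (Finset.sum_le_card_nsmul _ _ _ h1).trans ?_
        simp
    _ ≤ H / M * (Q ^ 2 * M / H * R) := by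
        gcongr
        exact Nat.floor_le hnn
    _ = Q ^ 2 * R := by field_simp

lemma norm_sum_unitExp_abs_mul (N : ℕ) (t : ℝ) (a : ℕ → ℝ) :
    ‖∑ n ∈ Finset.range N, unitExp (t * a n)‖ = ‖∑ n ∈ Finset.range N, unitExp (|t| * a n)‖ := by
  rcases abs_choice t with h | h
  · rw [h]
  · rw [h, ← RCLike.norm_conj, map_sum]
    simp only [conj_unitExp, neg_mul]

lemma Ytil_le_of_large {X H Q M lam t ε : ℝ} (hX : 1 ≤ X) (hε : 0 < ε) (hε' : ε ≤ 1 / 1056)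
    (hH : H = X ^ (8 / 33 + ε)) (hQ : 1 ≤ Q) (hQX : 100 * Q ^ 4 ≤ X ^ ((1 : ℝ) / 528))
    (hM : X ^ (-(ε ^ 2)) * H ≤ M) (hM' : M ≤ X ^ ((1 : ℝ) / 4))
    (hlam : X ^ (-(1 / 6) - 2 * ε) ≤ lam) (hlam' : lam ≤ 1)
    (ht : Q ^ (-(1 / 2) : ℝ) * lam * X ≤ |t|) (ht' : |t| ≤ Q ^ ((1 / 2) : ℝ) * lam * X) :
    Ytil H M Q t ≤ X ^ ((8 : ℝ) / 33) := by
  have hX0 : 0 < X := by linarith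
  have hQ0 : 0 < Q := by linarith
  set Y := X ^ ((1 : ℝ) / 528) with hYdef
  have hYpow : ∀ k : ℕ, Y ^ k = X ^ ((k : ℝ) / 528) := by
    intro k
    rw [hYdef, ← rpow_natCast, ← rpow_mul hX0.le]
    congr 1
    ring
  have hmonoX : ∀ {a b : ℝ}, a ≤ b → X ^ a ≤ X ^ b := fun h => rpow_le_rpow_of_exponent_le hX h
  have hQpow : ∀ k, 1 ≤ Q ^ k := fun k => one_le_pow₀ hQ
  have hY100 : 100 ≤ Y := by linarith [hQpow 4]
  have hY : 1 ≤ Y := by linarith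
  have hY0 : 0 < Y := by linarith
  have h128 : X ^ ((8 : ℝ) / 33) = Y ^ 128 := by rw [hYpow]; norm_num
  have h132 : X ^ ((1 : ℝ) / 4) = Y ^ 132 := by rw [hYpow]; norm_num
  have h528 : X = Y ^ 528 := by rw [hYpow]; norm_num
  have hH128 : Y ^ 128 ≤ H := by
    rw [hH, hYpow]; exact hmonoX (by norm_num; linarith)
  have hM128 : Y ^ 128 ≤ M := by
    refine le_trans ?_ hM
    rw [hH, hYpow, ← rpow_add hX0]
    refine hmonoX ?_
    norm_num
    nlinarith
  rw [h132] at hM'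
  rw [h128]
  have hlam0 : 0 < lam := lt_of_lt_of_le (by positivity) hlam
  have hH0 : 0 < H := lt_of_lt_of_le (by positivity) hH128
  have hM0 : 0 < M := lt_of_lt_of_le (by positivity) hM128
  have hTup : |t| ≤ Q * Y ^ 528 := by
    refine ht'.trans ?_
    rw [← h528]
    have : Q ^ ((1 / 2) : ℝ) ≤ Q := by
      simpa using rpow_le_rpow_of_exponent_le hQ (show (1 / 2 : ℝ) ≤ 1 by norm_num)
    calc Q ^ ((1 / 2) : ℝ) * lam * X ≤ Q * 1 * X := by gcongr
      _ = Q * X := by ring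
  have hTlow : Y ^ 439 ≤ Q * |t| := by
    have h1 : Q⁻¹ ≤ Q ^ (-(1 / 2) : ℝ) := by
      rw [← rpow_neg_one]
      exact rpow_le_rpow_of_exponent_le hQ (by norm_num)
    have h2 : Y ^ 439 ≤ lam * X := by
      calc Y ^ 439 ≤ X ^ (-(1 / 6) - 2 * ε) * X := by
            rw [hYpow]
            nth_rewrite 3 [← rpow_one X]
            rw [← rpow_add hX0]
            refine hmonoX ?_
            norm_num
            linarith
        _ ≤ lam * X := by gcongr
    have h3 : Q⁻¹ * (lam * X) ≤ |t| := by
      refine le_trans ?_ ht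
      rw [mul_assoc]
      gcongr
    calc Y ^ 439 ≤ lam * X := h2
      _ = Q * (Q⁻¹ * (lam * X)) := by field_simp
      _ ≤ Q * |t| := by gcongr
  have hT : 0 < |t| := by
    by_contra hcon
    have : 0 < Y ^ 439 := by positivity
    nlinarith
  have hQ1 : Q ≤ Q ^ 4 := le_self_pow₀ hQ (by norm_num)
  have hQ2 : Q ^ 2 ≤ Q ^ 4 := pow_le_pow_right₀ hQ (by norm_num)
  have hQ3 : Q ^ 3 ≤ Q ^ 4 := pow_le_pow_right₀ hQ (by norm_num)
  refine (Ytil_le (R := 70 * Y ^ 127) hH0 hM0 (by positivity) ?_).trans ?_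
  · intro l hl hlQ m₀ N hm₀ hN
    have hl0 : (1 : ℝ) ≤ l := by exact_mod_cast hl
    have hlQ' : l * Y ^ 128 ≤ Q ^ 2 * M := by
      rw [le_div_iff₀ hH0] at hlQ
      exact le_trans (by gcongr) hlQ
    have key := norm_sum_unitExp_log_ratio_le (T := |t|) (M := M) (Y := Y) hT
      (by
        have : Y ≤ Y ^ 128 := le_self_pow₀ hY (by norm_num)
        linarith) hY hM' hl ?_ ?_ ?_ hm₀ hN
    · simp only [div_eq_mul_inv, mul_assoc] at key ⊢
      rw [norm_sum_unitExp_abs_mul N t]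
      exact key
    · have h1 : Y ≤ Y ^ 128 := le_self_pow₀ hY (by norm_num)
      have h2 : 2 * Q ^ 2 ≤ Y ^ 128 := by linarith [hQpow 2]
      have h3 : l * (2 * Q ^ 2) ≤ Q ^ 2 * M := le_trans (by gcongr) hlQ'
      nlinarith [hQpow 2]
    · have hpi := pi_gt_three
      have h1 : |t| / (2 * π) * (48 * l / (3 * M) ^ 5) * Y ^ 100
          = 8 / (81 * π) * (|t| * l * Y ^ 100 / M ^ 5) := by
        field_simp
        norm_num
      have h2 : |t| * l * Y ^ 100 / M ^ 5 ≤ 1 := by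
        rw [div_le_one (by positivity)]
        refine le_of_mul_le_mul_right ?_ (show 0 < Y ^ 128 by positivity)
        calc |t| * l * Y ^ 100 * Y ^ 128 = |t| * (l * Y ^ 128) * Y ^ 100 := by ring
          _ ≤ (Q * Y ^ 528) * (Q ^ 2 * M) * Y ^ 100 := by gcongr
          _ = Q ^ 3 * Y ^ 628 * M := by ring
          _ ≤ Y * Y ^ 628 * M := by
              gcongr
              linarith [hQpow 3]
          _ = Y ^ 629 * M := by ring
          _ ≤ Y ^ 640 * M := by gcongr; norm_num
          _ = (Y ^ 128) ^ 4 * M * Y ^ 128 := by ring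
          _ ≤ M ^ 4 * M * Y ^ 128 := by gcongr
          _ = M ^ 5 * Y ^ 128 := by ring
      have h3 : 8 / (81 * π) ≤ 1 := by
        rw [div_le_one (by positivity)]; linarith
      rw [h1]
      exact mul_le_one₀ h3 (by positivity) h2
    · have hpi := pi_lt_four
      have hpi0 := pi_pos
      have h1 : |t| / (2 * π) * (48 * l / (3 * M) ^ 5) * Y ^ 224
          = 8 / (81 * π) * (|t| * l * Y ^ 224 / M ^ 5) := by
        field_simp
        norm_num
      have h2 : 100 ≤ |t| * l * Y ^ 224 / M ^ 5 := by
        rw [le_div_iff₀ (by positivity)]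
        refine le_of_mul_le_mul_left ?_ hQ0
        calc Q * (100 * M ^ 5) = (100 * Q) * M ^ 5 := by ring
          _ ≤ Y * (Y ^ 132) ^ 5 := by
              gcongr
              linarith
          _ = Y ^ 661 := by ring
          _ ≤ Y ^ 663 := by gcongr; norm_num
          _ = Y ^ 439 * 1 * Y ^ 224 := by ring
          _ ≤ (Q * |t|) * l * Y ^ 224 := by gcongr
          _ = _ := by ring
      have h3 : 1 / 100 ≤ 8 / (81 * π) := by
        rw [div_le_div_iff₀ (by norm_num) (by positivity)]; linarith
      rw [h1]
      calc (1 : ℝ) = 1 / 100 * 100 := by norm_num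
        _ ≤ _ := by gcongr
  · calc Q ^ 2 * (70 * Y ^ 127) = 70 * Q ^ 2 * Y ^ 127 := by ring
      _ ≤ Y * Y ^ 127 := by
          gcongr
          linarith [hQpow 2]
      _ = Y ^ 128 := by ring

lemma Ytil_le_trivial {H M Q t : ℝ} (hH : 0 < H) (hM : 0 < M) :
    Ytil H M Q t ≤ Q ^ 2 * (M + 1) := by
  refine Ytil_le hH hM (by positivity) fun l _ _ m₀ N hm₀ hN => ?_
  refine (norm_sum_le _ _).trans ?_
  simp only [norm_unitExp, Finset.sum_const, Finset.card_range, nsmul_eq_mul, mul_one]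
  linarith

/-- **Pointwise bound for maximal exponential sums with phase `log((m+ℓ)/(m−ℓ))`
via the van der Corput exponent pair `(1/14, 2/7)` (key Type `d₄` estimate).** -/
theorem type_d4_pointwise_bound :
    ∃ ε₀ C₀ : ℝ, 0 < ε₀ ∧ ∀ ε : ℝ, 0 < ε → ε ≤ ε₀ → ∀ B : ℝ, 0 < B →
    ∃ C : ℝ, ∀ X H Q M₁ lam : ℝ, 2 ≤ X →
      H = X ^ (8 / 33 + ε) → Q = Real.log X ^ B →
      X ^ (-(ε ^ 2)) * H ≤ M₁ → M₁ ≤ X ^ ((1 : ℝ) / 4) →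
      X ^ (-(1 / 6) - 2 * ε) ≤ lam → lam ≤ 1 →
      ∀ t' : ℝ, Q ^ (-(1 / 2) : ℝ) * lam * X ≤ |t'| → |t'| ≤ Q ^ ((1 / 2) : ℝ) * lam * X →
        Ytil H M₁ Q t' ≤ C * X ^ (-ε + C₀ * ε ^ 2) * H := by
  refine ⟨1 / 1056, 0, by norm_num, fun ε hε hε' B hB => ?_⟩
  obtain ⟨X₀, hX₀0, hX₀⟩ : ∃ X₀ : ℝ, 0 < X₀ ∧ ∀ X ≥ X₀,
      1 ≤ log X ∧ 100 * (log X ^ B) ^ 4 ≤ X ^ ((1 : ℝ) / 528) := by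
    have h1 := (isLittleO_log_rpow_rpow_atTop (B * 4)
      (show (0 : ℝ) < 1 / 528 by norm_num)).bound (show (0 : ℝ) < 1 / 100 by norm_num)
    have h2 := tendsto_log_atTop.eventually_ge_atTop (1 : ℝ)
    suffices h : ∀ᶠ X in Filter.atTop, 1 ≤ log X ∧
        100 * (log X ^ B) ^ 4 ≤ X ^ ((1 : ℝ) / 528) by
      obtain ⟨X₀, hX₀⟩ := Filter.eventually_atTop.1 h
      exact ⟨max X₀ 1, by positivity, fun X hX => hX₀ X (le_of_max_le_left hX)⟩
    filter_upwards [h1, h2, Filter.eventually_ge_atTop (1 : ℝ)] with X hX hX' hX1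
    refine ⟨hX', ?_⟩
    have hl : 0 ≤ log X := by linarith
    rw [norm_of_nonneg (by positivity), norm_of_nonneg (by positivity), rpow_mul hl] at hX
    have e : (log X ^ B) ^ (4 : ℝ) = (log X ^ B) ^ 4 := by exact_mod_cast rpow_natCast _ 4
    rw [e] at hX
    linarith
  refine ⟨1 + (log X₀ ^ B) ^ 2 * (X₀ ^ ((1 : ℝ) / 4) + 1), ?_⟩
  intro X H Q M lam hX hH hQ hM hM' hlam hlam' t ht ht'
  have hX0 : 0 < X := by linarith
  have hrhs : X ^ (-ε + 0 * ε ^ 2) * H = X ^ ((8 : ℝ) / 33) := by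
    rw [hH, ← rpow_add hX0]
    congr 1
    ring
  rw [mul_assoc, hrhs]
  have hlogX : 0 ≤ log X := log_nonneg (by linarith)
  rcases le_total X₀ X with h | h
  · obtain ⟨h1, h2⟩ := hX₀ X h
    have hQ1 : 1 ≤ Q := by
      rw [hQ]
      exact one_le_rpow h1 hB.le
    refine (Ytil_le_of_large (by linarith) hε hε' hH hQ1 (hQ ▸ h2) hM hM' hlam hlam'
      ht ht').trans ?_
    refine le_mul_of_one_le_left (by positivity) ?_
    have : 0 ≤ (log X₀ ^ B) ^ 2 * (X₀ ^ ((1 : ℝ) / 4) + 1) := by positivity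
    linarith
  · have hH0 : 0 < H := by rw [hH]; positivity
    have hM0 : 0 < M := lt_of_lt_of_le (by positivity) hM
    have hQ0 : 0 ≤ Q := by rw [hQ]; positivity
    refine (Ytil_le_trivial hH0 hM0).trans ?_
    have h1 : (1 : ℝ) ≤ X ^ ((8 : ℝ) / 33) := one_le_rpow (by linarith) (by norm_num)
    have h2 : Q ≤ log X₀ ^ B := by
      rw [hQ]
      gcongr
    have h3 : M ≤ X₀ ^ ((1 : ℝ) / 4) := hM'.trans (by gcongr)
    calc Q ^ 2 * (M + 1) ≤ (log X₀ ^ B) ^ 2 * (X₀ ^ ((1 : ℝ) / 4) + 1) := by gcongr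
      _ ≤ (1 + (log X₀ ^ B) ^ 2 * (X₀ ^ ((1 : ℝ) / 4) + 1)) * 1 := by linarith
      _ ≤ _ := by gcongr
end
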